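/- arXiv:2307.04204 — 7 statements merged into one kernel-verified Lean document; each statement's English description precedes it below -/
import Mathlib

section
/- Let r : ℝ → ℝ satisfy Assumption (R). Define p* = sup{p ≥ 0 : x·r'(x)/r(x) > -1 for all x with |x| ≤ p} and c = r(p*) (with c = 0 if p* = ∞). For q > 0 consider the map f_q : ℝ → ℝ, f_q(p) = p(1 - 2r(p)/q). Then: (i) if q > 1, the point p = 0 is a stable fixed point of f_q, i.e. f_q(0) = 0 and |f_q'(0)| < 1; (ii) if c < q < 1, then p = 0 is an unstable fixed point (|f_q'(0)| > 1) and {r̂(q), -r̂(q)} is a stable period-2 orbit of f_q, i.e. f_q(r̂(q)) = -r̂(q), f_q(-r̂(q)) = r̂(q), and |f_q'(r̂(q)) · f_q'(-r̂(q))| < 1. -/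
open Filter
open scoped Classical

noncomputable section

/-- Assumption (R): `r` is even, continuously differentiable, `r 0 = 1`, `r' 0 = 0`,
`r' p < 0` for `p > 0`, and `r → 0` at `±∞`. -/
def AssumptionR (r : ℝ → ℝ) : Prop :=
  (∀ p, r (-p) = r p) ∧ ContDiff ℝ 1 r ∧ r 0 = 1 ∧ deriv r 0 = 0 ∧
  (∀ p, 0 < p → deriv r p < 0) ∧
  Tendsto r atTop (nhds 0) ∧ Tendsto r atBot (nhds 0)

/-- Period-doubling bifurcation of the one-parameter family of maps
`f_q (p) = p * (1 - 2 * r p / q)`. -/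
theorem bifurcation_of_fq (r : ℝ → ℝ) (rhat : ℝ → ℝ) (c : ℝ)
    (hR : AssumptionR r)
    (hrhat : ∀ q : ℝ, 0 < q → q ≤ 1 → 0 ≤ rhat q ∧ r (rhat q) = q)
    (hc : c = if BddAbove {p : ℝ | 0 ≤ p ∧ ∀ x : ℝ, |x| ≤ p → x * deriv r x / r x > -1}
        then r (sSup {p : ℝ | 0 ≤ p ∧ ∀ x : ℝ, |x| ≤ p → x * deriv r x / r x > -1})
        else 0) :
    (∀ q : ℝ, 1 < q →
      (fun p : ℝ => p * (1 - 2 * r p / q)) 0 = 0 ∧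
      |deriv (fun p : ℝ => p * (1 - 2 * r p / q)) 0| < 1) ∧
    (∀ q : ℝ, c < q → q < 1 →
      (fun p : ℝ => p * (1 - 2 * r p / q)) 0 = 0 ∧
      |deriv (fun p : ℝ => p * (1 - 2 * r p / q)) 0| > 1 ∧
      (fun p : ℝ => p * (1 - 2 * r p / q)) (rhat q) = -(rhat q) ∧
      (fun p : ℝ => p * (1 - 2 * r p / q)) (-(rhat q)) = rhat q ∧
      |deriv (fun p : ℝ => p * (1 - 2 * r p / q)) (rhat q) *
        deriv (fun p : ℝ => p * (1 - 2 * r p / q)) (-(rhat q))| < 1) := by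
  obtain ⟨heven, hC, h0, hd0, hneg, htop, -⟩ := hR
  have hdiff : Differentiable ℝ r := hC.differentiable (by norm_num)
  have hanti : StrictAntiOn r (Set.Ici 0) := by
    apply strictAntiOn_of_deriv_neg (convex_Ici 0) hdiff.continuous.continuousOn
    intro x hx
    rw [interior_Ici] at hx
    exact hneg x hx
  have hpos0 : ∀ x, 0 ≤ x → 0 < r x := by
    intro x hx
    have h1 : r (x + 1) < r x :=
      hanti (Set.mem_Ici.2 hx) (Set.mem_Ici.2 (by linarith)) (by linarith)
    have h2 : 0 ≤ r (x + 1) := by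
      apply le_of_tendsto htop
      filter_upwards [eventually_ge_atTop (x + 1)] with y hy
      exact hanti.antitoneOn (Set.mem_Ici.2 (by linarith)) (Set.mem_Ici.2 (by linarith)) hy
    linarith
  have hodd : ∀ x, deriv r (-x) = -deriv r x := by
    intro x
    have h1 : deriv (fun y => r (-y)) x = -deriv r (-x) := deriv_comp_neg r x
    have h2 : (fun y => r (-y)) = r := funext heven
    rw [h2] at h1
    linarith
  have hderiv : ∀ q x : ℝ, deriv (fun p : ℝ => p * (1 - 2 * r p / q)) x
      = (1 - 2 * r x / q) + x * (-(2 * deriv r x / q)) := by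
    intro q x
    have h1 : HasDerivAt r (deriv r x) x := (hdiff x).hasDerivAt
    have h2 := (hasDerivAt_id x).mul (((h1.const_mul 2).div_const q).const_sub 1)
    have h3 := h2.deriv
    simp only [id, one_mul] at h3
    exact h3
  have hc0 : 0 ≤ c := by
    rw [hc]
    split_ifs with h
    · exact (hpos0 _ (Real.sSup_nonneg (fun p hp => hp.1))).le
    · exact le_rfl
  refine ⟨?_, ?_⟩
  · intro q hq
    refine ⟨by simp, ?_⟩
    rw [hderiv, h0, abs_lt]
    have hq0 : 0 < q := by linarith
    have h1 : 2 * 1 / q < 2 := by rw [div_lt_iff₀ hq0]; linarith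
    have h2 : 0 < 2 * 1 / q := by positivity
    constructor <;> linarith
  · intro q hcq hq
    have hq0 : 0 < q := by linarith
    obtain ⟨hp0, hpq⟩ := hrhat q hq0 hq.le
    set p := rhat q with hp
    have hppos : 0 < p := by
      rcases hp0.lt_or_eq with h | h
      · exact h
      · rw [← h, h0] at hpq; linarith
    have hu : p * deriv r p / r p > -1 := by
      have hex : ∃ s ∈ {p : ℝ | 0 ≤ p ∧ ∀ x : ℝ, |x| ≤ p → x * deriv r x / r x > -1},
          p < s := by
        by_cases hb : BddAbove {p : ℝ | 0 ≤ p ∧ ∀ x : ℝ, |x| ≤ p → x * deriv r x / r x > -1}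
        · rw [if_pos hb] at hc
          have hlt : p < sSup {p : ℝ | 0 ≤ p ∧ ∀ x : ℝ, |x| ≤ p → x * deriv r x / r x > -1} := by
            by_contra hcon
            have := hanti.antitoneOn
              (Set.mem_Ici.2 (Real.sSup_nonneg (fun p hp => hp.1))) (Set.mem_Ici.2 hp0)
              (not_lt.1 hcon)
            rw [← hc, hpq] at this
            linarith
          apply exists_lt_of_lt_csSup _ hlt
          by_contra hne
          rw [Set.not_nonempty_iff_eq_empty] at hne
          rw [hne, Real.sSup_empty] at hlt
          linarith
        · exact not_bddAbove_iff.1 hb p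
      obtain ⟨s, hs, hps⟩ := hex
      exact hs.2 p (by rw [abs_of_pos hppos]; exact hps.le)
    rw [hpq] at hu
    have hu2 : p * deriv r p / q < 0 :=
      div_neg_of_neg_of_pos (mul_neg_of_pos_of_neg hppos (hneg p hppos)) hq0
    have hqq : 2 * q / q = 2 := by field_simp
    refine ⟨by simp, ?_, ?_, ?_, ?_⟩
    · rw [hderiv, h0, gt_iff_lt, lt_abs]
      right
      have h1 : 2 < 2 * 1 / q := by rw [lt_div_iff₀ hq0]; linarith
      linarith
    · simp only [hpq, hqq]; ring
    · simp only [heven, hpq, hqq]; ring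
    · rw [hderiv, hderiv, heven, hodd, hpq, hqq]
      have e1 : (1 - 2 : ℝ) + p * (-(2 * deriv r p / q)) = -1 - 2 * (p * deriv r p / q) := by ring
      have e2 : (1 - 2 : ℝ) + -p * (-(2 * -deriv r p / q)) = -1 - 2 * (p * deriv r p / q) := by
        ring
      rw [e1, e2, abs_lt]
      constructor <;> nlinarith
end
end

section
/- Let η ∈ (0, 2/33), and suppose the initialization (p₀, q₀) of the reparameterized GD dynamics satisfies |p₀| ≤ 1 and q₀ ∈ (2/(2-η), min{1/(16η), r(1)/(2η)}). Then p_t converges to 0, the sequence (q_t) converges to a limit q*, and q₀ ≤ q* ≤ exp(Cη²)·q₀ ≤ 2q₀, where C = 8q₀ · [min{2(q₀-1)/q₀, r(1)/(2q₀)}]^{-1}. -/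
open Filter
open scoped Classical

noncomputable section

/-- Assumption (L): `l` is convex, even, 1-Lipschitz, twice differentiable, `l'' 0 = 1`. -/
def AssumptionL (l : ℝ → ℝ) : Prop :=
  ConvexOn ℝ Set.univ l ∧ (∀ x, l (-x) = l x) ∧ LipschitzWith 1 l ∧
  (∀ x, DifferentiableAt ℝ l x) ∧ (∀ x, DifferentiableAt ℝ (deriv l) x) ∧
  deriv (deriv l) 0 = 1

/-- Assumption (R2). -/
def AssumptionR2 (r : ℝ → ℝ) : Prop :=
  ContDiff ℝ 4 r ∧
  StrictAnti (fun z => deriv r z / (r z) ^ 2) ∧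
  StrictAntiOn (fun z => z * deriv r z / r z) (Set.Ioi 0) ∧
  StrictMonoOn (fun z => z * deriv r z / r z) (Set.Iio 0) ∧
  StrictAntiOn (fun z => z * r z / deriv r z) (Set.Ioi 0) ∧
  StrictMonoOn (fun z => z * r z / deriv r z) (Set.Iio 0)

/-- The reparameterized GD dynamics for the two-layer fully-connected linear network. -/
def LinDyn (r : ℝ → ℝ) (η : ℝ) (p q : ℕ → ℝ) : Prop :=
  (∀ t, p (t + 1) = (1 - 2 * r (p t) / q t + η ^ 2 * (p t) ^ 2 * (r (p t)) ^ 2) * p t) ∧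
  (∀ t, q (t + 1) = (1 - η ^ 2 * (p t) ^ 2 * r (p t) * (2 * q t - r (p t)))⁻¹ * q t)

/-- `z₀ = sup {z : z r'(z)/r(z) ≥ -1/2}`. -/
def zZero (r : ℝ → ℝ) : ℝ := sSup {z : ℝ | z * deriv r z / r z ≥ -(1 / 2)}

/-- `c₀ = max {r(z₀), 1/2}`. -/
def cZero (r : ℝ → ℝ) : ℝ := max (r (zZero r)) (1 / 2)

/-- The function `h` of Theorem (EoS regime, Phase I). -/
def hFun (r : ℝ → ℝ) (p : ℝ) : ℝ :=
  if p = 0 then -(1 / (2 * deriv (deriv r) 0))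
  else -(1 / 2) * (p * (r p) ^ 3 / deriv r p + p ^ 2 * (r p) ^ 2)


lemma r_bounds_aux (r : ℝ → ℝ) (hR : AssumptionR r) (x : ℝ) (hx : |x| ≤ 1) :
    r 1 ≤ r x ∧ r x ≤ 1 := by
  obtain ⟨heven, hC, h0, -, hneg, -, -⟩ := hR
  have hanti : StrictAntiOn r (Set.Ici 0) := by
    apply strictAntiOn_of_deriv_neg (convex_Ici 0) hC.continuous.continuousOn
    intro y hy
    rw [interior_Ici] at hy
    exact hneg y hy
  have hab : r x = r |x| := by
    rcases abs_cases x with ⟨h, _⟩ | ⟨h, _⟩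
    · rw [h]
    · rw [h, heven]
  rw [hab]
  constructor
  · exact hanti.antitoneOn (abs_nonneg x) (by simp : (1:ℝ) ∈ Set.Ici 0) hx
  · rw [← h0]
    exact hanti.antitoneOn (by simp : (0:ℝ) ∈ Set.Ici 0) (abs_nonneg x) (abs_nonneg x)

/-- contraction factor bound -/
lemma p_step_aux (η Q m ρ s q x : ℝ) (hη : 0 < η) (hη1 : η < 2 / 33) (hQ : 1 < Q)
    (hQη : Q * η < 1 / 16) (hm1 : m ≤ 2 * (Q - 1) / Q) (hm2 : m ≤ ρ / (2 * Q))
    (hρ : 0 < ρ) (hs : ρ ≤ s) (hs1 : s ≤ 1) (hq : Q ≤ q) (hq2 : q ≤ 2 * Q) (hx : |x| ≤ 1) :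
    |1 - 2 * s / q + η ^ 2 * x ^ 2 * s ^ 2| ≤ 1 - m := by
  have hQ0 : 0 < Q := by linarith
  have hq0 : 0 < q := by linarith
  have hx2 : x ^ 2 ≤ 1 := (sq_le_one_iff_abs_le_one x).2 hx
  have hs0 : 0 < s := by linarith
  have e1 : 2 * s / q ≤ 2 / Q := by
    rw [div_le_div_iff₀ hq0 hQ0]; nlinarith
  have e2 : 2 * (Q - 1) / Q = 2 - 2 / Q := by field_simp
  have e3 : s / Q ≤ 2 * s / q := by
    rw [div_le_div_iff₀ hQ0 hq0]; nlinarith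
  have e4 : ρ / (2 * Q) ≤ s / (2 * Q) := by gcongr
  have e5 : s / Q = s / (2 * Q) + s / (2 * Q) := by field_simp; ring
  have e6 : η ^ 2 * x ^ 2 * s ^ 2 ≤ s / (2 * Q) := by
    rw [le_div_iff₀ (by positivity)]
    have h1 : η ^ 2 * x ^ 2 * s ^ 2 ≤ η ^ 2 * 1 * (s * 1) := by
      have : s ^ 2 ≤ s * 1 := by nlinarith
      gcongr
    have h2 : η ^ 2 * (2 * Q) ≤ 1 := by nlinarith
    calc η ^ 2 * x ^ 2 * s ^ 2 * (2 * Q) ≤ η ^ 2 * 1 * (s * 1) * (2 * Q) := by gcongr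
      _ = s * (η ^ 2 * (2 * Q)) := by ring
      _ ≤ s * 1 := by gcongr
      _ = s := by ring
  have e7 : 0 ≤ η ^ 2 * x ^ 2 * s ^ 2 := by positivity
  rw [abs_le]
  constructor <;> linarith

lemma exp_aux (d : ℝ) (h0 : 0 ≤ d) (h1 : d ≤ 1 / 2) : (1 - d)⁻¹ ≤ Real.exp (2 * d) := by
  have h := Real.add_one_le_exp (2 * d)
  rw [inv_le_iff_one_le_mul₀ (by linarith)]
  nlinarith

lemma q_step_aux (η Q s q x : ℝ) (hη : 0 < η) (hη1 : η < 2 / 33) (hQ : 1 < Q)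
    (hQη : Q * η < 1 / 16) (hs : 0 < s) (hs1 : s ≤ 1) (hq : Q ≤ q) (hq2 : q ≤ 2 * Q)
    (hx : |x| ≤ 1) :
    q ≤ (1 - η ^ 2 * x ^ 2 * s * (2 * q - s))⁻¹ * q ∧
    (1 - η ^ 2 * x ^ 2 * s * (2 * q - s))⁻¹ * q ≤ Real.exp (8 * Q * η ^ 2 * |x|) * q := by
  have hx2 : x ^ 2 ≤ |x| := by
    rw [← sq_abs]; nlinarith [abs_nonneg x]
  have hx0 := abs_nonneg x
  set d := η ^ 2 * x ^ 2 * s * (2 * q - s) with hd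
  have hqs : 0 ≤ 2 * q - s := by linarith
  have d0 : 0 ≤ d := by positivity
  have d1 : d ≤ 4 * Q * η ^ 2 * |x| := by
    calc d ≤ η ^ 2 * |x| * 1 * (4 * Q) := by
          rw [hd]
          have : 2 * q - s ≤ 4 * Q := by linarith
          gcongr
      _ = _ := by ring
  have d2 : d ≤ 1 / 2 := by
    have h3 : 4 * Q * η ^ 2 * |x| ≤ 4 * Q * η ^ 2 * 1 := by gcongr
    nlinarith
  have hq0 : 0 ≤ q := by linarith
  constructor
  · apply le_mul_of_one_le_left hq0
    rw [one_le_inv₀ (by linarith)]; linarith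
  · apply mul_le_mul_of_nonneg_right _ hq0
    refine (exp_aux d d0 d2).trans ?_
    apply Real.exp_le_exp.2
    linarith

lemma exp_aux_rev (K : ℝ) (h : K ≤ 1 / 2) : Real.exp K ≤ 2 := by
  have h1 := Real.add_one_le_exp (-K)
  rw [Real.exp_neg] at h1
  have h2 : (2:ℝ)⁻¹ ≤ (Real.exp K)⁻¹ := by linarith
  exact (inv_le_inv₀ (by norm_num) (Real.exp_pos K)).1 h2

/-- Gradient flow regime for the two-layer fully-connected linear network. -/
theorem gradient_flow_regime_linear (l r : ℝ → ℝ) (η : ℝ) (p q : ℕ → ℝ)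
    (hL : AssumptionL l)
    (hr0 : r 0 = 1) (hrdef : ∀ x : ℝ, x ≠ 0 → r x = deriv l x / x)
    (hR : AssumptionR r)
    (hdyn : LinDyn r η p q)
    (hη : η ∈ Set.Ioo (0 : ℝ) (2 / 33))
    (hp0 : |p 0| ≤ 1)
    (hq0 : q 0 ∈ Set.Ioo (2 / (2 - η)) (min (1 / (16 * η)) (r 1 / (2 * η)))) :
    Tendsto p atTop (nhds 0) ∧
    ∃ qstar : ℝ, Tendsto q atTop (nhds qstar) ∧
      q 0 ≤ qstar ∧
      qstar ≤ Real.exp ((8 * q 0 * (min (2 * (q 0 - 1) / q 0) (r 1 / (2 * q 0)))⁻¹) * η ^ 2) * q 0 ∧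
      Real.exp ((8 * q 0 * (min (2 * (q 0 - 1) / q 0) (r 1 / (2 * q 0)))⁻¹) * η ^ 2) * q 0 ≤ 2 * q 0 := by
  obtain ⟨hη0, hη1⟩ := hη
  obtain ⟨hqlo, hqhi⟩ := hq0
  obtain ⟨hdp, hdq⟩ := hdyn
  obtain ⟨hqh1, hqh2⟩ := lt_min_iff.1 hqhi
  set Q := q 0 with hQdef
  have h2η : 0 < 2 - η := by linarith
  have hQlo : 2 < Q * (2 - η) := (div_lt_iff₀ h2η).1 hqlo
  have hQ0 : 0 < Q := lt_trans (by positivity) hqlo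
  have hQ : 1 < Q := by nlinarith
  have hQη : Q * η < 1 / 16 := by
    have := (lt_div_iff₀ (by positivity)).1 hqh1
    linarith
  have hQρ : Q * (2 * η) < r 1 := (lt_div_iff₀ (by positivity)).1 hqh2
  have hρ : 0 < r 1 := lt_trans (by positivity) hQρ
  have hρ1 : r 1 ≤ 1 := (r_bounds_aux r hR 1 (by simp)).2
  set m := min (2 * (Q - 1) / Q) (r 1 / (2 * Q)) with hm
  have hm1 : m ≤ 2 * (Q - 1) / Q := min_le_left _ _
  have hm2 : m ≤ r 1 / (2 * Q) := min_le_right _ _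
  have hηm : η < m := by
    apply lt_min
    · rw [lt_div_iff₀ hQ0]; nlinarith
    · rw [lt_div_iff₀ (by positivity)]; linarith
  have hm0 : 0 < m := by linarith
  have hmlt : m < 1 := by
    refine lt_of_le_of_lt hm2 ?_
    rw [div_lt_one (by positivity)]; linarith
  set K := 8 * Q * m⁻¹ * η ^ 2 with hK
  have hKm : K * m = 8 * Q * η ^ 2 := by rw [hK]; field_simp
  have hK0 : 0 ≤ K := by positivity
  have hKhalf : K ≤ 1 / 2 := by
    by_contra hcon
    push Not at hcon
    nlinarith
  have hexp : Real.exp K ≤ 2 := by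
    have h := exp_aux_rev K hKhalf
    exact h
  have key : ∀ t, |p t| ≤ (1 - m) ^ t ∧ Q ≤ q t ∧
      q t ≤ Real.exp (K * (1 - (1 - m) ^ t)) * Q := by
    intro t
    induction t with
    | zero => exact ⟨by simpa using hp0, le_rfl, by simp [← hQdef]⟩
    | succ t ih =>
      obtain ⟨ih1, ih2, ih3⟩ := ih
      have hpow0 : 0 ≤ (1 - m) ^ t := pow_nonneg (by linarith) t
      have hpow : (1 - m) ^ t ≤ 1 := pow_le_one₀ (by linarith) (by linarith)
      have hpt : |p t| ≤ 1 := ih1.trans hpow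
      have hqt : q t ≤ 2 * Q := by
        refine ih3.trans (mul_le_mul_of_nonneg_right (le_trans ?_ hexp) hQ0.le)
        apply Real.exp_le_exp.2
        nlinarith
      obtain ⟨hs, hs1⟩ := r_bounds_aux r hR (p t) hpt
      have hA := p_step_aux η Q m (r 1) (r (p t)) (q t) (p t) hη0 hη1 hQ hQη hm1 hm2 hρ hs hs1
        ih2 hqt hpt
      obtain ⟨hB, hC⟩ := q_step_aux η Q (r (p t)) (q t) (p t) hη0 hη1 hQ hQη
        (lt_of_lt_of_le hρ hs) hs1 ih2 hqt hpt
      rw [← hdq t] at hB hC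
      have hqt0 : 0 ≤ q t := by linarith
      refine ⟨?_, ih2.trans hB, hC.trans ?_⟩
      · rw [hdp t, abs_mul, pow_succ' (1 - m) t]
        exact mul_le_mul hA ih1 (abs_nonneg _) (by linarith)
      · calc Real.exp (8 * Q * η ^ 2 * |p t|) * q t
            ≤ Real.exp (8 * Q * η ^ 2 * (1 - m) ^ t) *
              (Real.exp (K * (1 - (1 - m) ^ t)) * Q) := by gcongr
          _ = Real.exp (K * (1 - (1 - m) ^ (t + 1))) * Q := by
              rw [← mul_assoc, ← Real.exp_add, ← hKm]
              congr 2
              ring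
  have hle : ∀ t, q t ≤ Real.exp K * Q := by
    intro t
    refine (key t).2.2.trans (mul_le_mul_of_nonneg_right (Real.exp_le_exp.2 ?_) hQ0.le)
    have hpow0 : 0 ≤ (1 - m) ^ t := pow_nonneg (by linarith) t
    nlinarith
  have hmono : Monotone q := by
    apply monotone_nat_of_le_succ
    intro t
    have hpt : |p t| ≤ 1 := (key t).1.trans (pow_le_one₀ (by linarith) (by linarith))
    obtain ⟨hs, hs1⟩ := r_bounds_aux r hR (p t) hpt
    have hqt : q t ≤ 2 * Q := (hle t).trans (mul_le_mul_of_nonneg_right hexp hQ0.le)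
    have hB := (q_step_aux η Q (r (p t)) (q t) (p t) hη0 hη1 hQ hQη
        (lt_of_lt_of_le hρ hs) hs1 (key t).2.1 hqt hpt).1
    rwa [← hdq t] at hB
  constructor
  · exact squeeze_zero_norm (fun t => (key t).1)
      (tendsto_pow_atTop_nhds_zero_of_lt_one (by linarith) (by linarith))
  · have hbdd : BddAbove (Set.range q) := ⟨_, by rintro _ ⟨t, rfl⟩; exact hle t⟩
    have hlim := tendsto_atTop_ciSup hmono hbdd
    exact ⟨_, hlim, le_ciSup hbdd 0, ciSup_le hle, mul_le_mul_of_nonneg_right hexp hQ0.le⟩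
end
end

section
/- There exist constants η₀ > 0, c > 0, C > 0 depending only on δ and ℓ such that for every step size η ∈ (0, η₀) the following holds. Suppose the initialization satisfies |p₀| ≤ 1 and q₀ ∈ (c₀, 1-δ), and suppose p_t ≠ 0 for every t with q_t < 1. Then there exists a time step t_b ≥ c(1-q₀)η^{-2} such that q_{t_b} ≤ 1 and q_t > 1 for all t > t_b. Moreover p_t converges to 0, q_t converges to a limit q*, and |q* − 1 + η²/(2r''(0))| ≤ C η⁴. -/
open Filter
open scoped Classical

noncomputable section

/-- A `C¹` function vanishing at `0` is `O(x)` on `[0, M]`. -/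
lemma aux_lin (f : ℝ → ℝ) (hf : ContDiff ℝ 1 f) (h0 : f 0 = 0) (M : ℝ) :
    ∃ C, 0 ≤ C ∧ ∀ x, 0 ≤ x → x ≤ M → |f x| ≤ C * x := by
  have hc : Continuous (deriv f) := hf.continuous_deriv le_rfl
  obtain ⟨C, hC⟩ := (isCompact_Icc (a := (0:ℝ)) (b := M)).exists_bound_of_continuousOn
    hc.continuousOn
  refine ⟨max C 0, le_max_right _ _, fun x hx hxM => ?_⟩
  have h := Convex.norm_image_sub_le_of_norm_deriv_le (f := f) (C := max C 0)
    (s := Set.Icc 0 M) (x := 0) (y := x)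
    (fun y _ => (hf.differentiable one_ne_zero) y)
    (fun y hy => (hC y hy).trans (le_max_left _ _)) (convex_Icc 0 M)
    ⟨le_rfl, hx.trans hxM⟩ ⟨hx, hxM⟩
  simpa [h0, abs_of_nonneg hx] using h

/-- If `|f'| ≤ C x` on `[0, M]`, then `f` is Lipschitz as a function of `x²`. -/
lemma aux_sqlip (f : ℝ → ℝ) (hf : Differentiable ℝ f) (C M : ℝ) (hC : 0 ≤ C)
    (hd : ∀ x, 0 ≤ x → x ≤ M → |deriv f x| ≤ C * x) :
    ∀ a b, 0 ≤ a → a ≤ M → 0 ≤ b → b ≤ M → |f a - f b| ≤ C * |a ^ 2 - b ^ 2| := by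
  have key : ∀ a b, 0 ≤ a → a ≤ b → b ≤ M → |f b - f a| ≤ C * |b ^ 2 - a ^ 2| := by
    intro a b ha hab hb
    have h := Convex.norm_image_sub_le_of_norm_deriv_le (f := f) (C := C * b)
      (s := Set.Icc 0 b) (x := a) (y := b)
      (fun y _ => hf y)
      (fun y hy => (hd y hy.1 (hy.2.trans hb)).trans
        (mul_le_mul_of_nonneg_left hy.2 hC)) (convex_Icc 0 b)
      ⟨ha, hab⟩ ⟨ha.trans hab, le_rfl⟩
    rw [Real.norm_eq_abs, Real.norm_eq_abs, abs_of_nonneg (sub_nonneg.2 hab)] at h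
    rw [abs_of_nonneg (by nlinarith : 0 ≤ b ^ 2 - a ^ 2)]
    refine h.trans ?_
    rw [mul_assoc]
    apply mul_le_mul_of_nonneg_left _ hC
    nlinarith
  intro a b ha haM hb hbM
  rcases le_total a b with h | h
  · rw [abs_sub_comm, abs_sub_comm (a ^ 2)]; exact key a b ha h hbM
  · exact key b a hb h haM

/-- Functions that are Lipschitz in `x²` on `[0, M]`, and bounded there. -/
def SqLip (M : ℝ) (f : ℝ → ℝ) : Prop :=
  ∃ C, 0 ≤ C ∧ (∀ a, 0 ≤ a → a ≤ M → |f a| ≤ C) ∧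
    ∀ a b, 0 ≤ a → a ≤ M → 0 ≤ b → b ≤ M → |f a - f b| ≤ C * |a ^ 2 - b ^ 2|

lemma SqLip.mk' (M : ℝ) (hM : 0 ≤ M) (f : ℝ → ℝ) (C : ℝ) (hC : 0 ≤ C)
    (h : ∀ a b, 0 ≤ a → a ≤ M → 0 ≤ b → b ≤ M → |f a - f b| ≤ C * |a ^ 2 - b ^ 2|) :
    SqLip M f := by
  refine ⟨|f 0| + C * M ^ 2 + C, by positivity, fun a ha haM => ?_, fun a b h1 h2 h3 h4 => ?_⟩
  · have := h a 0 ha haM le_rfl hM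
    have h2 : |a ^ 2 - 0 ^ 2| ≤ M ^ 2 := by
      rw [abs_of_nonneg (by simpa using sq_nonneg a)]; nlinarith
    have h3 := abs_sub_abs_le_abs_sub (f a) (f 0)
    have := mul_le_mul_of_nonneg_left h2 hC
    linarith
  · refine (h a b h1 h2 h3 h4).trans (mul_le_mul_of_nonneg_right ?_ (abs_nonneg _))
    have := abs_nonneg (f 0)
    have : 0 ≤ C * M ^ 2 := by positivity
    linarith

lemma SqLip.mul {M : ℝ} {f g : ℝ → ℝ} (hf : SqLip M f) (hg : SqLip M g) :
    SqLip M (fun x => f x * g x) := by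
  obtain ⟨C, hC, hb, hl⟩ := hf
  obtain ⟨D, hD, hb', hl'⟩ := hg
  refine ⟨2 * (C * D), by positivity, fun a h1 h2 => ?_, fun a b h1 h2 h3 h4 => ?_⟩
  · rw [abs_mul]
    have := mul_le_mul (hb a h1 h2) (hb' a h1 h2) (abs_nonneg _) hC
    have : 0 ≤ C * D := by positivity
    linarith
  · have e : f a * g a - f b * g b = f a * (g a - g b) + (f a - f b) * g b := by ring
    rw [e]
    refine (abs_add_le _ _).trans ?_
    rw [abs_mul, abs_mul]
    have h5 := mul_le_mul (hb a h1 h2) (hl' a b h1 h2 h3 h4) (abs_nonneg _) hC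
    have h6 := mul_le_mul (hl a b h1 h2 h3 h4) (hb' b h3 h4) (abs_nonneg _) (by positivity)
    nlinarith

lemma SqLip.add {M : ℝ} {f g : ℝ → ℝ} (hf : SqLip M f) (hg : SqLip M g) :
    SqLip M (fun x => f x + g x) := by
  obtain ⟨C, hC, hb, hl⟩ := hf
  obtain ⟨D, hD, hb', hl'⟩ := hg
  refine ⟨C + D, by positivity, fun a h1 h2 => ?_, fun a b h1 h2 h3 h4 => ?_⟩
  · have := abs_add_le (f a) (g a)
    have := hb a h1 h2
    have := hb' a h1 h2
    linarith
  · have e : f a + g a - (f b + g b) = (f a - f b) + (g a - g b) := by ring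
    rw [e]
    refine (abs_add_le _ _).trans ?_
    have := hl a b h1 h2 h3 h4
    have := hl' a b h1 h2 h3 h4
    linarith

lemma SqLip.const (M : ℝ) (hM : 0 ≤ M) (k : ℝ) : SqLip M (fun _ => k) :=
  SqLip.mk' M hM _ 0 le_rfl (by intros; simp)

lemma SqLip.sq (M : ℝ) (hM : 0 ≤ M) : SqLip M (fun x => x ^ 2) :=
  SqLip.mk' M hM _ 1 zero_le_one (by intros; simp)

lemma SqLip.inv {M : ℝ} (hM : 0 ≤ M) {f : ℝ → ℝ} (hf : SqLip M f) (c : ℝ) (hc : 0 < c)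
    (hl : ∀ a, 0 ≤ a → a ≤ M → c ≤ |f a|) :
    SqLip M (fun x => (f x)⁻¹) := by
  obtain ⟨C, hC, hb, hl'⟩ := hf
  refine SqLip.mk' M hM _ (C / c ^ 2) (by positivity) fun a b h1 h2 h3 h4 => ?_
  have ha := hl a h1 h2
  have hb := hl b h3 h4
  have ha0 : f a ≠ 0 := fun h => by simp [h] at ha; linarith
  have hb0 : f b ≠ 0 := fun h => by simp [h] at hb; linarith
  have e : (f a)⁻¹ - (f b)⁻¹ = (f b - f a) / (f a * f b) := by field_simp
  rw [e, abs_div, abs_mul, abs_sub_comm, div_mul_eq_mul_div]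
  apply div_le_div₀ (by positivity) (hl' a b h1 h2 h3 h4) (by positivity)
  nlinarith

lemma SqLip.of_deriv (f : ℝ → ℝ) (hf : Differentiable ℝ f) (M : ℝ) (hM : 0 ≤ M)
    (hf' : ContDiff ℝ 1 (deriv f)) (h0 : deriv f 0 = 0) : SqLip M f := by
  obtain ⟨C, hC, h⟩ := aux_lin (deriv f) hf' h0 M
  exact SqLip.mk' M hM f C hC (aux_sqlip f hf C M hC h)

lemma aux_deriv_even (f : ℝ → ℝ) (hf : ∀ x, f (-x) = f x) (x : ℝ) :
    deriv f (-x) = - deriv f x := by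
  have h := deriv_comp_neg f (-x)
  have e : (fun x => f (-x)) = f := funext hf
  rw [e, neg_neg] at h
  linarith

lemma aux_deriv_odd (f : ℝ → ℝ) (hf : ∀ x, f (-x) = - f x) (x : ℝ) :
    deriv f (-x) = deriv f x := by
  have h := deriv_comp_neg f (-x)
  have e : (fun x => f (-x)) = fun x => - f x := funext hf
  rw [e, neg_neg] at h
  simp at h
  linarith

lemma aux_contDiff_deriv (f : ℝ → ℝ) (n : ℕ) (hf : ContDiff ℝ ((n + 1 : ℕ)) f) :
    ContDiff ℝ n (deriv f) := by
  have : ContDiff ℝ ((n : ℕ∞) + 1 : WithTop ℕ∞) f := by exact_mod_cast hf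
  exact (contDiff_succ_iff_deriv.1 this).2.2

/-- `G(p) = r'(p)/p`, `G(0) = r''(0)`, is Lipschitz in `p²`. -/
lemma aux_G (r : ℝ → ℝ) (hr : ContDiff ℝ 4 r) (hev : ∀ p, r (-p) = r p) (M : ℝ) (hM : 0 ≤ M) :
    SqLip M (fun p => if p = 0 then deriv (deriv r) 0 else deriv r p / p) := by
  have h1 : ContDiff ℝ 3 (deriv r) := aux_contDiff_deriv r 3 (by exact_mod_cast hr)
  have h2 : ContDiff ℝ 2 (deriv (deriv r)) := aux_contDiff_deriv _ 2 (by exact_mod_cast h1)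
  have h3 : ContDiff ℝ 1 (deriv (deriv (deriv r))) :=
    aux_contDiff_deriv _ 1 (by exact_mod_cast h2)
  have o1 := aux_deriv_even r hev
  have o2 := aux_deriv_odd _ o1
  have o3 := aux_deriv_even _ o2
  have z1 : deriv r 0 = 0 := by have := o1 0; simp at this; linarith
  have z3 : deriv (deriv (deriv r)) 0 = 0 := by have := o3 0; simp at this; linarith
  obtain ⟨C, hC, hb, hl⟩ := SqLip.of_deriv (deriv (deriv r)) (h2.differentiable two_ne_zero)
    M hM h3 z3
  have d1 : Differentiable ℝ (deriv r) := h1.differentiable three_ne_zero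
  set G : ℝ → ℝ := fun p => if p = 0 then deriv (deriv r) 0 else deriv r p / p with hG
  -- the interpolating function
  have hφ : ∀ a t : ℝ, HasDerivAt (fun t => if a = 0 then deriv (deriv r) 0 * t
      else deriv r (t * a) / a) (deriv (deriv r) (t * a)) t := by
    intro a t
    by_cases ha : a = 0
    · simp only [ha, if_true, mul_zero]
      simpa using (hasDerivAt_id t).const_mul (deriv (deriv r) 0)
    · simp only [ha, if_false]
      have := ((d1 (t * a)).hasDerivAt.comp t ((hasDerivAt_id t).mul_const a)).div_const a
      simpa [ha, Function.comp_def] using this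
  refine SqLip.mk' M hM G C hC fun a b ha haM hb' hbM => ?_
  have h := Convex.norm_image_sub_le_of_norm_hasDerivWithin_le
    (f := fun t => (if a = 0 then deriv (deriv r) 0 * t else deriv r (t * a) / a) -
      (if b = 0 then deriv (deriv r) 0 * t else deriv r (t * b) / b))
    (f' := fun t => deriv (deriv r) (t * a) - deriv (deriv r) (t * b))
    (C := C * |a ^ 2 - b ^ 2|) (s := Set.Icc (0:ℝ) 1) (x := 0) (y := 1)
    (fun t _ => ((hφ a t).sub (hφ b t)).hasDerivWithinAt) ?_ (convex_Icc 0 1)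
    (by simp) (by simp)
  · simpa [hG, z1] using h
  · intro t ht
    obtain ⟨ht0, ht1⟩ := ht
    have := hl (t * a) (t * b) (by positivity) (by nlinarith) (by positivity) (by nlinarith)
    rw [Real.norm_eq_abs]
    refine this.trans (mul_le_mul_of_nonneg_left ?_ hC)
    have e : (t * a) ^ 2 - (t * b) ^ 2 = t ^ 2 * (a ^ 2 - b ^ 2) := by ring
    rw [e, abs_mul, abs_of_nonneg (by positivity)]
    have : t ^ 2 ≤ 1 := by nlinarith
    nlinarith [abs_nonneg (a ^ 2 - b ^ 2)]

/-- All the analytic facts on `r` that the dynamical part needs. -/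
structure Pack (r : ℝ → ℝ) (z0 z1 M m c D : ℝ) : Prop where
  m_pos : 0 < m
  m_le : m ≤ 1
  c_pos : 0 < c
  D_ge : 1 ≤ D
  z0_pos : 0 < z0
  z01 : z0 < z1
  M_ge : 2 * z1 + 1 ≤ M
  r_ge : ∀ P, 0 ≤ P → P ≤ M → m ≤ r P
  r_le : ∀ P, r P ≤ 1
  r_pos : ∀ P, 0 < r P
  r_even : ∀ P, r (-P) = r P
  r_anti : ∀ a b, 0 ≤ a → a < b → r b < r a
  r_cont : Continuous r
  r_zero : r 0 = 1
  R_low : ∀ a b, 0 ≤ a → a ≤ b → b ≤ M → c * (b ^ 2 - a ^ 2) ≤ (r b)⁻¹ - (r a)⁻¹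
  r_up : ∀ P, 0 ≤ P → P ≤ M → 1 - r P ≤ D * P ^ 2
  taylor : ∀ a b, 0 ≤ a → a ≤ M → 0 ≤ b → b ≤ M →
    |(r b)⁻¹ - (r a)⁻¹ + deriv r a / (r a) ^ 2 * (b - a)| ≤ D * (b - a) ^ 2
  th_low : ∀ P, 0 ≤ P → P ≤ M → c * P ^ 2 ≤ - (P * deriv r P / r P)
  th_up : ∀ P, 0 ≤ P → P ≤ z1 → - (P * deriv r P / r P) ≤ 3 / 4
  h_lip : ∀ a b, 0 ≤ a → a ≤ M → 0 ≤ b → b ≤ M → |hFun r a - hFun r b| ≤ D * |a ^ 2 - b ^ 2|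
  h_bd : ∀ a, 0 ≤ a → a ≤ M → |hFun r a| ≤ D
  h_id : ∀ P, 0 ≤ P → P ≤ M → 2 * (- (P * deriv r P / r P)) * hFun r P =
    P ^ 2 * (r P) ^ 2 * (1 - (- (P * deriv r P / r P)))
  mono : ∀ q P, r z0 < q → q < 1 → 0 ≤ P → q ≤ r P → q ≤ r ((2 * r P / q - 1) * P)
  h_zero : hFun r 0 = - (1 / (2 * deriv (deriv r) 0))
  h_zero_pos : 0 < hFun r 0

lemma exists_pack (r : ℝ → ℝ) (hR : AssumptionR r) (hR2 : AssumptionR2 r)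
    (hc0 : cZero r < 1) : ∃ z1 M m c D, Pack r (zZero r) z1 M m c D := by
  obtain ⟨hev, hC1, hr0, hd0, hdneg, htop, -⟩ := hR
  obtain ⟨hC4, hA1, hA2, -, hA3, -⟩ := hR2
  have hcont : Continuous r := hC4.continuous
  have hdiff : Differentiable ℝ r := hC4.differentiable (by norm_num)
  have hd1 : ContDiff ℝ 3 (deriv r) := aux_contDiff_deriv r 3 (by exact_mod_cast hC4)
  have hd1c : Continuous (deriv r) := hd1.continuous
  have hdd : Differentiable ℝ (deriv r) := hd1.differentiable three_ne_zero
  have hd2c : Continuous (deriv (deriv r)) := hd1.continuous_deriv (by norm_num)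
  have hanti : ∀ a b, 0 ≤ a → a < b → r b < r a := by
    have : StrictAntiOn r (Set.Ici 0) := by
      apply strictAntiOn_of_deriv_neg (convex_Ici 0) hcont.continuousOn
      intro x hx
      rw [interior_Ici] at hx
      exact hdneg x hx
    intro a b ha hab
    exact this ha (ha.trans hab.le) hab
  have hpos0 : ∀ P, 0 ≤ P → 0 < r P := by
    intro P hP
    have h1 := hanti P (P + 1) hP (by linarith)
    have h2 : 0 ≤ r (P + 1) := by
      apply le_of_tendsto htop
      filter_upwards [eventually_gt_atTop (P + 1)] with x hx
      exact (hanti _ x (by linarith) hx).le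
    linarith
  have hle0 : ∀ P, 0 ≤ P → r P ≤ 1 := by
    intro P hP
    rcases hP.eq_or_lt with h | h
    · rw [← h, hr0]
    · rw [← hr0]; exact (hanti 0 P le_rfl h).le
  have habs : ∀ P, r P = r |P| := by
    intro P
    rcases abs_cases P with ⟨h, -⟩ | ⟨h, -⟩ <;> rw [h]
    exact (hev P).symm
  have hpos : ∀ P, 0 < r P := fun P => by rw [habs]; exact hpos0 _ (abs_nonneg _)
  have hle : ∀ P, r P ≤ 1 := fun P => by rw [habs]; exact hle0 _ (abs_nonneg _)
  -- z0
  have hφc : Continuous (fun z => z * deriv r z / r z) :=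
    (continuous_id.mul hd1c).div hcont (fun x => (hpos x).ne')
  have hz0r : r (zZero r) < 1 := lt_of_le_of_lt (le_max_left _ _) hc0
  have hz0ne : zZero r ≠ 0 := fun h => by rw [h, hr0] at hz0r; exact lt_irrefl _ hz0r
  set S := {z : ℝ | z * deriv r z / r z ≥ -(1 / 2)} with hS
  have hbdd : BddAbove S := by
    by_contra h
    exact hz0ne (by unfold zZero; exact Real.sSup_of_not_bddAbove h)
  have h0S : (0:ℝ) ∈ S := by simp [hS]
  have hSc : IsClosed S := isClosed_le continuous_const hφc
  have hz0S : zZero r ∈ S := hSc.csSup_mem ⟨0, h0S⟩ hbdd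
  have hz0nn : 0 ≤ zZero r := le_csSup hbdd h0S
  have hz0p : 0 < zZero r := lt_of_le_of_ne hz0nn (Ne.symm hz0ne)
  set z0 := zZero r with hz0
  have hφz0 : -(1 / 2) ≤ z0 * deriv r z0 / r z0 := hz0S
  have hφle : ∀ P, 0 ≤ P → P ≤ z0 → -(1 / 2) ≤ P * deriv r P / r P := by
    intro P hP hPz
    rcases hP.eq_or_lt with h | h
    · rw [← h]; norm_num
    rcases hPz.eq_or_lt with h' | h'
    · rw [h']; exact hφz0
    · exact hφz0.trans (hA2 h hz0p h').le
  -- z1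
  obtain ⟨z1, hz01, hz1⟩ : ∃ z1, z0 < z1 ∧ -(3 / 4) ≤ z1 * deriv r z1 / r z1 := by
    have h1 : ∀ᶠ z in nhds z0, -(3 / 4) < z * deriv r z / r z :=
      hφc.continuousAt.eventually (lt_mem_nhds (by linarith))
    have h2 := (h1.filter_mono (nhdsWithin_le_nhds (s := Set.Ioi z0))).and
      (self_mem_nhdsWithin (s := Set.Ioi z0))
    obtain ⟨z, hz, hz'⟩ := h2.exists
    exact ⟨z, hz', hz.le⟩
  have hz1p : 0 < z1 := hz0p.trans hz01
  have hφle1 : ∀ P, 0 ≤ P → P ≤ z1 → -(P * deriv r P / r P) ≤ 3 / 4 := by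
    intro P hP hPz
    rcases hP.eq_or_lt with h | h
    · rw [← h]; norm_num
    rcases hPz.eq_or_lt with h' | h'
    · rw [h']; linarith
    · have := (hA2 h hz1p h').le
      simp only at this
      linarith
  set M := 2 * z1 + 1 with hMdef
  have hM : 0 < M := by linarith
  set m := r M with hmdef
  have hm : 0 < m := hpos M
  have hrge : ∀ P, 0 ≤ P → P ≤ M → m ≤ r P := by
    intro P hP hPM
    rcases hPM.eq_or_lt with h | h
    · rw [h]
    · exact (hanti P M hP h).le
  -- lower bound on -r'
  have hdM := hdneg M hM
  set B := M * r M / (- deriv r M) with hB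
  have hBp : 0 < B := by
    have : 0 < - deriv r M := by linarith
    have := hpos M
    positivity
  have hdlow : ∀ P, 0 ≤ P → P ≤ M → (m / B) * P ≤ - deriv r P := by
    intro P hP hPM
    rcases hP.eq_or_lt with h | h
    · rw [← h, hd0]; simp
    have hdP := hdneg P h
    have h1 : M * r M / deriv r M ≤ P * r P / deriv r P := by
      rcases hPM.eq_or_lt with h' | h'
      · rw [h']
      · exact (hA3 h hM h').le
    have h2 : P * r P / (- deriv r P) ≤ B := by
      rw [hB, div_neg, div_neg]; linarith
    rw [div_le_iff₀ (by linarith)] at h2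
    rw [div_mul_eq_mul_div, div_le_iff₀ hBp]
    have := hrge P hP hPM
    nlinarith
  set c0 := m / B with hc0def
  have hc0p : 0 < c0 := by positivity
  -- R = 1/r
  have hRd : ∀ x, HasDerivAt (fun x => (r x)⁻¹) (-deriv r x / (r x) ^ 2) x := fun x =>
    (hdiff x).hasDerivAt.inv (hpos x).ne'
  have hRlow : ∀ a b, 0 ≤ a → a ≤ b → b ≤ M →
      c0 / 2 * (b ^ 2 - a ^ 2) ≤ (r b)⁻¹ - (r a)⁻¹ := by
    have hd : ∀ x, HasDerivAt (fun x => (r x)⁻¹ - c0 / 2 * x ^ 2)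
        (-deriv r x / (r x) ^ 2 - c0 / 2 * (2 * x)) x := by
      intro x
      have := (hRd x).sub ((hasDerivAt_pow 2 x).const_mul (c0 / 2))
      refine HasDerivAt.congr_deriv this ?_
      simp
    have hmono : MonotoneOn (fun x => (r x)⁻¹ - c0 / 2 * x ^ 2) (Set.Icc 0 M) := by
      apply monotoneOn_of_deriv_nonneg (convex_Icc 0 M)
      · exact fun x _ => (hd x).continuousAt.continuousWithinAt
      · exact fun x _ => (hd x).differentiableAt.differentiableWithinAt
      · intro x hx
        rw [interior_Icc] at hx
        rw [(hd x).deriv]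
        have h1 := hdlow x hx.1.le hx.2.le
        have h2 : -deriv r x ≤ -deriv r x / (r x) ^ 2 := by
          rw [le_div_iff₀ (pow_pos (hpos x) 2)]
          have h3 : (r x) ^ 2 ≤ 1 := pow_le_one₀ (hpos x).le (hle x)
          have h4 : 0 ≤ - deriv r x := by
            have := hdneg x hx.1
            linarith
          nlinarith
        linarith
    intro a b ha hab hb
    have := hmono (⟨ha, hab.trans hb⟩ : a ∈ Set.Icc 0 M) (⟨ha.trans hab, hb⟩ : b ∈ Set.Icc 0 M) hab
    simp only at this
    linarith
  -- upper bound
  obtain ⟨D1, hD1, hrlip'⟩ := aux_lin (deriv r) (hd1.of_le (by norm_num)) hd0 M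
  have hrlip := aux_sqlip r hdiff D1 M hD1 hrlip'
  -- Taylor
  have hRdd : ∀ x, HasDerivAt (fun x => -deriv r x / (r x) ^ 2)
      ((-deriv (deriv r) x * (r x) ^ 2 - (-deriv r x) * (2 * r x * deriv r x)) /
        ((r x) ^ 2) ^ 2) x := by
    intro x
    have h1 : HasDerivAt (fun x => (r x) ^ 2) (2 * r x * deriv r x) x := by
      refine HasDerivAt.congr_deriv ((hdiff x).hasDerivAt.pow 2) ?_
      simp
    exact (hdd x).hasDerivAt.neg.div h1 (pow_pos (hpos x) 2).ne'
  have hRddc : Continuous (fun x => (-deriv (deriv r) x * (r x) ^ 2 -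
      (-deriv r x) * (2 * r x * deriv r x)) / ((r x) ^ 2) ^ 2) := by
    apply Continuous.div
    · fun_prop
    · fun_prop
    · intro x; have := hpos x; positivity
  obtain ⟨D2, hD2⟩ := (isCompact_Icc (a := (0:ℝ)) (b := M)).exists_bound_of_continuousOn
    hRddc.continuousOn
  have htay : ∀ a b, 0 ≤ a → a ≤ M → 0 ≤ b → b ≤ M →
      |(r b)⁻¹ - (r a)⁻¹ + deriv r a / (r a) ^ 2 * (b - a)| ≤ D2 * (b - a) ^ 2 := by
    intro a b ha haM hb hbM
    have hsub : Set.uIcc a b ⊆ Set.Icc 0 M :=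
      Set.uIcc_subset_Icc ⟨ha, haM⟩ ⟨hb, hbM⟩
    have hD2n : 0 ≤ D2 := (norm_nonneg _).trans (hD2 a ⟨ha, haM⟩)
    have hlip : ∀ x ∈ Set.uIcc a b,
        ‖-deriv r x / (r x) ^ 2 - -deriv r a / (r a) ^ 2‖ ≤ D2 * |b - a| := by
      intro x hx
      have h := Convex.norm_image_sub_le_of_norm_hasDerivWithin_le
        (fun t _ => (hRdd t).hasDerivWithinAt) (fun t ht => hD2 t (hsub ht))
        (convex_uIcc a b) (Set.left_mem_uIcc) hx
      refine h.trans (mul_le_mul_of_nonneg_left ?_ hD2n)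
      rw [Real.norm_eq_abs]
      exact Set.abs_sub_left_of_mem_uIcc hx
    have h := Convex.norm_image_sub_le_of_norm_hasDerivWithin_le
        (f := fun x => (r x)⁻¹ - (-deriv r a / (r a) ^ 2) * x)
        (f' := fun x => -deriv r x / (r x) ^ 2 - -deriv r a / (r a) ^ 2)
        (fun t _ => ((hRd t).sub (by
          simpa using (hasDerivAt_id t).const_mul (-deriv r a / (r a) ^ 2))).hasDerivWithinAt)
        hlip (convex_uIcc a b) (Set.left_mem_uIcc) (Set.right_mem_uIcc)
    rw [Real.norm_eq_abs, Real.norm_eq_abs, mul_assoc, abs_mul_abs_self, ← sq] at h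
    refine le_trans (le_of_eq ?_) h
    congr 1
    ring
  -- h
  have hGn := aux_G r hC4 hev M hM.le
  set G : ℝ → ℝ := fun p => if p = 0 then deriv (deriv r) 0 else deriv r p / p with hG
  have hdd0 : deriv (deriv r) 0 ≤ -c0 := by
    have h1 : Tendsto (slope (deriv r) 0) (nhdsWithin 0 (Set.Ioi 0)) (nhds (deriv (deriv r) 0)) :=
      (hasDerivAt_iff_tendsto_slope.1 (hdd 0).hasDerivAt).mono_left
        (nhdsWithin_mono _ (fun x hx => ne_of_gt hx))
    apply le_of_tendsto h1
    filter_upwards [Ioo_mem_nhdsGT hM] with x hx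
    have := hdlow x hx.1.le hx.2.le
    rw [slope_def_field, hd0, sub_zero, sub_zero, div_le_iff₀ hx.1]
    linarith
  have hGlow : ∀ p, 0 ≤ p → p ≤ M → c0 ≤ |G p| := by
    intro p hp hpM
    rw [hG]
    simp only
    split_ifs with h
    · rw [abs_of_neg (by linarith)]; linarith
    · have hp' : 0 < p := lt_of_le_of_ne hp (Ne.symm h)
      have := hdlow p hp hpM
      have h2 := hdneg p hp'
      rw [abs_of_neg (div_neg_of_neg_of_pos h2 hp'), ← neg_div, le_div_iff₀ hp']
      exact this
  have hrS : SqLip M r := SqLip.mk' M hM.le r D1 hD1 hrlip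
  have hhS : SqLip M (hFun r) := by
    have h1 := ((hrS.mul (hrS.mul hrS)).mul (hGn.inv hM.le c0 hc0p hGlow)).add
      ((SqLip.sq M hM.le).mul (hrS.mul hrS))
    have h2 := (SqLip.const M hM.le (-(1 / 2))).mul h1
    convert h2 using 1
    funext p
    unfold hFun
    simp only [hG]
    split_ifs with h
    · subst h; rw [hr0]; simp; ring
    · rw [inv_div]; ring
  obtain ⟨D3, hD3, hhb, hhl⟩ := hhS
  have hthlow : ∀ P, 0 ≤ P → P ≤ M → c0 * P ^ 2 ≤ - (P * deriv r P / r P) := by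
    intro P hP hPM
    rw [← neg_div, le_div_iff₀ (hpos P)]
    have h1 := hdlow P hP hPM
    have h2 := hle P
    have h3 : c0 * P ^ 2 * r P ≤ c0 * P ^ 2 * 1 := by
      apply mul_le_mul_of_nonneg_left h2; positivity
    nlinarith
  refine ⟨z1, M, m, c0 / 2, max 1 (max D1 (max D2 D3)), ⟨hm, hle M, by positivity,
    le_max_left _ _, hz0p, hz01, le_rfl, hrge, hle, hpos, hev, hanti, hcont, hr0, hRlow, ?_, ?_,
    ?_, hφle1, ?_, ?_, ?_, ?_, ?_, ?_⟩⟩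
  · intro P hP hPM
    have := hrlip 0 P le_rfl hM.le hP hPM
    rw [hr0] at this
    have h2 := (le_abs_self _).trans this
    have h3 : |0 ^ 2 - P ^ 2| = P ^ 2 := by
      rw [abs_of_nonpos (by nlinarith [sq_nonneg P])]; ring
    rw [h3] at h2
    refine h2.trans (mul_le_mul_of_nonneg_right ?_ (sq_nonneg _))
    simp
  · intro a b h1 h2 h3 h4
    refine (htay a b h1 h2 h3 h4).trans (mul_le_mul_of_nonneg_right ?_ (sq_nonneg _))
    simp
  · intro P hP hPM
    refine le_trans ?_ (hthlow P hP hPM)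
    nlinarith [sq_nonneg P, mul_nonneg hc0p.le (sq_nonneg P)]
  · intro a b h1 h2 h3 h4
    refine (hhl a b h1 h2 h3 h4).trans (mul_le_mul_of_nonneg_right ?_ (abs_nonneg _))
    simp
  · intro a h1 h2
    refine (hhb a h1 h2).trans ?_
    simp
  · intro P hP hPM
    rcases hP.eq_or_lt with h | h
    · rw [← h]; simp
    · have h1 := (hdneg P h).ne
      have h2 := (hpos P).ne'
      unfold hFun
      rw [if_neg h.ne']
      field_simp
      ring
  · intro q P hq hq1 hP hqr
    have hqp : 0 < q := (hpos z0).trans hq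
    obtain ⟨ph, hph, hrph⟩ : q ∈ r '' Set.Icc 0 z0 := by
      apply intermediate_value_Icc' hz0p.le hcont.continuousOn
      exact ⟨hq.le, by rw [hr0]; exact hq1.le⟩
    have hPph : P ≤ ph := by
      by_contra h
      push Not at h
      have := hanti ph P hph.1 h
      linarith
    have hd : ∀ x, HasDerivAt (fun x => (2 * r x / q - 1) * x)
        (2 * deriv r x / q * x + (2 * r x / q - 1)) x := by
      intro x
      have := ((((hdiff x).hasDerivAt.const_mul 2).div_const q).sub_const 1).mul (hasDerivAt_id x)
      refine HasDerivAt.congr_deriv this ?_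
      simp
    have hmono : MonotoneOn (fun x => (2 * r x / q - 1) * x) (Set.Icc 0 ph) := by
      apply monotoneOn_of_deriv_nonneg (convex_Icc 0 ph)
      · exact fun x _ => (hd x).continuousAt.continuousWithinAt
      · exact fun x _ => (hd x).differentiableAt.differentiableWithinAt
      · intro x hx
        rw [interior_Icc] at hx
        rw [(hd x).deriv]
        have h1 := hφle x hx.1.le (hx.2.le.trans hph.2)
        have h2 := hanti x ph hx.1.le hx.2
        rw [le_div_iff₀ (hpos x)] at h1
        have e : 2 * deriv r x / q * x + (2 * r x / q - 1) =
          (2 * (x * deriv r x) + 2 * r x - q) / q := by field_simp; ring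
        rw [e]
        apply div_nonneg _ hqp.le
        linarith
    have h1 := hmono ⟨hP, hPph⟩ ⟨hph.1, le_rfl⟩ hPph
    simp only [hrph] at h1
    have h2 : (2 * r P / q - 1) * P ≤ ph := by
      have e : (2 * q / q - 1) * ph = ph := by field_simp; ring
      linarith
    have h3 : 0 ≤ (2 * r P / q - 1) * P := by
      apply mul_nonneg _ hP
      have : 2 * 1 ≤ 2 * r P / q := by rw [le_div_iff₀ hqp]; linarith
      linarith
    rcases h2.eq_or_lt with h | h
    · rw [h, hrph]
    · have := hanti _ _ h3 h
      linarith
  · simp [hFun]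
  · have : hFun r 0 = 1 / (2 * (- deriv (deriv r) 0)) := by
      simp only [hFun, if_true, mul_neg, div_neg]
    rw [this]
    have : 0 < - deriv (deriv r) 0 := by linarith
    positivity

/-- One step of the dynamics for `|p|`. -/
def nP (r : ℝ → ℝ) (k P q : ℝ) : ℝ := |1 - 2 * r P / q + k * P ^ 2 * (r P) ^ 2| * P

/-- One step of the dynamics for `q`. -/
def nQ (r : ℝ → ℝ) (k P q : ℝ) : ℝ := (1 - k * P ^ 2 * r P * (2 * q - r P))⁻¹ * q

lemma nP_nonneg (r : ℝ → ℝ) (k P q : ℝ) (hP : 0 ≤ P) : 0 ≤ nP r k P q :=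
  mul_nonneg (abs_nonneg _) hP

lemma step_q {r : ℝ → ℝ} {z0 z1 M m c D : ℝ} (H : Pack r z0 z1 M m c D) {k P q : ℝ}
    (hk : 0 < k) (hkM : 8 * k * M ^ 2 ≤ 1) (hP : 0 ≤ P) (hPM : P ≤ M)
    (hq : 1 / 2 < q) (hq2 : q ≤ 2) :
    q ≤ nQ r k P q ∧ nQ r k P q ≤ q + 16 * k * P ^ 2 ∧
    nQ r k P q ≤ q * (1 + 8 * k * P ^ 2) ∧
    q * (k * P ^ 2 * r P * (2 * q - r P)) ≤ nQ r k P q - q := by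
  have h1 := H.r_pos P
  have h2 := H.r_le P
  have hPM2 : P ^ 2 ≤ M ^ 2 := pow_le_pow_left₀ hP hPM 2
  set w := k * P ^ 2 * r P * (2 * q - r P) with hw
  have hkP : 0 ≤ k * P ^ 2 := by positivity
  have hw0 : 0 ≤ w := by
    apply mul_nonneg (by positivity); linarith
  have hw1 : w ≤ 4 * (k * P ^ 2) := by
    have e : r P * (2 * q - r P) ≤ 4 := by nlinarith
    have := mul_le_mul_of_nonneg_left e hkP
    rw [hw]; linarith
  have hkM' : k * P ^ 2 ≤ k * M ^ 2 := mul_le_mul_of_nonneg_left hPM2 hk.le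
  have hw2 : w ≤ 1 / 2 := by linarith
  have hpos : 0 < 1 - w := by linarith
  have hl : 1 + w ≤ (1 - w)⁻¹ := by
    rw [le_inv_comm₀ (by linarith) hpos, inv_eq_one_div, le_div_iff₀ (by linarith)]
    nlinarith
  have hu : (1 - w)⁻¹ ≤ 1 + 2 * w := by
    rw [inv_le_iff_one_le_mul₀ hpos]
    nlinarith
  have hQ : nQ r k P q = (1 - w)⁻¹ * q := rfl
  rw [hQ]
  have hq0 : 0 < q := by linarith
  have a1 := mul_le_mul_of_nonneg_right hl hq0.le
  have a2 := mul_le_mul_of_nonneg_right hu hq0.le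
  have a3 : 0 ≤ w * q := by positivity
  have a4 : w * q ≤ 4 * (k * P ^ 2) * q := mul_le_mul_of_nonneg_right hw1 hq0.le
  have a5 : (k * P ^ 2) * q ≤ (k * P ^ 2) * 2 := mul_le_mul_of_nonneg_left hq2 hkP
  refine ⟨by linarith, by linarith, by linarith, by linarith⟩

set_option maxHeartbeats 1000000 in
/-- Stage 1 : `s` well above `1`. -/
lemma step_one {r : ℝ → ℝ} {z0 z1 M m c D : ℝ} (H : Pack r z0 z1 M m c D) {k P q δ K c2 : ℝ}
    (hk : 0 < k) (hkM : 8 * k * M ^ 2 ≤ 1) (hP : 0 ≤ P) (hP1 : P ≤ 1)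
    (hq : 1 / 2 < q) (hδ : 0 < δ) (hq2 : q ≤ 1 - δ / 2)
    (hkm : k ≤ m) (hc2 : c2 = c * δ * m ^ 2 / (4 * D)) (hK : 16 / (m * c2) ≤ K)
    (hs : 1 + K * k < q / r P) :
    nP r k P q ≤ P ∧
    nQ r k P q / r (nP r k P q) ≤ q / r P - c2 / 2 * K * k := by
  have hm := H.m_pos
  have hm1 := H.m_le
  have hc := H.c_pos
  have hD := H.D_ge
  have hM1 : 1 ≤ M := by linarith [H.M_ge, H.z01, H.z0_pos]
  have hrP := H.r_pos P
  have hr1 := H.r_le P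
  have hrm := H.r_ge P hP (hP1.trans hM1)
  have hc2p : 0 < c2 := by rw [hc2]; positivity
  have hKp : 0 < K := lt_of_lt_of_le (by positivity) hK
  have hq0 : 0 < q := by linarith
  set s := q / r P with hsdef
  have hs1 : 1 < s := by nlinarith [mul_pos hKp hk]
  have hsr : s * r P = q := by rw [hsdef]; field_simp
  have hsm : s * m ≤ 1 := by
    have : s * m ≤ s * r P := mul_le_mul_of_nonneg_left hrm (by linarith)
    linarith
  -- P is bounded below
  have hP2 : δ / 2 ≤ D * P ^ 2 := by
    have h1 := H.r_up P hP (hP1.trans hM1)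
    have : r P ≤ q := by nlinarith
    linarith
  set a := 1 - 2 * r P / q + k * P ^ 2 * (r P) ^ 2 with ha
  have h2s : 2 * r P / q = 2 / s := by rw [hsdef]; field_simp
  have hv0 : 0 ≤ k * P ^ 2 * (r P) ^ 2 := by positivity
  have hv1 : k * P ^ 2 * (r P) ^ 2 ≤ k := by
    have e1 : P ^ 2 ≤ 1 := pow_le_one₀ hP hP1
    have e2 : (r P) ^ 2 ≤ 1 := pow_le_one₀ hrP.le hr1
    have := mul_le_one₀ e1 (sq_nonneg _) e2
    nlinarith
  have hinv : m ≤ 1 / s := by rw [le_div_iff₀ (by linarith)]; linarith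
  have h2s' : 2 / s = 2 * (1 / s) := by ring
  have hms : m ^ 2 * (s - 1) ≤ m := by nlinarith
  have habs : |a| ≤ 1 - m ^ 2 * (s - 1) := by
    rw [abs_le]
    constructor
    · rw [ha, h2s]
      have e : 2 / s = 2 - 2 * ((s - 1) * (1 / s)) := by field_simp; ring
      have : (s - 1) * m ≤ (s - 1) * (1 / s) := mul_le_mul_of_nonneg_left hinv (by linarith)
      have : m ^ 2 * (s - 1) ≤ m * (s - 1) :=
        mul_le_mul_of_nonneg_right (by nlinarith) (by linarith)
      have : 0 ≤ (s - 1) * m := mul_nonneg (by linarith) hm.le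
      linarith
    · rw [ha, h2s, h2s']
      linarith
  have hPn : nP r k P q = |a| * P := rfl
  have hms0 : 0 ≤ m ^ 2 * (s - 1) := mul_nonneg (by positivity) (by linarith)
  have ha1 : |a| ≤ 1 := by linarith
  have hle : nP r k P q ≤ P := by
    rw [hPn]; nlinarith
  refine ⟨hle, ?_⟩
  have hn0 := nP_nonneg r k P q hP
  have hR := H.R_low _ _ hn0 hle (hP1.trans hM1)
  have hsq : P ^ 2 * (m ^ 2 * (s - 1)) ≤ P ^ 2 - (nP r k P q) ^ 2 := by
    rw [hPn, mul_pow]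
    have e1 : |a| ^ 2 ≤ 1 - m ^ 2 * (s - 1) := by
      have e2 : |a| * |a| ≤ |a| * 1 := mul_le_mul_of_nonneg_left ha1 (abs_nonneg a)
      rw [sq]; linarith
    have e3 := mul_le_mul_of_nonneg_right e1 (sq_nonneg P)
    linarith
  obtain ⟨-, -, hQ, -⟩ := step_q H hk hkM hP (hP1.trans hM1) hq (by linarith)
  set R' := (r (nP r k P q))⁻¹ with hR'
  have hR'0 : 0 < R' := inv_pos.2 (H.r_pos _)
  have hqR : q * (r P)⁻¹ = s := by rw [hsdef]; field_simp
  have h3 : q * R' ≤ s - c2 * (s - 1) := by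
    have e1 : c * (P ^ 2 * (m ^ 2 * (s - 1))) ≤ (r P)⁻¹ - R' :=
      (mul_le_mul_of_nonneg_left hsq hc.le).trans hR
    have e2 : δ / (2 * D) ≤ P ^ 2 := by
      rw [div_le_iff₀ (by positivity)]; nlinarith
    have e3 : c2 * (s - 1) * 2 ≤ c * (P ^ 2 * (m ^ 2 * (s - 1))) := by
      have : c2 * (s - 1) * 2 = c * (δ / (2 * D) * (m ^ 2 * (s - 1))) := by
        rw [hc2]; field_simp; ring
      rw [this]
      apply mul_le_mul_of_nonneg_left _ hc.le
      exact mul_le_mul_of_nonneg_right e2 hms0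
    have e4 : c2 * (s - 1) * 2 ≤ (r P)⁻¹ - R' := e3.trans e1
    have e5 : 0 ≤ c2 * (s - 1) * 2 := by
      apply mul_nonneg (mul_nonneg hc2p.le (by linarith)) (by norm_num)
    have e6 : (1 / 2) * (c2 * (s - 1) * 2) ≤ q * ((r P)⁻¹ - R') :=
      mul_le_mul hq.le e4 e5 hq0.le
    linarith
  have h4 : nQ r k P q / r (nP r k P q) ≤ q * R' * (1 + 8 * k) := by
    rw [div_eq_mul_inv, ← hR']
    have e1 : P ^ 2 ≤ 1 := pow_le_one₀ hP hP1
    have e2 : nQ r k P q ≤ q * (1 + 8 * k) := by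
      refine hQ.trans (mul_le_mul_of_nonneg_left ?_ hq0.le)
      nlinarith
    calc _ ≤ q * (1 + 8 * k) * R' := mul_le_mul_of_nonneg_right e2 hR'0.le
      _ = _ := by ring
  have h5 : q * R' ≤ 1 / m := by
    have : 0 ≤ c2 * (s - 1) := mul_nonneg hc2p.le (by linarith)
    have : s ≤ 1 / m := by rw [le_div_iff₀ hm]; exact hsm
    linarith
  have h6 : q * R' * (8 * k) ≤ 1 / m * (8 * k) := mul_le_mul_of_nonneg_right h5 (by positivity)
  have h7 : 1 / m * 8 ≤ c2 / 2 * K := by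
    have : c2 / 2 * (16 / (m * c2)) ≤ c2 / 2 * K := mul_le_mul_of_nonneg_left hK (by positivity)
    have e : c2 / 2 * (16 / (m * c2)) = 1 / m * 8 := by field_simp; ring
    linarith
  have h8 : 1 / m * (8 * k) ≤ c2 / 2 * K * k := by nlinarith
  have h9 : c2 * (K * k) ≤ c2 * (s - 1) := mul_le_mul_of_nonneg_left (by linarith) hc2p.le
  linarith

set_option maxHeartbeats 1000000 in
/-- Stage 2 : `s` well below `1`. -/
lemma step_two {r : ℝ → ℝ} {z0 z1 M m c D : ℝ} (H : Pack r z0 z1 M m c D) {k P q K : ℝ}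
    (hk : 0 < k) (hkM : 8 * k * M ^ 2 ≤ 1) (hP : 0 ≤ P) (hPM : P ≤ M)
    (hq : 1 / 2 < q) (hqz : r z0 < q) (hq1 : q < 1)
    (hK : 8 * M ^ 2 ≤ K)
    (hs : q / r P < 1 - K * k) :
    P ≤ nP r k P q ∧ nP r k P q ≤ z0 ∧
    q / r P + c / 2 * K * k * P ^ 2 ≤ nQ r k P q / r (nP r k P q) ∧
    nQ r k P q / r (nP r k P q) ≤ 1 + K * k := by
  have hc := H.c_pos
  have hM1 : 1 ≤ M := by linarith [H.M_ge, H.z01, H.z0_pos]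
  have hrP := H.r_pos P
  have hr1 := H.r_le P
  have hKp : 0 < K := lt_of_lt_of_le (by positivity) hK
  have hKk : 0 < K * k := mul_pos hKp hk
  have hq0 : 0 < q := by linarith
  set s := q / r P with hsdef
  have hsr : s * r P = q := by rw [hsdef]; field_simp
  have hs0 : 0 < s := by positivity
  have hs1 : s < 1 := by linarith
  have hqr : q ≤ r P := by nlinarith
  set v := k * P ^ 2 * (r P) ^ 2 with hv
  have hv0 : 0 ≤ v := by positivity
  have hPM2 : P ^ 2 ≤ M ^ 2 := pow_le_pow_left₀ hP hPM 2
  have hvM : v ≤ k * M ^ 2 := by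
    have e2 : (r P) ^ 2 ≤ 1 := pow_le_one₀ hrP.le hr1
    have e3 : k * P ^ 2 ≤ k * M ^ 2 := mul_le_mul_of_nonneg_left hPM2 hk.le
    have : k * P ^ 2 * (r P) ^ 2 ≤ k * P ^ 2 * 1 := mul_le_mul_of_nonneg_left e2 (by positivity)
    linarith
  have h2s : 2 * r P / q = 2 / s := by rw [hsdef]; field_simp
  have h2s' : 2 + 2 * (1 - s) ≤ 2 / s := by
    rw [le_div_iff₀ hs0]; nlinarith
  have hPn : nP r k P q = (2 / s - 1 - v) * P := by
    have : nP r k P q = |1 - 2 * r P / q + v| * P := rfl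
    rw [this, h2s, abs_of_nonpos (by linarith)]
    ring
  have hKM : M ^ 2 * k ≤ K * k := mul_le_mul_of_nonneg_right (by nlinarith) hk.le
  have hfac : 1 + (1 - s) ≤ 2 / s - 1 - v := by linarith
  have h1 : P ≤ nP r k P q := by rw [hPn]; nlinarith
  have hn0 := nP_nonneg r k P q hP
  have hF := H.mono q P hqz hq1 hP hqr
  have hFle : nP r k P q ≤ (2 * r P / q - 1) * P := by
    rw [hPn, h2s]; nlinarith
  have hrn : q ≤ r (nP r k P q) := by
    rcases hFle.eq_or_lt with h | h
    · rw [h]; exact hF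
    · exact hF.trans (H.r_anti _ _ hn0 h).le
  have hz : nP r k P q ≤ z0 := by
    by_contra h
    push Not at h
    have := H.r_anti _ _ H.z0_pos.le h
    linarith
  refine ⟨h1, hz, ?_, ?_⟩
  · obtain ⟨hQ, -, -, -⟩ := step_q H hk hkM hP hPM hq (by linarith)
    have hR := H.R_low _ _ hP h1 (by linarith [H.M_ge, H.z01, H.z0_pos])
    have hsq : P ^ 2 * (1 - s) ≤ (nP r k P q) ^ 2 - P ^ 2 := by
      have e : (1 + (1 - s)) * P ≤ nP r k P q := by
        rw [hPn]; exact mul_le_mul_of_nonneg_right hfac hP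
      have e2 := pow_le_pow_left₀ (mul_nonneg (by linarith) hP) e 2
      have e3 : 0 ≤ P ^ 2 * (1 - s) := mul_nonneg (sq_nonneg _) (by linarith)
      have e4 : 0 ≤ P ^ 2 * (1 - s) ^ 2 := by positivity
      nlinarith
    rw [div_eq_mul_inv (nQ r k P q)]
    set R' := (r (nP r k P q))⁻¹ with hR'
    have hR'0 : 0 < R' := inv_pos.2 (H.r_pos _)
    have hqR : q * (r P)⁻¹ = s := by rw [hsdef]; field_simp
    have e1 : c * (P ^ 2 * (K * k)) ≤ R' - (r P)⁻¹ := by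
      refine le_trans (mul_le_mul_of_nonneg_left ?_ hc.le) hR
      exact (mul_le_mul_of_nonneg_left (by linarith) (sq_nonneg _)).trans hsq
    have e2 : 1 / 2 * (c * (P ^ 2 * (K * k))) ≤ q * (R' - (r P)⁻¹) :=
      mul_le_mul hq.le e1 (by positivity) hq0.le
    have e3 : q * R' ≤ nQ r k P q * R' := mul_le_mul_of_nonneg_right hQ hR'0.le
    linarith
  · obtain ⟨-, -, hQ, -⟩ := step_q H hk hkM hP hPM hq (by linarith)
    rw [div_le_iff₀ (H.r_pos _)]
    have e1 : 1 + 8 * k * P ^ 2 ≤ 1 + K * k := by nlinarith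
    calc nQ r k P q ≤ q * (1 + 8 * k * P ^ 2) := hQ
      _ ≤ q * (1 + K * k) := mul_le_mul_of_nonneg_left e1 hq0.le
      _ ≤ r (nP r k P q) * (1 + K * k) := mul_le_mul_of_nonneg_right hrn (by linarith)
      _ = _ := by ring

lemma aux_am (a k : ℝ) : a * k ≤ a ^ 2 + k ^ 2 := by
  nlinarith [sq_nonneg (a - k), sq_nonneg a, sq_nonneg k]

lemma aux_am2 (a k M : ℝ) : (3 * a + M ^ 2 * k) ^ 2 ≤ 2 * (9 * a ^ 2 + M ^ 4 * k ^ 2) := by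
  nlinarith [sq_nonneg (3 * a - M ^ 2 * k)]

lemma aux_om {w v : ℝ} (h0 : 0 ≤ w) (h1 : w ≤ 2 * v) (h2 : w ≤ 1 / 2) :
    w ^ 2 ≤ 8 * v ^ 2 * (1 - w) := by
  have e1 : w ^ 2 ≤ (2 * v) ^ 2 := pow_le_pow_left₀ h0 h1 2
  have e2 : v ^ 2 * (1 / 2) ≤ v ^ 2 * (1 - w) :=
    mul_le_mul_of_nonneg_left (by linarith) (sq_nonneg v)
  linarith

/-- Polynomial remainder bound. -/
lemma aux_poly {y v th om : ℝ} (hy : |y| ≤ 1 / 4) (hv : 0 ≤ v) (hv1 : v ≤ 1 / 2)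
    (hth : 0 ≤ th) (hth1 : th ≤ 1) (hom : |om| ≤ 8 * v ^ 2) :
    |(1 + y - 2 * th * y - th * (1 + y) * v) * (1 + v + 2 * y * v + om)
      - 1 - (1 - 2 * th) * y - v * (1 - th)| ≤ 40 * (|y| * v + v ^ 2) := by
  have hyp := abs_nonneg y
  have hA : |1 + y - 2 * th * y - th * (1 + y) * v| ≤ 3 := by
    obtain ⟨h1, h2⟩ := abs_le.1 hy
    have e1 : |th * y| ≤ 1 / 4 := by
      rw [abs_mul, abs_of_nonneg hth]; nlinarith
    have e2 : th * v ≤ 1 / 2 := by nlinarith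
    have e3 : 0 ≤ th * v := by positivity
    obtain ⟨h3, h4⟩ := abs_le.1 e1
    have e5 : th * (1 + y) * v = (th * v) * (1 + y) := by ring
    rw [e5, mul_assoc, abs_le]
    constructor <;> nlinarith
  have e : (1 + y - 2 * th * y - th * (1 + y) * v) * (1 + v + 2 * y * v + om)
      - 1 - (1 - 2 * th) * y - v * (1 - th) =
      (1 + y - 2 * th * y - th * (1 + y) * v) * om +
      (y * v) * (2 * (1 + y - 2 * th * y - th * (1 + y) * v) + (1 - 3 * th) - th * v)
      - th * v ^ 2 := by ring
  rw [e]
  have b1 : |(1 + y - 2 * th * y - th * (1 + y) * v) * om| ≤ 3 * (8 * v ^ 2) := by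
    rw [abs_mul]; exact mul_le_mul hA hom (abs_nonneg _) (by norm_num)
  have b2 : |(y * v) * (2 * (1 + y - 2 * th * y - th * (1 + y) * v) + (1 - 3 * th) - th * v)| ≤
      |y| * v * 9 := by
    rw [abs_mul, abs_mul, abs_of_nonneg hv]
    apply mul_le_mul_of_nonneg_left _ (by positivity)
    obtain ⟨h3, h4⟩ := abs_le.1 hA
    have e2 : th * v ≤ 1 / 2 := by nlinarith
    have e3 : 0 ≤ th * v := by positivity
    rw [abs_le]; constructor <;> linarith
  have b3 : |th * v ^ 2| ≤ v ^ 2 := by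
    rw [abs_of_nonneg (by positivity)]; nlinarith [sq_nonneg v]
  have t1 := abs_sub ((1 + y - 2 * th * y - th * (1 + y) * v) * om +
      (y * v) * (2 * (1 + y - 2 * th * y - th * (1 + y) * v) + (1 - 3 * th) - th * v))
      (th * v ^ 2)
  have t2 := abs_add_le ((1 + y - 2 * th * y - th * (1 + y) * v) * om)
      ((y * v) * (2 * (1 + y - 2 * th * y - th * (1 + y) * v) + (1 - 3 * th) - th * v))
  have : 0 ≤ |y| * v := by positivity
  linarith [sq_nonneg v]

set_option maxHeartbeats 1000000 in
/-- Stage 3 : the precise expansion when `s` is close to `1`. -/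
lemma step_three {r : ℝ → ℝ} {z0 z1 M m c D : ℝ} (H : Pack r z0 z1 M m c D) {k P q y : ℝ}
    (hk : 0 < k) (hkM : 8 * k * M ^ 2 ≤ 1) (hP : 0 ≤ P) (hPz : P ≤ z1)
    (hy : |y| ≤ 1 / 8) (hqy : q = r P * (1 + y)) :
    |nQ r k P q / r (nP r k P q) - 1 - (1 - 2 * (-(P * deriv r P / r P))) * y
        - k * P ^ 2 * (r P) ^ 2 * (1 - (-(P * deriv r P / r P)))| ≤
      (72 * D * (9 + M ^ 4) + 80 * (1 + M ^ 2)) * P ^ 2 * (y ^ 2 + k ^ 2) ∧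
    |(nP r k P q) ^ 2 - P ^ 2| ≤ 3 * P ^ 2 * (3 * |y| + M ^ 2 * k) ∧
    nP r k P q ≤ M := by
  have hc := H.c_pos
  have hD := H.D_ge
  have hM1 : 1 ≤ M := by linarith [H.M_ge, H.z01, H.z0_pos]
  have hz1 : 0 < z1 := H.z0_pos.trans H.z01
  have hPM : P ≤ M := by linarith [H.M_ge]
  have hrP := H.r_pos P
  have hr1 := H.r_le P
  obtain ⟨hy1, hy2⟩ := abs_le.1 hy
  have hyp := abs_nonneg y
  have hs0 : 0 < 1 + y := by linarith
  set v := k * P ^ 2 * (r P) ^ 2 with hv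
  have hv0 : 0 ≤ v := by positivity
  have hPM2 : P ^ 2 ≤ M ^ 2 := pow_le_pow_left₀ hP hPM 2
  have hvP : v ≤ k * P ^ 2 := by
    have e2 : (r P) ^ 2 ≤ 1 := pow_le_one₀ hrP.le hr1
    have : k * P ^ 2 * (r P) ^ 2 ≤ k * P ^ 2 * 1 := mul_le_mul_of_nonneg_left e2 (by positivity)
    linarith
  have hvM : v ≤ k * M ^ 2 := hvP.trans (mul_le_mul_of_nonneg_left hPM2 hk.le)
  have hv8 : v ≤ 1 / 8 := by linarith
  set th := -(P * deriv r P / r P) with hth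
  have hth1 : th ≤ 3 / 4 := H.th_up P hP hPz
  have hth0 : 0 ≤ th := le_trans (by positivity) (H.th_low P hP hPM)
  -- the multiplier
  set d := 2 / (1 + y) - 2 - v with hd
  have h2s : 2 * r P / q = 2 / (1 + y) := by rw [hqy]; field_simp
  have hsd : (1 + y) * d = -2 * y - (1 + y) * v := by rw [hd]; field_simp; ring
  have hd1 : |d| ≤ 3 * |y| + v := by
    have e : 2 / (1 + y) - 2 = y * (-2 / (1 + y)) := by field_simp; ring
    have e2 : |y * (-2 / (1 + y))| ≤ |y| * 3 := by
      rw [abs_mul]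
      apply mul_le_mul_of_nonneg_left _ hyp
      rw [abs_div, abs_of_pos hs0, div_le_iff₀ hs0, abs_neg, abs_two]
      linarith
    rw [hd, e]
    have := abs_sub (y * (-2 / (1 + y))) v
    rw [abs_of_nonneg hv0] at this
    linarith
  have hdh : |d| ≤ 1 / 2 := by linarith
  obtain ⟨hd2, hd3⟩ := abs_le.1 hdh
  have hPn : nP r k P q = P + P * d := by
    have : nP r k P q = |1 - 2 * r P / q + v| * P := rfl
    rw [this, h2s, abs_of_nonpos (by linarith)]
    rw [hd]; ring
  have hn0 := nP_nonneg r k P q hP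
  have hnM : nP r k P q ≤ M := by
    have e : P * d ≤ P * 1 := mul_le_mul_of_nonneg_left (by linarith) hP
    rw [hPn]; linarith [H.M_ge]
  have hdM : |d| ≤ 3 * |y| + M ^ 2 * k := by linarith
  refine ⟨?_, ?_, hnM⟩
  · have htay := H.taylor P (nP r k P q) hP hPM hn0 hnM
    set R' := (r (nP r k P q))⁻¹ with hR'
    set tau := R' - (r P)⁻¹ + deriv r P / (r P) ^ 2 * (nP r k P q - P) with htau
    -- q R' expansion
    have hqR : q * R' = (1 + y - 2 * th * y - th * (1 + y) * v) + q * tau := by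
      have e1 : R' = tau + (r P)⁻¹ - deriv r P / (r P) ^ 2 * (P * d) := by
        rw [htau, hPn]; ring
      have e2 : q * R' = q * tau + (1 + y) + th * ((1 + y) * d) := by
        rw [e1, hqy, hth]; field_simp; ring
      rw [e2, hsd]; ring
    have hw : k * P ^ 2 * r P * (2 * q - r P) = v * (1 + 2 * y) := by rw [hqy, hv]; ring
    set w := v * (1 + 2 * y) with hwdef
    have hw0 : 0 ≤ w := mul_nonneg hv0 (by linarith)
    have hw2 : w ≤ 2 * v := by
      have e := mul_le_mul_of_nonneg_left (by linarith : 1 + 2 * y ≤ 2) hv0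
      linarith
    have hw1 : w ≤ 1 / 2 := by linarith
    set om := w ^ 2 / (1 - w) with hom
    have hrho : (1 - w)⁻¹ = 1 + v + 2 * y * v + om := by
      have hne : 1 - w ≠ 0 := by linarith
      have e : (1 - w)⁻¹ = 1 + w + om := by rw [hom]; field_simp; ring
      rw [e, hwdef]; ring
    have homb : |om| ≤ 8 * v ^ 2 := by
      have hp : 0 < 1 - w := by linarith
      rw [hom, abs_of_nonneg (by positivity), div_le_iff₀ hp]
      exact aux_om hw0 hw2 hw1
    have hpoly := aux_poly (hy.trans (by norm_num)) hv0 (by linarith) hth0 (by linarith) homb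
    have hNQ : nQ r k P q / r (nP r k P q) = (1 - w)⁻¹ * (q * R') := by
      have : nQ r k P q = (1 - k * P ^ 2 * r P * (2 * q - r P))⁻¹ * q := rfl
      rw [this, hw, div_eq_mul_inv]; ring
    have hrho2 : |(1 - w)⁻¹| ≤ 2 := by
      have hp : 0 < 1 - w := by linarith
      rw [abs_of_pos (inv_pos.2 hp), inv_le_iff_one_le_mul₀ hp]; linarith
    have hq2 : |q| ≤ 2 := by
      rw [abs_of_pos (by rw [hqy]; positivity), hqy]
      have e := mul_le_mul_of_nonneg_right hr1 hs0.le
      linarith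
    have htaub : |tau| ≤ D * (P ^ 2 * d ^ 2) := by
      have : (nP r k P q - P) ^ 2 = P ^ 2 * d ^ 2 := by rw [hPn]; ring
      rw [this] at htay; exact htay
    have hd2b : d ^ 2 ≤ 2 * (9 + M ^ 4) * (y ^ 2 + k ^ 2) := by
      have e1 : d ^ 2 ≤ (3 * |y| + M ^ 2 * k) ^ 2 := by
        rw [← sq_abs d]; exact pow_le_pow_left₀ (abs_nonneg _) hdM 2
      have e2 : (3 * |y| + M ^ 2 * k) ^ 2 ≤ 2 * (9 * y ^ 2 + M ^ 4 * k ^ 2) := by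
        rw [← sq_abs y]; exact aux_am2 _ _ _
      have e3 : 0 ≤ M ^ 4 * y ^ 2 := by positivity
      linarith [sq_nonneg k]
    have hmain : nQ r k P q / r (nP r k P q) - 1 - (1 - 2 * th) * y - v * (1 - th) =
        ((1 + y - 2 * th * y - th * (1 + y) * v) * (1 + v + 2 * y * v + om)
          - 1 - (1 - 2 * th) * y - v * (1 - th)) + (1 - w)⁻¹ * q * tau := by
      rw [hNQ, hqR, ← hrho]; ring
    rw [hmain]
    refine (abs_add_le _ _).trans ?_
    have b1 : |(1 - w)⁻¹ * q * tau| ≤ 4 * (D * (P ^ 2 * d ^ 2)) := by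
      rw [abs_mul, abs_mul]
      have := mul_le_mul hrho2 hq2 (abs_nonneg _) (by norm_num)
      exact mul_le_mul (by linarith) htaub (abs_nonneg _) (by norm_num)
    have b2 : D * (P ^ 2 * d ^ 2) ≤ D * (P ^ 2 * (2 * (9 + M ^ 4) * (y ^ 2 + k ^ 2))) := by
      apply mul_le_mul_of_nonneg_left _ (by linarith)
      exact mul_le_mul_of_nonneg_left hd2b (sq_nonneg _)
    have b3 : |y| * v ≤ P ^ 2 * (y ^ 2 + k ^ 2) := by
      have e1 : |y| * v ≤ |y| * (k * P ^ 2) := mul_le_mul_of_nonneg_left hvP hyp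
      have e2 : |y| * k ≤ y ^ 2 + k ^ 2 := by
        rw [← sq_abs y]; exact aux_am _ _
      have e3 := mul_le_mul_of_nonneg_left e2 (sq_nonneg P)
      linarith
    have b4 : v ^ 2 ≤ M ^ 2 * (P ^ 2 * (y ^ 2 + k ^ 2)) := by
      have e1 : v ^ 2 ≤ (k * M ^ 2) * (k * P ^ 2) := by
        rw [sq]; exact mul_le_mul hvM hvP hv0 (by positivity)
      have e2 : 0 ≤ M ^ 2 * (P ^ 2 * y ^ 2) := by positivity
      linarith
    have b5 : 0 ≤ D * (9 + M ^ 4) * (P ^ 2 * (y ^ 2 + k ^ 2)) := by positivity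
    have b6 : 0 ≤ (1 + M ^ 2) * (P ^ 2 * (y ^ 2 + k ^ 2)) := by positivity
    linarith
  · have e : (nP r k P q) ^ 2 - P ^ 2 = P ^ 2 * ((2 + d) * d) := by rw [hPn]; ring
    rw [e, abs_mul, abs_mul, abs_of_nonneg (sq_nonneg P), abs_of_pos (by linarith : 0 < 2 + d)]
    have : (2 + d) * |d| ≤ 3 * (3 * |y| + M ^ 2 * k) :=
      mul_le_mul (by linarith) hdM (abs_nonneg _) (by norm_num)
    calc _ ≤ P ^ 2 * (3 * (3 * |y| + M ^ 2 * k)) := mul_le_mul_of_nonneg_left this (sq_nonneg _)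
      _ = _ := by ring

set_option maxHeartbeats 1000000 in
/-- Stage 3 : invariance of the tube and contraction of the alignment error. -/
lemma step_three' {r : ℝ → ℝ} {z0 z1 M m c D : ℝ} (H : Pack r z0 z1 M m c D)
    {k P q K D3 : ℝ}
    (hD3 : D3 = 72 * D * (9 + M ^ 4) + 80 * (1 + M ^ 2))
    (hk : 0 < k) (hkM : 8 * k * M ^ 2 ≤ 1) (hP : 0 ≤ P) (hPz : P ≤ z1)
    (hK : 3 / c ≤ K) (hkD : D3 * (K ^ 2 + 1) * k ≤ 1) (hKk : K * k ≤ 1 / 8)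
    (hz : r z1 * (1 + K * k) ≤ r z0) (hq : 1 / 2 < q) (hqz : r z0 < q)
    (hs : |q / r P - 1| ≤ K * k) :
    |nQ r k P q / r (nP r k P q) - 1| ≤ K * k ∧ nP r k P q ≤ z1 ∧
    |nQ r k P q / r (nP r k P q) - 1 - k * hFun r (nP r k P q)| ≤
      (1 - 2 / 3 * c * P ^ 2) * |q / r P - 1 - k * hFun r P| +
      (D3 * (K ^ 2 + 1) + 3 * D * (3 * K + M ^ 2)) * P ^ 2 * k ^ 2 ∧
    0 ≤ 1 - 2 / 3 * c * P ^ 2 ∧ q ≤ 2 ∧ q - 1 ≤ K * k ∧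
    k * P ^ 2 * (m ^ 2 / 4) ≤ nQ r k P q - q := by
  have hc := H.c_pos
  have hD := H.D_ge
  have hm := H.m_pos
  have hM1 : 1 ≤ M := by linarith [H.M_ge, H.z01, H.z0_pos]
  have hz1 : 0 < z1 := H.z0_pos.trans H.z01
  have hPM : P ≤ M := by linarith [H.M_ge]
  have hrP := H.r_pos P
  have hr1 := H.r_le P
  have hKp : 0 < K := lt_of_lt_of_le (by positivity) hK
  set y := q / r P - 1 with hy
  have hqy : q = r P * (1 + y) := by rw [hy]; field_simp; ring
  have hy8 : |y| ≤ 1 / 8 := hs.trans hKk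
  obtain ⟨hyl, hyu⟩ := abs_le.1 hy8
  obtain ⟨h1, h2, h3⟩ := step_three H hk hkM hP hPz hy8 hqy
  rw [← hD3] at h1
  have hD3p : 0 ≤ D3 := by rw [hD3]; positivity
  have hn0 := nP_nonneg r k P q hP
  set th := -(P * deriv r P / r P) with hth
  have hth1 : th ≤ 3 / 4 := H.th_up P hP hPz
  have hthl : c * P ^ 2 ≤ th := H.th_low P hP hPM
  have hcP : 0 ≤ c * P ^ 2 := by positivity
  have habs : |1 - 2 * th| ≤ 1 - 2 / 3 * c * P ^ 2 := by
    rw [abs_le]; constructor <;> linarith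
  have hfac : 0 ≤ 1 - 2 / 3 * c * P ^ 2 := (abs_nonneg _).trans habs
  set y' := nQ r k P q / r (nP r k P q) - 1 with hy'
  set v := k * P ^ 2 * (r P) ^ 2 with hv
  have hv0 : 0 ≤ v := by positivity
  have hvP : v ≤ k * P ^ 2 := by
    have e2 : (r P) ^ 2 ≤ 1 := pow_le_one₀ hrP.le hr1
    have : k * P ^ 2 * (r P) ^ 2 ≤ k * P ^ 2 * 1 := mul_le_mul_of_nonneg_left e2 (by positivity)
    linarith
  have hyk : y ^ 2 + k ^ 2 ≤ (K ^ 2 + 1) * k ^ 2 := by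
    have := pow_le_pow_left₀ (abs_nonneg y) hs 2
    rw [sq_abs] at this
    linarith
  have hrem : |y' - (1 - 2 * th) * y - v * (1 - th)| ≤ D3 * (K ^ 2 + 1) * P ^ 2 * k ^ 2 := by
    refine h1.trans ?_
    have := mul_le_mul_of_nonneg_left hyk (by positivity : 0 ≤ D3 * P ^ 2)
    linarith
  have hq2 : q ≤ 1 + K * k := by
    have := (abs_le.1 hs).2
    have e : r P * (1 + y) ≤ 1 * (1 + y) := mul_le_mul_of_nonneg_right hr1 (by linarith)
    linarith
  have hq0 : 0 < q := by linarith
  obtain ⟨hQ1, hQ2, hQ3, hQ4⟩ := step_q H hk hkM hP hPM hq (by linarith)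
  have hy'b : |y'| ≤ K * k := by
    have e : y' = (y' - (1 - 2 * th) * y - v * (1 - th)) + ((1 - 2 * th) * y + v * (1 - th)) := by
      ring
    rw [e]
    refine (abs_add_le _ _).trans ?_
    have e1 := abs_add_le ((1 - 2 * th) * y) (v * (1 - th))
    have e2 : |(1 - 2 * th) * y| ≤ (1 - 2 / 3 * c * P ^ 2) * (K * k) := by
      rw [abs_mul]; exact mul_le_mul habs hs (abs_nonneg _) hfac
    have e3 : |v * (1 - th)| ≤ k * P ^ 2 := by
      rw [abs_of_nonneg (mul_nonneg hv0 (by linarith))]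
      have : v * (1 - th) ≤ v * 1 := mul_le_mul_of_nonneg_left (by linarith) hv0
      linarith
    have e4 : D3 * (K ^ 2 + 1) * k * (P ^ 2 * k) ≤ 1 * (P ^ 2 * k) :=
      mul_le_mul_of_nonneg_right hkD (by positivity)
    have e5 : 3 * (P ^ 2 * k) ≤ K * c * (P ^ 2 * k) := by
      apply mul_le_mul_of_nonneg_right _ (by positivity)
      rwa [div_le_iff₀ hc] at hK
    linarith
  refine ⟨hy'b, ?_, ?_, hfac, by linarith, by linarith, ?_⟩
  · by_contra h
    push Not at h
    have h4 := H.r_anti _ _ hz1.le h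
    have h5 := (abs_le.1 hy'b).2
    have h6 : nQ r k P q / r (nP r k P q) ≤ 1 + K * k := by linarith
    rw [div_le_iff₀ (H.r_pos _)] at h6
    have h7 : (1 + K * k) * r (nP r k P q) ≤ (1 + K * k) * r z1 :=
      mul_le_mul_of_nonneg_left h4.le (by positivity)
    linarith
  · have hid := H.h_id P hP hPM
    rw [← hth] at hid
    have hl := H.h_lip P (nP r k P q) hP hPM hn0 h3
    rw [abs_sub_comm (P ^ 2)] at hl
    have hl2 : |hFun r P - hFun r (nP r k P q)| ≤ D * (3 * P ^ 2 * ((3 * K + M ^ 2) * k)) := by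
      refine hl.trans (mul_le_mul_of_nonneg_left (h2.trans ?_) (by linarith))
      apply mul_le_mul_of_nonneg_left _ (by positivity)
      linarith
    have e : y' - k * hFun r (nP r k P q) = (y' - (1 - 2 * th) * y - v * (1 - th)) +
        (1 - 2 * th) * (y - k * hFun r P) + k * (hFun r P - hFun r (nP r k P q)) := by
      have : v * (1 - th) = k * (2 * th * hFun r P) := by rw [hid, hv]; ring
      rw [this]; ring
    rw [e]
    refine (abs_add_le _ _).trans ?_
    have t1 := abs_add_le (y' - (1 - 2 * th) * y - v * (1 - th))
      ((1 - 2 * th) * (y - k * hFun r P))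
    have t2 : |(1 - 2 * th) * (y - k * hFun r P)| ≤
        (1 - 2 / 3 * c * P ^ 2) * |y - k * hFun r P| := by
      rw [abs_mul]; exact mul_le_mul_of_nonneg_right habs (abs_nonneg _)
    have t3 : |k * (hFun r P - hFun r (nP r k P q))| ≤
        k * (D * (3 * P ^ 2 * ((3 * K + M ^ 2) * k))) := by
      rw [abs_mul, abs_of_pos hk]; exact mul_le_mul_of_nonneg_left hl2 hk.le
    linarith
  · refine le_trans ?_ hQ4
    have hrm := H.r_ge P hP hPM
    have e0 : 2 * q - r P = r P * (1 + 2 * y) := by rw [hqy]; ring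
    have e1 : m ≤ r P := hrm
    have e2 : m ^ 2 ≤ r P ^ 2 := pow_le_pow_left₀ hm.le hrm 2
    have e3 : m ^ 2 * (1 / 2) ≤ r P ^ 2 * (1 + 2 * y) :=
      mul_le_mul e2 (by linarith) (by norm_num) (sq_nonneg _)
    have e4 : 1 / 2 * (k * P ^ 2 * (m ^ 2 * (1 / 2))) ≤ q * (k * P ^ 2 * (r P ^ 2 * (1 + 2 * y))) := by
      apply mul_le_mul hq.le _ (by positivity) hq0.le
      exact mul_le_mul_of_nonneg_left e3 (by positivity)
    have e5 : k * P ^ 2 * r P * (2 * q - r P) = k * P ^ 2 * (r P ^ 2 * (1 + 2 * y)) := by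
      rw [e0]; ring
    rw [e5]; linarith

/-- Abstract stage lemma. -/
lemma stage_lemma (J Good : ℕ → Prop) (V q : ℕ → ℝ) (B qmax : ℝ) (t0 : ℕ) (hB : 0 ≤ B)
    (hV : ∀ t, J t → 0 ≤ V t) (hJ0 : J t0) (hinit : q t0 + B * V t0 ≤ qmax)
    (hstep : ∀ t, t0 ≤ t → J t → q t ≤ qmax → ¬ Good t →
      J (t + 1) ∧ q (t + 1) + B * V (t + 1) ≤ q t + B * V t) :
    (∃ T, t0 ≤ T ∧ Good T ∧ ∀ t, t0 ≤ t → t ≤ T → J t ∧ q t ≤ qmax) ∨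
    (∀ t, t0 ≤ t → J t ∧ ¬ Good t ∧ q t ≤ qmax) := by
  have key : ∀ n, (∀ i, i < n → ¬ Good (t0 + i)) →
      J (t0 + n) ∧ q (t0 + n) + B * V (t0 + n) ≤ qmax := by
    intro n
    induction n with
    | zero => intro _; exact ⟨hJ0, hinit⟩
    | succ n ih =>
      intro h
      obtain ⟨a, b⟩ := ih (fun i hi => h i (by omega))
      have hb : q (t0 + n) ≤ qmax := by
        have := mul_nonneg hB (hV _ a)
        linarith
      obtain ⟨c1, c2⟩ := hstep (t0 + n) (by omega) a hb (h n (by omega))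
      exact ⟨c1, c2.trans b⟩
  have key2 : ∀ n, (∀ i, i < n → ¬ Good (t0 + i)) → J (t0 + n) ∧ q (t0 + n) ≤ qmax := by
    intro n hn
    obtain ⟨a, b⟩ := key n hn
    have := mul_nonneg hB (hV _ a)
    exact ⟨a, by linarith⟩
  by_cases hex : ∃ n, Good (t0 + n)
  · left
    refine ⟨t0 + Nat.find hex, by omega, Nat.find_spec hex, fun t h1 h2 => ?_⟩
    obtain ⟨i, rfl⟩ := Nat.exists_eq_add_of_le h1
    exact key2 i (fun j hj => Nat.find_min hex (by omega))
  · right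
    push Not at hex
    intro t ht
    obtain ⟨i, rfl⟩ := Nat.exists_eq_add_of_le ht
    obtain ⟨a, b⟩ := key2 i (fun j _ => hex j)
    exact ⟨a, hex i, b⟩

lemma no_descent (V : ℕ → ℝ) (κ : ℝ) (hκ : 0 < κ) (t0 : ℕ) (hV : ∀ t, t0 ≤ t → 0 ≤ V t)
    (h : ∀ t, t0 ≤ t → V (t + 1) ≤ V t - κ) : False := by
  have key : ∀ n : ℕ, V (t0 + n) ≤ V t0 - n * κ := by
    intro n
    induction n with
    | zero => simp
    | succ n ih =>
      have := h (t0 + n) (by omega)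
      push_cast
      rw [← add_assoc]
      linarith
  obtain ⟨n, hn⟩ := exists_nat_gt (V t0 / κ)
  rw [div_lt_iff₀ hκ] at hn
  have := key n
  have := hV (t0 + n) (by omega)
  linarith

lemma aux_small (A B : ℝ) (hB : 0 < B) : ∃ k0 > 0, ∀ k, 0 < k → k < k0 → A * k ≤ B := by
  refine ⟨B / (|A| + 1), by positivity, fun k h0 hk => ?_⟩
  rw [lt_div_iff₀ (by positivity)] at hk
  have : A * k ≤ |A| * k := mul_le_mul_of_nonneg_right (le_abs_self A) h0.le
  linarith

set_option maxHeartbeats 2000000 in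
lemma core {r : ℝ → ℝ} {z0 z1 M m c D : ℝ} (H : Pack r z0 z1 M m c D) (δ : ℝ) (hδ : 0 < δ) :
    ∃ k0 > (0:ℝ), ∃ C > (0:ℝ), ∀ k, 0 < k → k < k0 → ∀ P q : ℕ → ℝ,
      (∀ t, 0 ≤ P t) → (∀ t, P (t + 1) = nP r k (P t) (q t)) →
      (∀ t, q (t + 1) = nQ r k (P t) (q t)) →
      P 0 ≤ 1 → 1 / 2 < q 0 → r z0 < q 0 → q 0 < 1 - δ → (∀ t, q t < 1 → P t ≠ 0) →
      (∀ t, q t ≤ q (t + 1) ∧ q (t + 1) ≤ q t + 16 * M ^ 2 * k) ∧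
      Tendsto P atTop (nhds 0) ∧ ∃ qs, Tendsto q atTop (nhds qs) ∧
        |qs - 1 - k * hFun r 0| ≤ C * k ^ 2 := by
  have hc := H.c_pos
  have hD := H.D_ge
  have hm := H.m_pos
  have hM1 : 1 ≤ M := by linarith [H.M_ge, H.z01, H.z0_pos]
  have hz1 : 0 < z1 := H.z0_pos.trans H.z01
  have hz1M : z1 ≤ M := by linarith [H.M_ge]
  have hz01 := H.z01
  obtain ⟨c2, hc2⟩ : ∃ c2, c2 = c * δ * m ^ 2 / (4 * D) := ⟨_, rfl⟩
  have hc2p : 0 < c2 := by rw [hc2]; positivity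
  obtain ⟨K, hK1, hK2, hK3, hK4, hK5⟩ : ∃ K, 16 / (m * c2) ≤ K ∧ 128 / (c2 * m * δ) ≤ K ∧
      256 / (c * δ) ≤ K ∧ 8 * M ^ 2 ≤ K ∧ 3 / c ≤ K := by
    have a1 : 0 < 16 / (m * c2) := by positivity
    have a2 : 0 < 128 / (c2 * m * δ) := by positivity
    have a3 : 0 < 256 / (c * δ) := by positivity
    have a4 : 0 < 8 * M ^ 2 := by positivity
    have a5 : 0 < 3 / c := by positivity
    refine ⟨16 / (m * c2) + 128 / (c2 * m * δ) + 256 / (c * δ) + 8 * M ^ 2 + 3 / c, ?_, ?_, ?_, ?_,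
      ?_⟩ <;> linarith
  have hKp : 0 < K := lt_of_lt_of_le (by positivity) hK5
  obtain ⟨D3, hD3⟩ : ∃ D3, D3 = 72 * D * (9 + M ^ 4) + 80 * (1 + M ^ 2) := ⟨_, rfl⟩
  have hD3p : 0 < D3 := by rw [hD3]; positivity
  obtain ⟨E, hE⟩ : ∃ E, E = D3 * (K ^ 2 + 1) + 3 * D * (3 * K + M ^ 2) := ⟨_, rfl⟩
  have hEp : 0 < E := by rw [hE]; positivity
  obtain ⟨K2, hL1, hL2⟩ : ∃ K2, 3 * E / c ≤ K2 ∧ 192 * (K + D) / (c * δ) ≤ K2 := 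
    ⟨_, le_max_left _ _, le_max_right _ _⟩
  have hK2p : 0 < K2 := lt_of_lt_of_le (by positivity) hL1
  obtain ⟨k1, hk1, hs1⟩ := aux_small (8 * M ^ 2) 1 one_pos
  obtain ⟨k2, hk2, hs2⟩ := aux_small 1 m hm
  obtain ⟨k3, hk3, hs3⟩ := aux_small (D3 * (K ^ 2 + 1)) 1 one_pos
  obtain ⟨k4, hk4, hs4⟩ := aux_small K (1 / 8) (by norm_num)
  obtain ⟨k5, hk5, hs5⟩ := aux_small K (δ / 8) (by positivity)
  obtain ⟨k6, hk6, hs6⟩ := aux_small (r z1 * K) (r z0 - r z1)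
    (by linarith [H.r_anti z0 z1 H.z0_pos.le H.z01])
  refine ⟨min k1 (min k2 (min k3 (min k4 (min k5 k6)))), by positivity, K2, hK2p, ?_⟩
  intro k hk hkk P q hP0 hPs hqs hP1 hqh hqz hqd hne
  simp only [lt_min_iff] at hkk
  obtain ⟨l1, l2, l3, l4, l5, l6⟩ := hkk
  replace hs1 := hs1 k hk l1
  replace hs2 := hs2 k hk l2
  replace hs3 := hs3 k hk l3
  replace hs4 := hs4 k hk l4
  replace hs5 := hs5 k hk l5
  replace hs6 := hs6 k hk l6
  have hkM : 8 * k * M ^ 2 ≤ 1 := by linarith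
  have hkm : k ≤ m := by linarith
  have hKk : 0 < K * k := mul_pos hKp hk
  have hzK : r z1 * (1 + K * k) ≤ r z0 := by linarith
  have hsq : ∀ x, 0 ≤ x → x ≤ M → x ^ 2 ≤ M ^ 2 := fun x h1 h2 => pow_le_pow_left₀ h1 h2 2
  -- Stage 1
  obtain ⟨T1, hT1g, hT1⟩ : ∃ T, q T / r (P T) ≤ 1 + K * k ∧
      ∀ t, t ≤ T → (P t ≤ 1 ∧ q 0 ≤ q t) ∧ q t ≤ 1 - 3 * δ / 4 := by
    have hB : 0 ≤ 32 / (c2 * K) := by positivity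
    have hstep : ∀ t, (P t ≤ 1 ∧ q 0 ≤ q t) → q t ≤ 1 - 3 * δ / 4 →
        ¬ (q t / r (P t) ≤ 1 + K * k) →
        (P (t + 1) ≤ 1 ∧ q 0 ≤ q (t + 1)) ∧ q (t + 1) ≤ q t + 16 * k ∧
        q (t + 1) / r (P (t + 1)) ≤ q t / r (P t) - c2 / 2 * K * k := by
      rintro t ⟨a1, a2⟩ a3 a4
      push Not at a4
      obtain ⟨b1, b2⟩ := step_one H hk hkM (hP0 t) a1 (by linarith) hδ (by linarith) hkm hc2 hK1 a4
      obtain ⟨b3, b4, -, -⟩ := step_q H hk hkM (hP0 t) (a1.trans hM1) (by linarith : 1 / 2 < q t)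
        (by linarith)
      rw [hPs, hqs]
      have e : (P t) ^ 2 ≤ 1 := pow_le_one₀ (hP0 t) a1
      have e2 : 16 * k * (P t) ^ 2 ≤ 16 * k * 1 := mul_le_mul_of_nonneg_left e (by positivity)
      exact ⟨⟨b1.trans a1, a2.trans b3⟩, by linarith, b2⟩
    have hs0 : q 0 / r (P 0) ≤ 1 / m := by
      apply div_le_div₀ zero_le_one (by linarith) hm
      exact H.r_ge _ (hP0 0) (hP1.trans hM1)
    have hinit : q 0 + 32 / (c2 * K) * (q 0 / r (P 0)) ≤ 1 - 3 * δ / 4 := by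
      have e1 := mul_le_mul_of_nonneg_left hs0 hB
      have e2 : 32 / (c2 * K) * (1 / m) ≤ δ / 4 := by
        rw [div_le_iff₀ (by positivity)] at hK2
        rw [div_mul_div_comm, div_le_iff₀ (by positivity)]
        linarith
      linarith
    rcases stage_lemma (fun t => P t ≤ 1 ∧ q 0 ≤ q t) (fun t => q t / r (P t) ≤ 1 + K * k)
      (fun t => q t / r (P t)) q (32 / (c2 * K)) (1 - 3 * δ / 4) 0 hB
      (fun t ht => div_nonneg (by linarith [ht.2]) (H.r_pos _).le) ⟨hP1, le_rfl⟩ hinit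
      (fun t _ a1 a2 a3 => by
        obtain ⟨b1, b2, b3⟩ := hstep t a1 a2 a3
        refine ⟨b1, ?_⟩
        have := mul_le_mul_of_nonneg_left b3 hB
        have e : 32 / (c2 * K) * (c2 / 2 * K * k) = 16 * k := by field_simp; ring
        linarith) with ⟨T, -, h1, h2⟩ | h
    · exact ⟨T, h1, fun t ht => h2 t (Nat.zero_le _) ht⟩
    · exfalso
      refine no_descent (fun t => q t / r (P t)) (c2 / 2 * K * k) (by positivity) 0 ?_ ?_
      · intro t ht
        exact div_nonneg (by linarith [(h t ht).1.2]) (H.r_pos _).le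
      · intro t ht
        obtain ⟨a1, a2, a3⟩ := h t ht
        exact (hstep t a1 a3 a2).2.2
  -- Stage 2
  obtain ⟨T2, hT12, hT2g, hT2⟩ : ∃ T, T1 ≤ T ∧ 1 - K * k ≤ q T / r (P T) ∧
      ∀ t, T1 ≤ t → t ≤ T → (P t ≤ M ∧ q 0 ≤ q t ∧ q t / r (P t) ≤ 1 + K * k) ∧
        q t ≤ 1 - δ / 2 := by
    have hB : 0 ≤ 32 / (c * K) := by positivity
    have hstep : ∀ t, (P t ≤ M ∧ q 0 ≤ q t ∧ q t / r (P t) ≤ 1 + K * k) → q t ≤ 1 - δ / 2 →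
        ¬ (1 - K * k ≤ q t / r (P t)) →
        (P (t + 1) ≤ M ∧ q 0 ≤ q (t + 1) ∧ q (t + 1) / r (P (t + 1)) ≤ 1 + K * k) ∧
        q (t + 1) ≤ q t + 16 * k * (P t) ^ 2 ∧ P t ≤ P (t + 1) ∧
        q t / r (P t) + c / 2 * K * k * (P t) ^ 2 ≤ q (t + 1) / r (P (t + 1)) := by
      rintro t ⟨a1, a2, a2'⟩ a3 a4
      push Not at a4
      obtain ⟨b1, b2, b3, b4⟩ := step_two H hk hkM (hP0 t) a1 (by linarith) (by linarith)
        (by linarith) hK4 a4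
      obtain ⟨b5, b6, -, -⟩ := step_q H hk hkM (hP0 t) a1 (by linarith : 1 / 2 < q t)
        (by linarith)
      rw [hPs, hqs]
      exact ⟨⟨by linarith, by linarith, b4⟩, b6, b1, b3⟩
    obtain ⟨⟨i1, i2⟩, i3⟩ := hT1 T1 le_rfl
    have hinit : q T1 + 32 / (c * K) * (1 + K * k - q T1 / r (P T1)) ≤ 1 - δ / 2 := by
      have e0 : 0 ≤ q T1 / r (P T1) := div_nonneg (by linarith) (H.r_pos _).le
      have e1 := mul_le_mul_of_nonneg_left (by linarith : 1 + K * k - q T1 / r (P T1) ≤ 2) hB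
      have e2 : 32 / (c * K) * 2 ≤ δ / 4 := by
        rw [div_le_iff₀ (by positivity)] at hK3
        rw [div_mul_eq_mul_div, div_le_iff₀ (by positivity)]
        linarith
      linarith
    rcases stage_lemma (fun t => P t ≤ M ∧ q 0 ≤ q t ∧ q t / r (P t) ≤ 1 + K * k)
      (fun t => 1 - K * k ≤ q t / r (P t))
      (fun t => 1 + K * k - q t / r (P t)) q (32 / (c * K)) (1 - δ / 2) T1 hB
      (fun t ht => by linarith [ht.2.2]) ⟨i1.trans hM1, i2, hT1g⟩ hinit
      (fun t _ a1 a2 a3 => by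
        obtain ⟨b1, b2, -, b3⟩ := hstep t a1 a2 a3
        refine ⟨b1, ?_⟩
        have := mul_le_mul_of_nonneg_left b3 hB
        have e : 32 / (c * K) * (c / 2 * K * k * (P t) ^ 2) = 16 * k * (P t) ^ 2 := by
          field_simp; ring
        linarith) with ⟨T, h0, h1, h2⟩ | h
    · exact ⟨T, h0, h1, h2⟩
    · exfalso
      have hPT : 0 < P T1 := lt_of_le_of_ne (hP0 _) (Ne.symm (hne T1 (by linarith)))
      have hmono : ∀ n, P T1 ≤ P (T1 + n) := by
        intro n
        induction n with
        | zero => simp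
        | succ n ih =>
          obtain ⟨a1, a2, a3⟩ := h (T1 + n) (by omega)
          exact ih.trans (hstep _ a1 a3 a2).2.2.1
      refine no_descent (fun t => 1 + K * k - q t / r (P t)) (c / 2 * K * k * (P T1) ^ 2)
        (by positivity) T1 ?_ ?_
      · intro t ht
        linarith [(h t ht).1.2.2]
      · intro t ht
        obtain ⟨a1, a2, a3⟩ := h t ht
        have e1 := (hstep t a1 a3 a2).2.2.2
        obtain ⟨i, rfl⟩ := Nat.exists_eq_add_of_le ht
        have e2 : (P T1) ^ 2 ≤ (P (T1 + i)) ^ 2 := pow_le_pow_left₀ hPT.le (hmono i) 2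
        have e3 := mul_le_mul_of_nonneg_left e2 (by positivity : 0 ≤ c / 2 * K * k)
        linarith
  -- Stage 3 : the tube is invariant
  have hJ3 : ∀ t, T2 ≤ t → |q t / r (P t) - 1| ≤ K * k ∧ P t ≤ z1 ∧ q 0 ≤ q t := by
    intro t ht
    induction t, ht using Nat.le_induction with
    | base =>
      obtain ⟨⟨a1, a2, a3⟩, a4⟩ := hT2 T2 hT12 le_rfl
      refine ⟨abs_le.2 ⟨by linarith, by linarith⟩, ?_, a2⟩
      by_contra h
      push Not at h
      have h4 := H.r_anti _ _ hz1.le h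
      rw [div_le_iff₀ (H.r_pos _)] at a3
      have h7 : (1 + K * k) * r (P T2) ≤ (1 + K * k) * r z1 :=
        mul_le_mul_of_nonneg_left h4.le (by positivity)
      linarith
    | succ t ht ih =>
      obtain ⟨a1, a2, a3⟩ := ih
      obtain ⟨b1, b2, -, -, b4, -, b5⟩ := step_three' H hD3 hk hkM (hP0 t) a2 hK5 hs3 hs4 hzK
        (by linarith) (by linarith) a1
      rw [hPs, hqs]
      refine ⟨b1, b2, ?_⟩
      have : 0 ≤ k * P t ^ 2 * (m ^ 2 / 4) := by positivity
      linarith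
  have hst3 : ∀ t, T2 ≤ t → 
      |q (t + 1) / r (P (t + 1)) - 1 - k * hFun r (P (t + 1))| ≤
        (1 - 2 / 3 * c * P t ^ 2) * |q t / r (P t) - 1 - k * hFun r (P t)| +
        E * P t ^ 2 * k ^ 2 ∧ 0 ≤ 1 - 2 / 3 * c * P t ^ 2 ∧ q t ≤ 2 ∧ q t - 1 ≤ K * k ∧
      k * P t ^ 2 * (m ^ 2 / 4) ≤ q (t + 1) - q t := by
    intro t ht
    obtain ⟨a1, a2, a3⟩ := hJ3 t ht
    obtain ⟨-, -, b3⟩ := step_three' H hD3 hk hkM (hP0 t) a2 hK5 hs3 hs4 hzK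
        (by linarith) (by linarith) a1
    rw [hPs, hqs, hE]
    exact b3
  -- global facts
  have hglob : ∀ t, P t ≤ M ∧ 1 / 2 < q t ∧ q t ≤ 2 := by
    intro t
    rcases le_total t T1 with h | h
    · obtain ⟨⟨a1, a2⟩, a3⟩ := hT1 t h
      exact ⟨by linarith, by linarith, by linarith⟩
    rcases le_total t T2 with h' | h'
    · obtain ⟨⟨a1, a2, -⟩, a3⟩ := hT2 t h h'
      exact ⟨a1, by linarith, by linarith⟩
    · obtain ⟨a1, a2, a3⟩ := hJ3 t h'
      obtain ⟨-, -, b1, -⟩ := hst3 t h'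
      exact ⟨by linarith, by linarith, b1⟩
  have hinc : ∀ t, q t ≤ q (t + 1) ∧ q (t + 1) ≤ q t + 16 * k * P t ^ 2 := by
    intro t
    obtain ⟨a1, a2, a3⟩ := hglob t
    obtain ⟨b1, b2, -⟩ := step_q H hk hkM (hP0 t) a1 a2 a3
    rw [hqs]; exact ⟨b1, b2⟩
  have hmonoq : Monotone q := monotone_nat_of_le_succ fun t => (hinc t).1
  obtain ⟨qs, hqlim⟩ : ∃ qs, Tendsto q atTop (nhds qs) := by
    refine ⟨_, tendsto_atTop_ciSup hmonoq ⟨2, ?_⟩⟩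
    rintro _ ⟨t, rfl⟩
    exact (hglob t).2.2
  have hPlim : Tendsto P atTop (nhds 0) := by
    have h1 : Tendsto (fun t => q (t + 1) - q t) atTop (nhds 0) := by
      have := ((tendsto_add_atTop_iff_nat 1).2 hqlim).sub hqlim
      simpa using this
    have h2 : Tendsto (fun t => (q (t + 1) - q t) * (k * (m ^ 2 / 4))⁻¹) atTop (nhds 0) := by
      have h5 := h1.mul_const (k * (m ^ 2 / 4))⁻¹
      rwa [zero_mul] at h5
    have h3 : Tendsto (fun t => P t ^ 2) atTop (nhds 0) := by
      refine tendsto_of_tendsto_of_tendsto_of_le_of_le' tendsto_const_nhds h2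
        (Eventually.of_forall fun t => sq_nonneg _) ?_
      filter_upwards [eventually_ge_atTop T2] with t ht
      rw [← div_eq_mul_inv, le_div_iff₀ (by positivity)]
      linarith [(hst3 t ht).2.2.2.2]
    have h4 := h3.sqrt
    simpa [Real.sqrt_sq (hP0 _)] using h4
  have hslim : Tendsto (fun t => q t / r (P t)) atTop (nhds qs) := by
    have h1 : Tendsto (fun t => r (P t)) atTop (nhds 1) := by
      have := (H.r_cont.tendsto 0).comp hPlim
      rwa [H.r_zero] at this
    have h5 := hqlim.div h1 one_ne_zero
    rw [div_one] at h5
    exact h5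
  have hqs1 : 1 - K * k ≤ qs := by
    apply ge_of_tendsto hslim
    filter_upwards [eventually_ge_atTop T2] with t ht
    linarith [(abs_le.1 (hJ3 t ht).1).1]
  have hhlim : Tendsto (fun t => hFun r (P t)) atTop (nhds (hFun r 0)) := by
    rw [tendsto_iff_norm_sub_tendsto_zero]
    have h2 : Tendsto (fun t => D * P t ^ 2) atTop (nhds 0) := by
      simpa using (hPlim.pow 2).const_mul D
    refine squeeze_zero (fun t => norm_nonneg _) (fun t => ?_) h2
    have := H.h_lip (P t) 0 (hP0 t) (hglob t).1 le_rfl (by linarith)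
    rw [Real.norm_eq_abs]
    simpa [abs_of_nonneg (sq_nonneg (P t))] using this
  have helim : Tendsto (fun t => |q t / r (P t) - 1 - k * hFun r (P t)|) atTop
      (nhds |qs - 1 - k * hFun r 0|) :=
    ((hslim.sub_const 1).sub (hhlim.const_mul k)).abs
  -- Stage 3 : the alignment error
  obtain ⟨T3, hT23, hT3⟩ : ∃ T, T2 ≤ T ∧
      |q T / r (P T) - 1 - k * hFun r (P T)| ≤ K2 * k ^ 2 := by
    have hB : 0 ≤ 48 / (c * K2 * k) := by positivity
    have hV0 : |q T2 / r (P T2) - 1 - k * hFun r (P T2)| ≤ (K + D) * k := by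
      have e1 := abs_sub (q T2 / r (P T2) - 1) (k * hFun r (P T2))
      have e2 := (hJ3 T2 le_rfl).1
      have e3 := H.h_bd (P T2) (hP0 _) (hglob _).1
      have e4 : |k * hFun r (P T2)| ≤ k * D := by
        rw [abs_mul, abs_of_pos hk]; exact mul_le_mul_of_nonneg_left e3 hk.le
      linarith
    have hinit : q T2 + 48 / (c * K2 * k) * |q T2 / r (P T2) - 1 - k * hFun r (P T2)| ≤
        1 - δ / 4 := by
      have e1 := mul_le_mul_of_nonneg_left hV0 hB
      have e2 : 48 / (c * K2 * k) * ((K + D) * k) ≤ δ / 4 := by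
        rw [div_le_iff₀ (by positivity)] at hL2
        rw [div_mul_eq_mul_div, div_le_iff₀ (by positivity)]
        have := mul_le_mul_of_nonneg_right hL2 hk.le
        linarith
      linarith [(hT2 T2 hT12 le_rfl).2]
    rcases stage_lemma (fun t => T2 ≤ t)
      (fun t => |q t / r (P t) - 1 - k * hFun r (P t)| ≤ K2 * k ^ 2)
      (fun t => |q t / r (P t) - 1 - k * hFun r (P t)|) q (48 / (c * K2 * k)) (1 - δ / 4) T2 hB
      (fun t _ => abs_nonneg _) le_rfl hinit
      (fun t _ a1 a2 a3 => by
        refine ⟨Nat.le_succ_of_le a1, ?_⟩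
        push Not at a3
        obtain ⟨b1, b2, -⟩ := hst3 t a1
        have b3 := (hinc t).2
        have e0 : 0 ≤ P t ^ 2 * k ^ 2 := by positivity
        have e1 : 3 * E * (P t ^ 2 * k ^ 2) ≤ K2 * c * (P t ^ 2 * k ^ 2) := by
          rw [div_le_iff₀ hc] at hL1
          exact mul_le_mul_of_nonneg_right hL1 e0
        have e2 : c * P t ^ 2 * (K2 * k ^ 2) ≤
            c * P t ^ 2 * |q t / r (P t) - 1 - k * hFun r (P t)| :=
          mul_le_mul_of_nonneg_left a3.le (by positivity)
        have e3 : |q (t + 1) / r (P (t + 1)) - 1 - k * hFun r (P (t + 1))| ≤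
            |q t / r (P t) - 1 - k * hFun r (P t)| - c / 3 * K2 * (P t ^ 2 * k ^ 2) := by
          linarith
        have e4 := mul_le_mul_of_nonneg_left e3 hB
        have e5 : 48 / (c * K2 * k) * (c / 3 * K2 * (P t ^ 2 * k ^ 2)) = 16 * k * P t ^ 2 := by
          field_simp; ring
        linarith) with ⟨T, h0, h1, h2⟩ | h
    · exact ⟨T, h0, h1⟩
    · exfalso
      have : qs ≤ 1 - δ / 4 := by
        apply le_of_tendsto hqlim
        filter_upwards [eventually_ge_atTop T2] with t ht
        exact (h t ht).2.2
      linarith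
  have hfin : ∀ t, T3 ≤ t → |q t / r (P t) - 1 - k * hFun r (P t)| ≤ K2 * k ^ 2 := by
    intro t ht
    induction t, ht using Nat.le_induction with
    | base => exact hT3
    | succ t ht ih =>
      obtain ⟨b1, b2, -⟩ := hst3 t (hT23.trans ht)
      have e0 : 0 ≤ P t ^ 2 * k ^ 2 := by positivity
      have e1 : 3 * E * (P t ^ 2 * k ^ 2) ≤ K2 * c * (P t ^ 2 * k ^ 2) := by
        rw [div_le_iff₀ hc] at hL1
        exact mul_le_mul_of_nonneg_right hL1 e0
      have e2 := mul_le_mul_of_nonneg_left ih b2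
      have e3 : 0 ≤ K2 * c * (P t ^ 2 * k ^ 2) := by positivity
      linarith
  refine ⟨fun t => ⟨(hinc t).1, ?_⟩, hPlim, qs, hqlim, ?_⟩
  · have e := mul_le_mul_of_nonneg_left (hsq _ (hP0 t) (hglob t).1)
      (by positivity : 0 ≤ 16 * k)
    linarith [(hinc t).2]
  · apply le_of_tendsto helim
    filter_upwards [eventually_ge_atTop T3] with t ht
    exact hfin t ht
/-- EoS regime, Phase II, for the two-layer fully-connected linear network. -/
theorem eos_phase_two_linear (l r : ℝ → ℝ) (δ : ℝ)
    (hL : AssumptionL l)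
    (hr0 : r 0 = 1) (hrdef : ∀ x : ℝ, x ≠ 0 → r x = deriv l x / x)
    (hR : AssumptionR r) (hR2 : AssumptionR2 r)
    (hδ : δ ∈ Set.Ioo 0 (1 - cZero r)) :
    ∃ η₀ > (0 : ℝ), ∃ c > (0 : ℝ), ∃ C > (0 : ℝ),
      ∀ η : ℝ, 0 < η → η < η₀ →
        ∀ p q : ℕ → ℝ, LinDyn r η p q →
          |p 0| ≤ 1 → q 0 ∈ Set.Ioo (cZero r) (1 - δ) →
          (∀ t : ℕ, q t < 1 → p t ≠ 0) →
          (∃ t_b : ℕ, c * (1 - q 0) / η ^ 2 ≤ (t_b : ℝ) ∧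
            q t_b ≤ 1 ∧ ∀ t : ℕ, t_b < t → 1 < q t) ∧
          Tendsto p atTop (nhds 0) ∧
          ∃ qstar : ℝ, Tendsto q atTop (nhds qstar) ∧
            |qstar - 1 + η ^ 2 / (2 * deriv (deriv r) 0)| ≤ C * η ^ 4 := by
  have hc0 : cZero r < 1 := by linarith [hδ.1, hδ.2]
  obtain ⟨z1, M, m, c, D, H⟩ := exists_pack r hR hR2 hc0
  have hδ0 : 0 < δ := hδ.1
  obtain ⟨k0, hk0, C, hC, hcore⟩ := core H δ hδ0
  obtain ⟨k1, hk1, hs1⟩ := aux_small (16 * M ^ 2) (δ / 2) (by positivity)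
  obtain ⟨k2, hk2, hs2⟩ := aux_small C (hFun r 0 / 2) (half_pos H.h_zero_pos)
  have hM : 0 < M := by linarith [H.M_ge, H.z0_pos, H.z01]
  refine ⟨min 1 (min k0 (min k1 k2)), by positivity, 1 / (32 * M ^ 2), by positivity,
    C, hC, ?_⟩
  intro η hη hη0 p q hdyn hp0 hq0 hne
  simp only [lt_min_iff] at hη0
  obtain ⟨h1, h2, h3, h4⟩ := hη0
  have hk : 0 < η ^ 2 := by positivity
  have hkη : η ^ 2 ≤ η := by nlinarith
  have hrabs : ∀ x, r |x| = r x := by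
    intro x
    rcases abs_choice x with h | h
    · rw [h]
    · rw [h, H.r_even]
  obtain ⟨hp, hq⟩ := hdyn
  have hq0h : 1 / 2 < q 0 := lt_of_le_of_lt (le_max_right _ _) hq0.1
  have hq0z : r (zZero r) < q 0 := lt_of_le_of_lt (le_max_left _ _) hq0.1
  have hq0d : q 0 < 1 - δ := hq0.2
  obtain ⟨hqm, hpl, qs, hqs, hqb⟩ := hcore (η ^ 2) hk (by linarith) (fun t => |p t|) q
    (fun t => abs_nonneg _)
    (by
      intro t
      simp only [nP, hrabs, sq_abs]
      rw [hp t, abs_mul])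
    (by
      intro t
      simp only [nQ, hrabs, sq_abs]
      exact hq t)
    hp0 hq0h hq0z hq0d (fun t ht => abs_ne_zero.mpr (hne t ht))
  have hsm1 := hs1 (η ^ 2) hk (by linarith)
  have hsm2 := hs2 (η ^ 2) hk (by linarith)
  have hqs1 : 1 < qs := by
    have h5 := (abs_le.mp hqb).1
    have h6 : C * (η ^ 2) ^ 2 ≤ hFun r 0 / 2 * η ^ 2 := by
      have := mul_le_mul_of_nonneg_right hsm2 hk.le
      linarith
    have h7 : 0 < hFun r 0 * η ^ 2 := mul_pos H.h_zero_pos hk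
    linarith
  have hmono : Monotone q := monotone_nat_of_le_succ (fun t => (hqm t).1)
  have hgrow : ∀ t : ℕ, q t ≤ q 0 + 16 * M ^ 2 * η ^ 2 * t := by
    intro t
    induction t with
    | zero => simp
    | succ n ih =>
      have := (hqm n).2
      push_cast
      linarith
  refine ⟨?_, ?_, qs, hqs, ?_⟩
  · have hex : ∃ t, 1 < q t := (hqs.eventually_const_lt hqs1).exists
    have hfs := Nat.find_spec hex
    have hfm : ∀ n, n < Nat.find hex → q n ≤ 1 := fun n hn => not_lt.mp (Nat.find_min hex hn)
    generalize Nat.find hex = T at hfs hfm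
    cases T with
    | zero => linarith
    | succ n =>
      refine ⟨n, ?_, hfm n (Nat.lt_succ_self n), ?_⟩
      · have h5 := hgrow (n + 1)
        push_cast at h5
        rw [div_le_iff₀ hk, div_mul_eq_mul_div, one_mul, div_le_iff₀ (by positivity)]
        linarith
      · intro t ht
        exact lt_of_lt_of_le hfs (hmono ht)
  · exact (tendsto_zero_iff_abs_tendsto_zero p).mpr hpl
  · have h5 : qs - 1 + η ^ 2 / (2 * deriv (deriv r) 0) = qs - 1 - η ^ 2 * hFun r 0 := by
      rw [H.h_zero]; ring
    rw [h5]
    calc _ ≤ _ := hqb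
      _ = C * η ^ 4 := by ring
end
end

section
/- Suppose η ∈ (0, 2/33), |p₀| ≤ 1, and q₀ ∈ (2/(2-η), min{1/(16η), r(1)/(2η)}). Then for every t ≥ 0 the reparameterized GD dynamics satisfies |p_t| ≤ [1 − min{2(q₀−1)/q₀, r(1)/(2q₀)}]^t ≤ 1, and q₀ ≤ q_t ≤ exp(8η²q₀ · [min{2(q₀−1)/q₀, r(1)/(2q₀)}]^{-1}) · q₀ ≤ 2q₀. -/
open Filter
open scoped Classical

noncomputable section

set_option maxHeartbeats 2000000

/-- Per-step bounds in the gradient flow regime for the two-layer linear network. -/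
theorem gradient_flow_bounds_linear (l r : ℝ → ℝ) (η : ℝ) (p q : ℕ → ℝ)
    (hL : AssumptionL l)
    (hr0 : r 0 = 1) (hrdef : ∀ x : ℝ, x ≠ 0 → r x = deriv l x / x)
    (hR : AssumptionR r)
    (hdyn : LinDyn r η p q)
    (hη : η ∈ Set.Ioo (0 : ℝ) (2 / 33))
    (hp0 : |p 0| ≤ 1)
    (hq0 : q 0 ∈ Set.Ioo (2 / (2 - η)) (min (1 / (16 * η)) (r 1 / (2 * η)))) :
    ∀ t : ℕ,
      (|p t| ≤ (1 - min (2 * (q 0 - 1) / q 0) (r 1 / (2 * q 0))) ^ t ∧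
        (1 - min (2 * (q 0 - 1) / q 0) (r 1 / (2 * q 0))) ^ t ≤ 1) ∧
      (q 0 ≤ q t ∧
        q t ≤ Real.exp (8 * η ^ 2 * q 0 * (min (2 * (q 0 - 1) / q 0) (r 1 / (2 * q 0)))⁻¹) * q 0 ∧
        Real.exp (8 * η ^ 2 * q 0 * (min (2 * (q 0 - 1) / q 0) (r 1 / (2 * q 0)))⁻¹) * q 0 ≤ 2 * q 0) := by
  obtain ⟨heven, hC, -, -, hder, -, -⟩ := hR
  obtain ⟨hdp, hdq⟩ := hdyn
  obtain ⟨hη0, hη1⟩ := hη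
  obtain ⟨hql, hqu⟩ := hq0
  have hanti : AntitoneOn r (Set.Ici 0) := by
    apply antitoneOn_of_deriv_nonpos (convex_Ici 0) hC.continuous.continuousOn
    · exact (hC.differentiable (by norm_num)).differentiableOn
    · intro x hx
      rw [interior_Ici] at hx
      exact (hder x hx).le
  have hrabs : ∀ x, r |x| = r x := by
    intro x
    rcases abs_choice x with h | h <;> rw [h]
    exact heven x
  have hr_le : ∀ x, r x ≤ 1 := by
    intro x
    rw [← hrabs, ← hr0]
    exact hanti (Set.mem_Ici.2 le_rfl) (Set.mem_Ici.2 (abs_nonneg x)) (abs_nonneg x)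
  have hr_ge : ∀ x, |x| ≤ 1 → r 1 ≤ r x := by
    intro x hx
    rw [← hrabs x]
    exact hanti (Set.mem_Ici.2 (abs_nonneg x)) (Set.mem_Ici.2 zero_le_one) hx
  have hqa : q 0 < 1 / (16 * η) := lt_of_lt_of_le hqu (min_le_left _ _)
  have hqb : q 0 < r 1 / (2 * η) := lt_of_lt_of_le hqu (min_le_right _ _)
  rw [lt_div_iff₀ (by positivity)] at hqa hqb
  rw [div_lt_iff₀ (by linarith)] at hql
  set Q := q 0 with hQ
  have hQ1 : 1 < Q := by nlinarith
  have hQ0 : 0 < Q := by linarith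
  have hr1 : 0 < r 1 := by nlinarith [mul_pos hQ0 hη0]
  set m := min (2 * (Q - 1) / Q) (r 1 / (2 * Q)) with hm
  have hmη : η < m := by
    rw [hm, lt_min_iff, lt_div_iff₀ hQ0, lt_div_iff₀ (by positivity)]
    constructor <;> nlinarith
  have hm0 : 0 < m := by linarith
  have hma : m * Q ≤ 2 * (Q - 1) := by
    rw [← le_div_iff₀ hQ0]; exact min_le_left _ _
  have hmb : m * (2 * Q) ≤ r 1 := by
    rw [← le_div_iff₀ (by positivity)]; exact min_le_right _ _
  have hmhalf : m < 1 / 2 := by nlinarith [hr_le 1]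
  have hexp : Real.exp (8 * η ^ 2 * Q * m⁻¹) ≤ 2 := by
    have h1 : 8 * η ^ 2 * Q * m⁻¹ ≤ 1 / 2 := by
      rw [← div_eq_mul_inv, div_le_iff₀ hm0]
      nlinarith
    have h2 : Real.exp (8 * η ^ 2 * Q * m⁻¹) ≤ Real.exp (1 / 2) := Real.exp_le_exp.2 h1
    have h3 : Real.exp (1 / 2) * Real.exp (1 / 2) = Real.exp 1 := by
      rw [← Real.exp_add]; norm_num
    nlinarith [Real.exp_one_lt_d9, Real.exp_pos (1 / 2)]
  have hpow : ∀ t : ℕ, (1 - m) ^ t ≤ 1 := fun t => pow_le_one₀ (by linarith) (by linarith)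
  have hpow0 : ∀ t : ℕ, 0 < (1 - m) ^ t := fun t => pow_pos (by linarith) t
  have hmono : ∀ t : ℕ, Real.exp (8 * η ^ 2 * Q * (m⁻¹ * (1 - (1 - m) ^ t))) * Q
      ≤ Real.exp (8 * η ^ 2 * Q * m⁻¹) * Q := by
    intro t
    apply mul_le_mul_of_nonneg_right _ hQ0.le
    apply Real.exp_le_exp.2
    apply mul_le_mul_of_nonneg_left _ (by positivity)
    have : 0 < m⁻¹ := inv_pos.2 hm0
    nlinarith [hpow0 t]
  have key : ∀ t : ℕ, |p t| ≤ (1 - m) ^ t ∧ Q ≤ q t ∧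
      q t ≤ Real.exp (8 * η ^ 2 * Q * (m⁻¹ * (1 - (1 - m) ^ t))) * Q := by
    intro t
    induction t with
    | zero => simp [hp0, ← hQ]
    | succ t ih =>
      obtain ⟨ih1, ih2, ih3⟩ := ih
      have hp1 : |p t| ≤ 1 := ih1.trans (hpow t)
      have hq2 : q t ≤ 2 * Q := by
        have := hmono t
        nlinarith
      have ra := hr_le (p t)
      have rb := hr_ge (p t) hp1
      have hpsq1 : (p t) ^ 2 ≤ 1 := by rw [← sq_abs]; nlinarith [abs_nonneg (p t)]
      have hpsq : (p t) ^ 2 ≤ (1 - m) ^ t := by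
        rw [← sq_abs]; nlinarith [abs_nonneg (p t)]
      have hpp : 0 ≤ (p t) ^ 2 := sq_nonneg _
      have hqt : 0 < q t := by linarith
      have hηQ : η ^ 2 * Q ≤ 1 / 16 * η := by nlinarith
      refine ⟨?_, ?_⟩
      · rw [hdp t, abs_mul, pow_succ, mul_comm]
        apply mul_le_mul ih1 _ (abs_nonneg _) (hpow0 t).le
        generalize r (p t) = R at *
        have hR0 : 0 < R := by linarith
        have e1 : R / Q ≤ 2 * R / q t := by
          rw [div_le_div_iff₀ hQ0 hqt]
          nlinarith only [mul_le_mul_of_nonneg_left hq2 hR0.le]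
        have e2 : 2 * R / q t ≤ 2 / Q := by
          rw [div_le_div_iff₀ hqt hQ0]
          nlinarith only [mul_le_mul_of_nonneg_right ra hQ0.le, ih2]
        have e3 : η ^ 2 * (p t) ^ 2 * R ^ 2 ≤ R / (2 * Q) := by
          have a1 : η ^ 2 * (p t) ^ 2 ≤ η ^ 2 := by nlinarith [sq_nonneg η]
          have a2 : R ^ 2 ≤ R := by nlinarith
          have a3 : η ^ 2 * (p t) ^ 2 * R ^ 2 ≤ η ^ 2 * R := 
            mul_le_mul a1 a2 (by positivity) (by positivity)
          refine a3.trans ?_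
          rw [le_div_iff₀ (by positivity)]
          have a4 : η ^ 2 * Q ≤ 1 / 2 := by linarith
          nlinarith only [mul_le_mul_of_nonneg_right a4 hR0.le]
        have e4 : m ≤ R / (2 * Q) := by
          rw [le_div_iff₀ (by positivity)]; linarith
        have e5 : R / Q = 2 * (R / (2 * Q)) := by field_simp
        have e6 : 2 / Q ≤ 2 - m := by
          rw [div_le_iff₀ hQ0]; linarith
        have e7 : 0 ≤ η ^ 2 * (p t) ^ 2 * R ^ 2 := by positivity
        rw [abs_le]
        constructor <;> linarith
      · rw [hdq t]
        generalize r (p t) = R at *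
        have hR0 : 0 < R := by linarith
        set x := η ^ 2 * (p t) ^ 2 * R * (2 * q t - R) with hx
        have hx0 : 0 ≤ x := mul_nonneg (by positivity) (by linarith)
        have hx1 : x ≤ 4 * η ^ 2 * Q * (p t) ^ 2 := by
          have b1 : R * (2 * q t - R) ≤ 4 * Q := by
            nlinarith only [mul_le_mul_of_nonneg_right ra hqt.le, sq_nonneg R, hq2]
          have b2 := mul_le_mul_of_nonneg_left b1 (show 0 ≤ η ^ 2 * (p t) ^ 2 by positivity)
          rw [hx]; linarith
        have hx2 : x ≤ 1 / 2 := by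
          have : η ^ 2 * Q * (p t) ^ 2 ≤ η ^ 2 * Q := 
            mul_le_of_le_one_right (by positivity) hpsq1
          linarith
        have hinv1 : 1 ≤ (1 - x)⁻¹ := (one_le_inv₀ (by linarith)).2 (by linarith)
        have hinv2 : (1 - x)⁻¹ ≤ Real.exp (8 * η ^ 2 * Q * (1 - m) ^ t) := by
          have c1 : (1 - x)⁻¹ ≤ 2 * x + 1 := by
            rw [inv_le_iff_one_le_mul₀ (by linarith)]
            nlinarith only [mul_nonneg hx0 (sub_nonneg.2 hx2)]
          have c2 : 2 * x ≤ 8 * η ^ 2 * Q * (1 - m) ^ t := by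
            have := mul_le_mul_of_nonneg_left hpsq (show 0 ≤ 4 * η ^ 2 * Q by positivity)
            linarith
          exact c1.trans ((Real.add_one_le_exp _).trans (Real.exp_le_exp.2 c2))
        refine ⟨ih2.trans (le_mul_of_one_le_left hqt.le hinv1), ?_⟩
        have hsum : 8 * η ^ 2 * Q * (m⁻¹ * (1 - (1 - m) ^ (t + 1))) =
            8 * η ^ 2 * Q * (1 - m) ^ t + 8 * η ^ 2 * Q * (m⁻¹ * (1 - (1 - m) ^ t)) := by
          field_simp
          ring
        rw [hsum, Real.exp_add, mul_assoc]
        exact mul_le_mul hinv2 ih3 hqt.le (Real.exp_pos _).le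
  intro t
  obtain ⟨k1, k2, k3⟩ := key t
  exact ⟨⟨k1, hpow t⟩, k2, k3.trans (hmono t), mul_le_mul_of_nonneg_right hexp hQ0.le⟩
end
end

section
/- There exist constants η₀ > 0 and C > 0 depending only on δ and ℓ such that for every step size η ∈ (0, η₀) the following holds: if |p₀| ≤ 1, q₀ ∈ (c₀, 1-δ), and p_t ≠ 0 for every t with q_t < 1, then there exists a time step t₀ ≤ C such that s_{t₀} ≤ 2/(2 − r(1)), where s_t = q_t/r(p_t). -/
open Filter
open scoped Classical

noncomputable section

/-- Elementary consequences of Assumption (R). -/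
theorem aux_r_props (r : ℝ → ℝ) (hR : AssumptionR r) :
    (∀ x, 0 < r x) ∧ (∀ x, r x ≤ 1) ∧ (∀ x, |x| ≤ 1 → r 1 ≤ r x) ∧ r 1 < 1 := by
  obtain ⟨heven, hC, h0, _, hneg, hTop, _⟩ := hR
  have hanti : StrictAntiOn r (Set.Ici 0) := by
    apply strictAntiOn_of_deriv_neg (convex_Ici 0) hC.continuous.continuousOn
    intro x hx
    rw [interior_Ici] at hx
    exact hneg x hx
  have habs : ∀ x, r |x| = r x := by
    intro x
    rcases abs_choice x with h | h <;> rw [h]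
    exact heven x
  have hnn : ∀ x, 0 ≤ x → 0 ≤ r x := by
    intro x hx
    apply le_of_tendsto hTop
    filter_upwards [eventually_ge_atTop x] with y hy
    exact hanti.antitoneOn hx (hx.trans hy) hy
  refine ⟨?_, ?_, ?_, ?_⟩
  · intro x
    rw [← habs]
    have h1 := hnn (|x| + 1) (by positivity)
    have h2 := hanti (abs_nonneg x : |x| ∈ Set.Ici (0:ℝ))
      (by positivity : (0:ℝ) ≤ |x| + 1) (by linarith : |x| < |x| + 1)
    linarith
  · intro x
    rw [← habs, ← h0]
    exact hanti.antitoneOn (le_refl (0:ℝ)) (abs_nonneg x) (abs_nonneg x)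
  · intro x hx
    rw [← habs x]
    exact hanti.antitoneOn (abs_nonneg x) (zero_le_one' ℝ) hx
  · have h := hanti (le_refl (0:ℝ)) (zero_le_one' ℝ) zero_lt_one
    rwa [h0] at h

/-- One step of the `p` dynamics contracts. -/
theorem aux_p_step (R1 R q p e : ℝ) (hR1 : 0 < R1) (hRR : R1 ≤ R) (hR1' : R ≤ 1)
    (hq : 1 / 2 ≤ q) (hq1 : q ≤ 1) (hp : |p| ≤ 1) (he0 : 0 ≤ e) (he : e ≤ R1 / 2)
    (hlt : R1 < 1) (hs : 2 / (2 - R1) < q / R) :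
    |(1 - 2 * R / q + e * p ^ 2 * R ^ 2) * p| ≤ (1 - R1 / 2) * |p| := by
  have hR : 0 < R := by linarith
  have hqp : 0 < q := by linarith
  rw [div_lt_div_iff₀ (by linarith) hR] at hs
  have h1 : 2 * R / q ≤ 2 - R1 := by
    rw [div_le_iff₀ hqp]; linarith
  have h2 : 2 * R1 ≤ 2 * R / q := by
    rw [le_div_iff₀ hqp]; nlinarith
  have hp2 : p ^ 2 ≤ 1 := (sq_le_one_iff_abs_le_one p).2 hp
  have hR2 : R ^ 2 ≤ 1 := by nlinarith
  have hm : p ^ 2 * R ^ 2 ≤ 1 := mul_le_one₀ hp2 (by positivity) hR2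
  have h3 : e * p ^ 2 * R ^ 2 ≤ R1 / 2 := by
    rw [mul_assoc]
    nlinarith [mul_le_mul_of_nonneg_left hm he0]
  have h4 : 0 ≤ e * p ^ 2 * R ^ 2 := by positivity
  rw [abs_mul]
  apply mul_le_mul_of_nonneg_right _ (abs_nonneg p)
  rw [abs_le]
  constructor <;> linarith

/-- One step of the `q` dynamics changes `q` by a small nonnegative amount. -/
theorem aux_q_step (R q p e : ℝ) (hR : 0 < R) (hR1' : R ≤ 1)
    (hq : 1 / 2 ≤ q) (hq1 : q ≤ 1) (hp : |p| ≤ 1) (he0 : 0 ≤ e) (he : e ≤ 1 / 4) :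
    1 / 2 ≤ (1 - e * p ^ 2 * R * (2 * q - R))⁻¹ * q ∧
      (1 - e * p ^ 2 * R * (2 * q - R))⁻¹ * q ≤ q + 4 * e := by
  have hp2 : p ^ 2 ≤ 1 := (sq_le_one_iff_abs_le_one p).2 hp
  have hm : p ^ 2 * R ≤ 1 := mul_le_one₀ hp2 hR.le hR1'
  have hm0 : 0 ≤ p ^ 2 * R := by positivity
  have hw0 : 0 ≤ 2 * q - R := by linarith
  have hw : 2 * q - R ≤ 2 := by linarith
  obtain ⟨x, hx⟩ : ∃ x, x = e * p ^ 2 * R * (2 * q - R) := ⟨_, rfl⟩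
  rw [← hx]
  have hx0 : 0 ≤ x := by rw [hx]; positivity
  have hx1 : x ≤ 2 * e := by
    have : p ^ 2 * R * (2 * q - R) ≤ 1 * 2 := mul_le_mul hm hw hw0 zero_le_one
    have := mul_le_mul_of_nonneg_left this he0
    rw [hx]; nlinarith
  have hD : 0 < 1 - x := by linarith
  rw [inv_mul_eq_div]
  constructor
  · rw [le_div_iff₀ hD]; linarith
  · rw [div_le_iff₀ hD]
    nlinarith [mul_nonneg he0 hx0, mul_nonneg hx0 (by linarith : 0 ≤ 1 - q),
      mul_le_mul_of_nonneg_left (by linarith : x ≤ 1 / 2) he0]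

/-- Early-phase bound: `s_{t₀} ≤ 2/(2 - r 1)` for some `t₀ = O(1)`. -/
theorem eos_s_initial_bound_linear (l r : ℝ → ℝ) (δ : ℝ)
    (hL : AssumptionL l)
    (hr0 : r 0 = 1) (hrdef : ∀ x : ℝ, x ≠ 0 → r x = deriv l x / x)
    (hR : AssumptionR r) (hR2 : AssumptionR2 r)
    (hδ : δ ∈ Set.Ioo 0 (1 - cZero r)) :
    ∃ η₀ > (0 : ℝ), ∃ C > (0 : ℝ),
      ∀ η : ℝ, 0 < η → η < η₀ →
        ∀ p q : ℕ → ℝ, LinDyn r η p q →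
          |p 0| ≤ 1 → q 0 ∈ Set.Ioo (cZero r) (1 - δ) →
          (∀ t : ℕ, q t < 1 → p t ≠ 0) →
          ∃ t₀ : ℕ, (t₀ : ℝ) ≤ C ∧ q t₀ / r (p t₀) ≤ 2 / (2 - r 1) := by
  obtain ⟨hpos, hle1, hge, hlt⟩ := aux_r_props r hR
  have hcont : Continuous r := hR.2.1.continuous
  have hr1 : 0 < r 1 := hpos 1
  have hδ0 : 0 < δ := hδ.1
  -- near `0`, `r` is close to `1`
  obtain ⟨ρ, hρ, hρr⟩ : ∃ ρ > 0, ∀ x, |x| < ρ → 1 - r 1 / 2 < r x := by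
    have h1 : ∀ᶠ x in nhds 0, 1 - r 1 / 2 < r x :=
      hcont.continuousAt.eventually (lt_mem_nhds (by rw [hr0]; linarith))
    obtain ⟨ρ, hρ, h⟩ := Metric.eventually_nhds_iff.1 h1
    exact ⟨ρ, hρ, fun x hx => h (by simpa [Real.dist_eq] using hx)⟩
  have hk0 : 0 ≤ 1 - r 1 / 2 := by linarith
  have hk1 : 1 - r 1 / 2 < 1 := by linarith
  obtain ⟨T, hT⟩ := exists_pow_lt_of_lt_one hρ hk1
  have hTpos : (0:ℝ) < 4 * (T + 1) := by positivity
  refine ⟨min (1 / 4) (min (r 1 / 2) (δ / (4 * (T + 1)))), by positivity, T + 1, by positivity, ?_⟩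
  intro η hη hη0 p q hdyn hp0 hq0 _
  obtain ⟨hdp, hdq⟩ := hdyn
  rw [lt_min_iff, lt_min_iff, lt_div_iff₀ hTpos] at hη0
  obtain ⟨hη1, hη2, hη3⟩ := hη0
  have hsq : η ^ 2 ≤ η := by nlinarith
  have hsq0 : 0 ≤ η ^ 2 := by positivity
  have hqlow : 1 / 2 ≤ q 0 := (le_max_right (r (zZero r)) (1 / 2)).trans hq0.1.le
  by_contra hcon
  push Not at hcon
  have hT' : ∀ t : ℕ, t ≤ T → 2 / (2 - r 1) < q t / r (p t) := by
    intro t ht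
    apply hcon
    have : (t:ℝ) ≤ T := by exact_mod_cast ht
    linarith
  have hqub : ∀ t : ℕ, t ≤ T → 1 - δ + 4 * η ^ 2 * t ≤ 1 := by
    intro t ht
    have h1 : (t:ℝ) ≤ T := by exact_mod_cast ht
    have h2 : η ^ 2 * t ≤ η * (T + 1) :=
      mul_le_mul hsq (by linarith) (by positivity) hη.le
    nlinarith
  have key : ∀ t : ℕ, t ≤ T →
      |p t| ≤ (1 - r 1 / 2) ^ t ∧ 1 / 2 ≤ q t ∧ q t ≤ 1 - δ + 4 * η ^ 2 * t := by
    intro t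
    induction t with
    | zero =>
      intro _
      refine ⟨by simpa using hp0, hqlow, ?_⟩
      have := hq0.2.le
      simpa using this
    | succ t ih =>
      intro ht
      have htT : t ≤ T := by omega
      obtain ⟨h1, h2, h3⟩ := ih htT
      have hp1 : |p t| ≤ 1 := h1.trans (pow_le_one₀ hk0 hk1.le)
      have hq1 : q t ≤ 1 := h3.trans (hqub t htT)
      have hP := aux_p_step (r 1) (r (p t)) (q t) (p t) (η ^ 2) hr1 (hge _ hp1) (hle1 _) h2 hq1
        hp1 hsq0 (by linarith) hlt (hT' t htT)
      have hQ := aux_q_step (r (p t)) (q t) (p t) (η ^ 2) (hpos _) (hle1 _) h2 hq1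
        hp1 hsq0 (by linarith)
      rw [← hdp t] at hP
      rw [← hdq t] at hQ
      refine ⟨?_, hQ.1, ?_⟩
      · rw [pow_succ']
        exact hP.trans (mul_le_mul_of_nonneg_left h1 hk0)
      · have := hQ.2
        push_cast
        linarith
  obtain ⟨h1, h2, h3⟩ := key T le_rfl
  have h4 := hρr (p T) (h1.trans_lt hT)
  have h5 : q T ≤ 1 := h3.trans (hqub T le_rfl)
  have h6 := hT' T le_rfl
  rw [div_lt_div_iff₀ (by linarith) (hpos _)] at h6
  nlinarith
end
end

section
/- There exist constants η₀ > 0 and C > 0 depending only on δ and ℓ such that for every step size η ∈ (0, η₀) the following holds. Suppose |p₀| ≤ 1 and q₀ ∈ (c₀, 1-δ). If at some time step t one has q_t < 1 and s_t ≤ 1 (where s_t = q_t/r(p_t)), then s_{t+1} ≤ 1 + Cη². -/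
open Filter
open scoped Classical

noncomputable section

theorem aux_anti {r : ℝ → ℝ} (hR : AssumptionR r) : StrictAntiOn r (Set.Ici 0) := by
  obtain ⟨_, hc, _, _, hd, _, _⟩ := hR
  apply strictAntiOn_of_deriv_neg (convex_Ici 0) hc.continuous.continuousOn
  intro x hx
  rw [interior_Ici] at hx
  exact hd x hx

theorem aux_abs {r : ℝ → ℝ} (hR : AssumptionR r) (x : ℝ) : r |x| = r x := by
  rcases abs_choice x with h | h <;> rw [h]
  exact hR.1 x

theorem aux_pos {r : ℝ → ℝ} (hR : AssumptionR r) (x : ℝ) : 0 < r x := by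
  rw [← aux_abs hR x]
  have ha := aux_anti hR
  have h0 := abs_nonneg x
  have h1 : r (|x| + 1) < r |x| :=
    ha (Set.mem_Ici.2 h0) (Set.mem_Ici.2 (by linarith)) (by linarith)
  have h2 : 0 ≤ r (|x| + 1) := by
    apply le_of_tendsto hR.2.2.2.2.2.1
    filter_upwards [eventually_ge_atTop (|x| + 1)] with y hy
    exact ha.antitoneOn (Set.mem_Ici.2 (by linarith)) (Set.mem_Ici.2 (by linarith)) hy
  linarith

theorem aux_le_one {r : ℝ → ℝ} (hR : AssumptionR r) (x : ℝ) : r x ≤ 1 := by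
  rw [← aux_abs hR x, ← hR.2.2.1]
  exact (aux_anti hR).antitoneOn (Set.mem_Ici.2 le_rfl) (Set.mem_Ici.2 (abs_nonneg x))
    (abs_nonneg x)

/-- points whose `r`-value exceeds `r z₀` satisfy the elasticity bound. -/
theorem aux_elastic {r : ℝ → ℝ} (hR : AssumptionR r) (hR2 : AssumptionR2 r) {w : ℝ}
    (hw : 0 ≤ w) (h : r (zZero r) < r w) {x : ℝ} (hx : 0 < x) (hxw : x ≤ w) :
    -(1 / 2) * r x ≤ x * deriv r x := by
  have hmem : (0 : ℝ) ∈ {z : ℝ | z * deriv r z / r z ≥ -(1 / 2)} := by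
    simp
  have hz : 0 ≤ zZero r := by
    unfold zZero
    by_cases hb : BddAbove {z : ℝ | z * deriv r z / r z ≥ -(1 / 2)}
    · exact le_csSup hb hmem
    · rw [Real.sSup_of_not_bddAbove hb]
  have hlt : w < zZero r := by
    by_contra hcon
    have := (aux_anti hR).antitoneOn (Set.mem_Ici.2 hz) (Set.mem_Ici.2 hw) (not_lt.1 hcon)
    linarith
  obtain ⟨v, hv, hwv⟩ := exists_lt_of_lt_csSup ⟨0, hmem⟩ hlt
  have h1 := hR2.2.2.1 (Set.mem_Ioi.2 hx) (Set.mem_Ioi.2 (show 0 < v by linarith))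
    (show x < v by linarith)
  have h2 : -(1 / 2) ≤ x * deriv r x / r x := le_trans hv h1.le
  rwa [le_div_iff₀ (aux_pos hR x)] at h2

/-- the one-step comparison. -/
theorem aux_key {r : ℝ → ℝ} (hR : AssumptionR r) (hR2 : AssumptionR2 r) {p q : ℝ}
    (hp : 0 ≤ p) (hq : 0 < q) (hqz : r (zZero r) < q) (hqr : q ≤ r p) :
    q ≤ r ((2 * r p / q - 1) * p) := by
  have hcont : Continuous r := hR.2.1.continuous
  have hdiff : Differentiable ℝ r := hR.2.1.differentiable (by norm_num)
  obtain ⟨w, hpw, hw⟩ : ∃ w, p ≤ w ∧ r w = q := by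
    obtain ⟨b, hb1, hb2⟩ := ((hR.2.2.2.2.2.1.eventually (gt_mem_nhds hq)).and
      (eventually_ge_atTop p)).exists
    obtain ⟨w, hw, hwq⟩ := intermediate_value_Icc' hb2 hcont.continuousOn ⟨hb1.le, hqr⟩
    exact ⟨w, hw.1, hwq⟩
  have hw0 : 0 ≤ w := hp.trans hpw
  have hmono : MonotoneOn (fun v => (v + p) * r v) (Set.Icc p w) := by
    apply monotoneOn_of_deriv_nonneg (convex_Icc p w)
    · fun_prop
    · exact (by fun_prop : Differentiable ℝ (fun v => (v + p) * r v)).differentiableOn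
    · intro x hx
      rw [interior_Icc] at hx
      have hx0 : 0 < x := lt_of_le_of_lt hp hx.1
      have hD : HasDerivAt (fun v => (v + p) * r v) (1 * r x + (x + p) * deriv r x) x :=
        ((hasDerivAt_id x).add_const p).mul (hdiff x).hasDerivAt
      rw [hD.deriv]
      have he := aux_elastic hR hR2 hw0 (by rw [hw]; exact hqz) hx0 hx.2.le
      have hn := hR.2.2.2.2.1 x hx0
      nlinarith [mul_nonneg (sub_nonneg.2 hx.1.le) (neg_nonneg.2 hn.le)]
  have hg := hmono (Set.left_mem_Icc.2 hpw) (Set.right_mem_Icc.2 hpw) hpw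
  simp only [hw] at hg
  have h1 : 1 ≤ r p / q := by rwa [le_div_iff₀ hq, one_mul]
  have h2 : (2 * r p / q - 1) * p ≤ w := by
    have : (2 * r p / q - 1) * p = (2 * r p * p - q * p) / q := by
      field_simp
    rw [this, div_le_iff₀ hq]
    nlinarith
  have h3 : 0 ≤ (2 * r p / q - 1) * p := by
    apply mul_nonneg _ hp
    rw [mul_div_assoc]; linarith
  calc q = r w := hw.symm
    _ ≤ _ := (aux_anti hR).antitoneOn (Set.mem_Ici.2 h3) (Set.mem_Ici.2 hw0) h2

theorem aux_step_nonpos {ρ η p q : ℝ} (hρ : 0 < ρ) (hq : q ≤ 0) :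
    (1 - η ^ 2 * p ^ 2 * ρ * (2 * q - ρ))⁻¹ * q ≤ 0 := by
  apply mul_nonpos_of_nonneg_of_nonpos _ hq
  apply inv_nonneg.2
  have : 0 ≤ η ^ 2 * p ^ 2 * ρ * (ρ - 2 * q) :=
    mul_nonneg (by positivity) (by linarith)
  nlinarith

theorem aux_inv {r : ℝ → ℝ} (hR : AssumptionR r) {η : ℝ} {p q : ℕ → ℝ}
    (hD : LinDyn r η p q) (h0 : cZero r < q 0) (t : ℕ) : q t ≤ 0 ∨ cZero r < q t := by
  induction t with
  | zero => exact Or.inr h0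
  | succ t ih =>
    have hρ := aux_pos hR (p t)
    rw [hD.2 t]
    rcases ih with h | h
    · exact Or.inl (aux_step_nonpos hρ h)
    · have hc : 1 / 2 ≤ cZero r := le_max_right _ _
      have h1 := aux_le_one hR (p t)
      have hn : 0 ≤ η ^ 2 * (p t) ^ 2 * r (p t) * (2 * q t - r (p t)) :=
        mul_nonneg (by positivity) (by linarith)
      rcases le_or_gt (1 - η ^ 2 * (p t) ^ 2 * r (p t) * (2 * q t - r (p t))) 0 with hd | hd
      · left
        exact mul_nonpos_of_nonpos_of_nonneg (inv_nonpos.2 hd) (by linarith)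
      · right
        have := (one_le_inv₀ hd).2 (by linarith)
        nlinarith

theorem aux_lip {l r : ℝ → ℝ} (hL : AssumptionL l)
    (hrdef : ∀ x : ℝ, x ≠ 0 → r x = deriv l x / x) (x : ℝ) : x ^ 2 * (r x) ^ 2 ≤ 1 := by
  by_cases hx : x = 0
  · simp [hx]
  · have h := norm_deriv_le_of_lipschitz (x₀ := x) hL.2.2.1
    rw [hrdef x hx, div_pow, mul_div_cancel₀ _ (pow_ne_zero 2 hx)]
    rw [sq_le_one_iff_abs_le_one]
    simpa using h

/-- If `s_t ≤ 1` then `s_{t+1} ≤ 1 + O(η²)`. -/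
theorem eos_s_le_one_linear (l r : ℝ → ℝ) (δ : ℝ)
    (hL : AssumptionL l)
    (hr0 : r 0 = 1) (hrdef : ∀ x : ℝ, x ≠ 0 → r x = deriv l x / x)
    (hR : AssumptionR r) (hR2 : AssumptionR2 r)
    (hδ : δ ∈ Set.Ioo 0 (1 - cZero r)) :
    ∃ η₀ > (0 : ℝ), ∃ C > (0 : ℝ),
      ∀ η : ℝ, 0 < η → η < η₀ →
        ∀ p q : ℕ → ℝ, LinDyn r η p q →
          |p 0| ≤ 1 → q 0 ∈ Set.Ioo (cZero r) (1 - δ) →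
          ∀ t : ℕ, q t < 1 → q t / r (p t) ≤ 1 →
            q (t + 1) / r (p (t + 1)) ≤ 1 + C * η ^ 2 := by
  refine ⟨1 / 2, by norm_num, 2, by norm_num, ?_⟩
  intro η hη hη2 p q hD _ hq0 t hq1 hs
  have hρ := aux_pos hR (p t)
  have hρ' := aux_pos hR (p (t + 1))
  rcases aux_inv hR hD hq0.1 t with h | h
  · have h1 : q (t + 1) ≤ 0 := by
      rw [hD.2 t]
      exact aux_step_nonpos hρ h
    have h2 : q (t + 1) / r (p (t + 1)) ≤ 0 := div_nonpos_of_nonpos_of_nonneg h1 hρ'.le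
    nlinarith [sq_nonneg η]
  · have hc : 1 / 2 ≤ cZero r := le_max_right _ _
    have hz : r (zZero r) ≤ cZero r := le_max_left _ _
    have hq : 0 < q t := by linarith
    have hqr : q t ≤ r (p t) := by rwa [div_le_one hρ] at hs
    have hlip := aux_lip hL hrdef (p t)
    have hlip0 : 0 ≤ (p t) ^ 2 * (r (p t)) ^ 2 := by positivity
    have hη4 : η ^ 2 ≤ 1 / 4 := by nlinarith
    -- lower bound on the new `r`
    have hkey : q t ≤ r (p (t + 1)) := by
      have hk := aux_key hR hR2 (abs_nonneg (p t)) hq (by linarith)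
        (by rw [aux_abs hR]; exact hqr)
      rw [aux_abs hR] at hk
      refine hk.trans ?_
      rw [← aux_abs hR (p (t + 1))]
      have h1 : 1 ≤ r (p t) / q t := by rwa [le_div_iff₀ hq, one_mul]
      have h2 : |p (t + 1)| ≤ (2 * r (p t) / q t - 1) * |p t| := by
        rw [hD.1 t, abs_mul]
        apply mul_le_mul_of_nonneg_right _ (abs_nonneg _)
        rw [mul_div_assoc, abs_le]
        constructor <;> nlinarith [mul_nonneg (sq_nonneg η) hlip0]
      exact (aux_anti hR).antitoneOn (Set.mem_Ici.2 (abs_nonneg _))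
        (Set.mem_Ici.2 ((abs_nonneg _).trans h2)) h2
    have hA : η ^ 2 * (p t) ^ 2 * r (p t) * (2 * q t - r (p t)) ≤ η ^ 2 := by
      have : (p t) ^ 2 * r (p t) * (2 * q t - r (p t)) ≤ (p t) ^ 2 * r (p t) * r (p t) :=
        mul_le_mul_of_nonneg_left (by linarith) (by positivity)
      nlinarith [sq_nonneg η]
    have hq' : q (t + 1) ≤ (1 + 2 * η ^ 2) * q t := by
      rw [hD.2 t]
      apply mul_le_mul_of_nonneg_right _ hq.le
      rw [inv_le_iff_one_le_mul₀ (by linarith)]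
      nlinarith [sq_nonneg η]
    rw [div_le_iff₀ hρ']
    exact hq'.trans (mul_le_mul_of_nonneg_left hkey (by positivity))
end
end

section
/- There exist constants η₀ > 0, C > 0, and d ∈ (0, 1/2] depending only on δ and ℓ such that for every step size η ∈ (0, η₀) the following holds. Suppose |p₀| ≤ 1, q₀ ∈ (c₀, 1-δ), and p_t ≠ 0 whenever q_t < 1. If at some time step t one has q_t ≤ 1 − δ/2, s_t < 2(1+η²)^{-1}, |s_t − 1| > η²/2, and r(p_t) ≤ 1 − δ/4 (where s_t = q_t/r(p_t)), then |s_{t+1} − 1| ≤ (1 − d)|s_t − 1| + Cη². -/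
open Filter
open scoped Classical

noncomputable section

/-- Convenient consequences of the assumptions. -/
structure Good (r : ℝ → ℝ) : Prop where
  even : ∀ p, r (-p) = r p
  diff : ∀ p, HasDerivAt r (deriv r p) p
  cont1 : ContDiff ℝ 1 r
  zero : r 0 = 1
  pos : ∀ p, 0 < r p
  anti : StrictAntiOn r (Set.Ici 0)
  le_one : ∀ p, r p ≤ 1
  bound_one : ∀ p, |p * r p| ≤ 1
  lim : Tendsto r atTop (nhds 0)
  mono : ∀ p, 0 < p → 0 ≤ r p + p * deriv r p
  dneg : ∀ p, 0 < p → deriv r p < 0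
  gconv : StrictAnti (fun z => deriv r z / (r z) ^ 2)
  elas : StrictAntiOn (fun z => z * deriv r z / r z) (Set.Ioi 0)

lemma good_of (l r : ℝ → ℝ) (hL : AssumptionL l)
    (hr0 : r 0 = 1) (hrdef : ∀ x : ℝ, x ≠ 0 → r x = deriv l x / x)
    (hR : AssumptionR r) (hR2 : AssumptionR2 r) : Good r := by
  obtain ⟨hconv, hev, hlip, hd1, hd2, -⟩ := hL
  obtain ⟨reven, rC, -, -, rneg, rtop, -⟩ := hR
  obtain ⟨-, h1, h2, -, -, -⟩ := hR2
  have hdiff : ∀ p, HasDerivAt r (deriv r p) p := fun p =>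
    ((rC.differentiable (by norm_num)) p).hasDerivAt
  have hanti : StrictAntiOn r (Set.Ici 0) := by
    apply strictAntiOn_of_deriv_neg (convex_Ici 0) rC.continuous.continuousOn
    intro x hx
    rw [interior_Ici] at hx
    exact rneg x hx
  have hpos0 : ∀ p, 0 ≤ p → 0 < r p := by
    intro p hp
    have h3 : r (p + 1) < r p := hanti hp (by simp; linarith) (by linarith)
    have h4 : 0 ≤ r (p + 1) := by
      apply le_of_tendsto rtop
      filter_upwards [eventually_ge_atTop (p + 1)] with x hx
      exact hanti.antitoneOn (by simp; linarith) (by simp; linarith) hx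
    linarith
  have habs : ∀ p, r |p| = r p := by
    intro p
    rcases abs_choice p with h | h <;> rw [h]
    exact reven p
  have heq : ∀ p, p ≠ 0 → p * r p = deriv l p := by
    intro p hp
    rw [hrdef p hp]; field_simp
  have hmd : Monotone (deriv l) := by
    have := hconv.monotoneOn_deriv (fun x _ => hd1 x)
    intro a b hab
    exact this (by trivial) (by trivial) hab
  refine ⟨reven, hdiff, rC, hr0, fun p => habs p ▸ hpos0 _ (abs_nonneg p), hanti, ?_, ?_, rtop, ?_,
    rneg, h1, h2⟩
  · intro p
    rw [← habs p, ← hr0]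
    exact hanti.antitoneOn (by simp) (by simp) (abs_nonneg p)
  · intro p
    by_cases hp : p = 0
    · simp [hp]
    · rw [heq p hp]
      have := norm_deriv_le_of_lipschitz (x₀ := p) hlip
      simpa using this
  · intro p hp
    have h3 : HasDerivAt (fun x => x * r x) (1 * r p + p * deriv r p) p :=
      (hasDerivAt_id p).mul (hdiff p)
    have h4 : (fun x => x * r x) =ᶠ[nhds p] deriv l := by
      filter_upwards [lt_mem_nhds hp] with x hx
      exact heq x hx.ne'
    have h5 : deriv (deriv l) p = 1 * r p + p * deriv r p := by
      rw [← h4.deriv_eq, h3.deriv]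
    have h6 : 0 ≤ deriv (deriv l) p := hmd.deriv_nonneg
    rw [h5] at h6
    linarith

/-- Tangent bounds for the convex function `1/r`. -/
lemma Good.tangent {r : ℝ → ℝ} (h : Good r) {a b : ℝ} (hab : a ≤ b) :
    -(deriv r a / r a ^ 2) * (b - a) ≤ (r b)⁻¹ - (r a)⁻¹ ∧
    (r b)⁻¹ - (r a)⁻¹ ≤ -(deriv r b / r b ^ 2) * (b - a) := by
  rcases hab.eq_or_lt with rfl | hab
  · simp
  have hd : ∀ x, HasDerivAt (fun y => (r y)⁻¹) (-deriv r x / r x ^ 2) x := fun x =>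
    (h.diff x).inv (h.pos x).ne'
  obtain ⟨c, hc, hc'⟩ := exists_hasDerivAt_eq_slope (fun y => (r y)⁻¹) _ hab
    (fun x _ => (hd x).continuousAt.continuousWithinAt) (fun x _ => hd x)
  have e : (r b)⁻¹ - (r a)⁻¹ = -(deriv r c / r c ^ 2) * (b - a) := by
    rw [neg_div] at hc'
    rw [hc']
    have : b - a ≠ 0 := by linarith
    field_simp
  have h1 := h.gconv hc.1
  have h2 := h.gconv hc.2
  try simp only at h1 h2
  rw [e]
  constructor <;> apply mul_le_mul_of_nonneg_right <;> linarith

/-- contraction, `s < 1` side -/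
lemma Good.caseA {r : ℝ → ℝ} (h : Good r) {p z κ : ℝ} (hp : 0 < p) (hpz : p ≤ z)
    (hz : -(1 / 2) ≤ z * deriv r z / r z) (hκ : κ ≤ -(p * deriv r p / r p)) (hκ1 : κ ≤ 1) :
    |r z / r ((2 * r p / r z - 1) * p) - 1| ≤ (1 - κ) * |r z / r p - 1| := by
  have hrz := h.pos z
  have hrp := h.pos p
  have hle : r z ≤ r p := h.anti.antitoneOn hp.le (hp.le.trans hpz) hpz
  set w := (2 * r p / r z - 1) * p with hw
  have hwp : p ≤ w := by
    have : 1 ≤ r p / r z := by rw [le_div_iff₀ hrz]; linarith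
    have e : w - p = 2 * (r p / r z - 1) * p := by rw [hw]; ring
    have : 0 ≤ 2 * (r p / r z - 1) * p := by apply mul_nonneg <;> linarith
    linarith
  have hd : ∀ x, HasDerivAt (fun y => (2 * r y / r z - 1) * y)
      ((2 * deriv r x / r z) * x + (2 * r x / r z - 1) * 1) x := fun x =>
    ((((h.diff x).const_mul 2).div_const (r z)).sub_const 1).mul (hasDerivAt_id x)
  have hwz : w ≤ z := by
    have hm : MonotoneOn (fun y => (2 * r y / r z - 1) * y) (Set.Icc p z) := by
      apply monotoneOn_of_deriv_nonneg (convex_Icc p z)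
        (fun x _ => (hd x).continuousAt.continuousWithinAt)
        (fun x _ => (hd x).differentiableAt.differentiableWithinAt)
      intro x hx
      rw [interior_Icc] at hx
      rw [(hd x).deriv]
      have hx0 : 0 < x := hp.trans hx.1
      have h1 := h.elas.antitoneOn (Set.mem_Ioi.2 hx0) (Set.mem_Ioi.2 (hx0.trans hx.2)) hx.2.le
      try simp only at h1
      have h2 : -(1 / 2) ≤ x * deriv r x / r x := hz.trans h1
      have hrx := h.pos x
      rw [le_div_iff₀ hrx] at h2
      have h3 : r z ≤ r x := h.anti.antitoneOn hx0.le (hx0.trans hx.2).le hx.2.le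
      have e : 2 * deriv r x / r z * x + (2 * r x / r z - 1) * 1
        = (2 * (x * deriv r x) + 2 * r x - r z) / r z := by field_simp; ring
      rw [e]
      apply div_nonneg _ hrz.le
      linarith
    have := hm (Set.left_mem_Icc.2 hpz) (Set.right_mem_Icc.2 hpz) hpz
    try simp only at this
    have e : (2 * r z / r z - 1) * z = z := by field_simp; ring
    rw [e] at this
    exact this
  have hrw := h.pos w
  have hle2 : r z ≤ r w := h.anti.antitoneOn (hp.le.trans hwp) (hp.le.trans hpz) hwz
  have ht := (h.tangent hwp).1
  have e1 : w - p = 2 * p * r p * ((r z)⁻¹ - (r p)⁻¹) := by rw [hw]; field_simp; ring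
  rw [e1] at ht
  have e2 : -(deriv r p / r p ^ 2) * (2 * p * r p * ((r z)⁻¹ - (r p)⁻¹))
    = 2 * (-(p * deriv r p / r p)) * ((r z)⁻¹ - (r p)⁻¹) := by field_simp
  rw [e2] at ht
  have hgz : (r p)⁻¹ ≤ (r z)⁻¹ := inv_anti₀ hrz hle
  have h0 : 0 ≤ -(p * deriv r p / r p) := by
    rw [← neg_div, ← mul_neg]
    have := h.dneg p hp
    apply div_nonneg (mul_nonneg hp.le (by linarith)) hrp.le
  have key : κ * ((r z)⁻¹ - (r p)⁻¹) ≤ (r w)⁻¹ - (r p)⁻¹ := by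
    refine le_trans ?_ ht
    apply mul_le_mul_of_nonneg_right <;> linarith
  rw [abs_of_nonpos (by rw [sub_nonpos, div_le_one hrw]; exact hle2),
    abs_of_nonpos (by rw [sub_nonpos, div_le_one hrp]; exact hle)]
  have e3 : ∀ x, -(r z / x - 1) = r z * ((r z)⁻¹ - x⁻¹) := by
    intro x; rw [mul_sub, mul_inv_cancel₀ hrz.ne']; ring
  rw [e3, e3]
  have := mul_le_mul_of_nonneg_left key hrz.le
  linarith

/-- contraction, `s > 1` side -/
lemma Good.caseB {r : ℝ → ℝ} (h : Good r) {p z κ ε : ℝ} (hz : 0 < z) (hpz : z ≤ p)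
    (hs : r z ≤ 2 * r p) (hκ : κ ≤ -(z * deriv r z / r z)) (hκ1 : κ ≤ 1)
    (hε : ε ≤ 1 + p * deriv r p / r p) (hκε : κ ≤ ε) (hε0 : 0 < ε) :
    |r z / r ((2 * r p / r z - 1) * p) - 1| ≤ (1 - κ) * |r z / r p - 1| := by
  have hp : 0 < p := hz.trans_le hpz
  have hrz := h.pos z
  have hrp := h.pos p
  have hle : r p ≤ r z := h.anti.antitoneOn hz.le hp.le hpz
  set w := (2 * r p / r z - 1) * p with hw
  have hw0 : 0 ≤ w := by
    apply mul_nonneg _ hp.le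
    rw [sub_nonneg, le_div_iff₀ hrz]; linarith
  have hrw := h.pos w
  have hgz : (r z)⁻¹ ≤ (r p)⁻¹ := inv_anti₀ hrp hle
  have e3 : ∀ x, r z / x - 1 = r z * (x⁻¹ - (r z)⁻¹) := by
    intro x; rw [mul_sub, mul_inv_cancel₀ hrz.ne']; ring
  have e1 : p - w = 2 * p * r p * ((r p)⁻¹ - (r z)⁻¹) := by rw [hw]; field_simp; ring
  have hwp : w ≤ p := by
    have : 0 ≤ 2 * p * r p * ((r p)⁻¹ - (r z)⁻¹) :=
      mul_nonneg (by positivity) (by linarith)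
    linarith
  have hzn := h.dneg z hz
  have hg0 : 0 ≤ -(deriv r z / r z ^ 2) := by
    rw [← neg_div]; apply div_nonneg <;> [linarith; positivity]
  rw [abs_of_nonneg (a := r z / r p - 1) (by rw [sub_nonneg, one_le_div hrp]; exact hle)]
  rcases le_total z w with hzw | hzw
  · have hle2 : r w ≤ r z := h.anti.antitoneOn hz.le hw0 hzw
    rw [abs_of_nonneg (by rw [sub_nonneg, one_le_div hrw]; exact hle2), e3, e3]
    have ht := (h.tangent hwp).1
    have hgw := h.gconv.antitone hzw
    try simp only at hgw
    have h1 : -(deriv r z / r z ^ 2) * (p - w) ≤ (r p)⁻¹ - (r w)⁻¹ := by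
      refine le_trans ?_ ht
      apply mul_le_mul_of_nonneg_right <;> linarith
    have h2 : z * r z * ((r p)⁻¹ - (r z)⁻¹) ≤ p - w := by
      rw [e1]
      apply mul_le_mul_of_nonneg_right _ (by linarith)
      nlinarith
    have h3 := mul_le_mul_of_nonneg_left h2 hg0
    have e2 : -(deriv r z / r z ^ 2) * (z * r z * ((r p)⁻¹ - (r z)⁻¹))
      = (-(z * deriv r z / r z)) * ((r p)⁻¹ - (r z)⁻¹) := by field_simp
    rw [e2] at h3
    have h4 : κ * ((r p)⁻¹ - (r z)⁻¹) ≤ (-(z * deriv r z / r z)) * ((r p)⁻¹ - (r z)⁻¹) :=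
      mul_le_mul_of_nonneg_right hκ (by linarith)
    have key : κ * ((r p)⁻¹ - (r z)⁻¹) ≤ (r p)⁻¹ - (r w)⁻¹ := by linarith
    have := mul_le_mul_of_nonneg_left key hrz.le
    linarith
  · have hle2 : r z ≤ r w := h.anti.antitoneOn hw0 hz.le hzw
    rw [abs_of_nonpos (by rw [sub_nonpos, div_le_one hrw]; exact hle2), e3, e3]
    have t1 := (h.tangent hzw).2
    have t2 := (h.tangent hpz).1
    have hd : ∀ x, HasDerivAt (fun y => (1 - ε / 2) * y - y * (1 - r y / r z))
        ((1 - ε / 2) * 1 - (1 * (1 - r x / r z) + x * (0 - deriv r x / r z))) x := fun x =>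
      ((hasDerivAt_id x).const_mul _).sub
        ((hasDerivAt_id x).mul ((hasDerivAt_const x (1:ℝ)).sub ((h.diff x).div_const (r z))))
    have hm : MonotoneOn (fun y => (1 - ε / 2) * y - y * (1 - r y / r z)) (Set.Icc z p) := by
      apply monotoneOn_of_deriv_nonneg (convex_Icc z p)
        (fun x _ => (hd x).continuousAt.continuousWithinAt)
        (fun x _ => (hd x).differentiableAt.differentiableWithinAt)
      intro x hx
      rw [interior_Icc] at hx
      rw [(hd x).deriv]
      have hx0 : 0 < x := hz.trans hx.1
      have h1 := h.elas.antitoneOn (Set.mem_Ioi.2 hx0) (Set.mem_Ioi.2 (hx0.trans hx.2)) hx.2.le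
      try simp only at h1
      have hrx := h.pos x
      have h2 : ε - 1 ≤ x * deriv r x / r x := by linarith
      rw [le_div_iff₀ hrx] at h2
      have h3 : r p ≤ r x := h.anti.antitoneOn hx0.le (hx0.trans hx.2).le hx.2.le
      have e : (1 - ε / 2) * 1 - (1 * (1 - r x / r z) + x * (0 - deriv r x / r z))
        = (r x + x * deriv r x - ε / 2 * r z) / r z := by field_simp; ring
      rw [e]
      apply div_nonneg _ hrz.le
      nlinarith
    have hm1 := hm (Set.left_mem_Icc.2 hpz) (Set.right_mem_Icc.2 hpz) hpz
    try simp only at hm1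
    rw [div_self hrz.ne'] at hm1
    have e5 : w = p - 2 * (p * (1 - r p / r z)) := by rw [hw]; ring
    have h6 : z - w ≤ (1 - κ) * (p - z) := by
      have : (1 - ε) * (p - z) ≤ (1 - κ) * (p - z) :=
        mul_le_mul_of_nonneg_right (by linarith) (by linarith)
      rw [e5]; linarith
    have h7 := mul_le_mul_of_nonneg_left h6 hg0
    have h8 := mul_le_mul_of_nonneg_left t2 (show 0 ≤ 1 - κ by linarith)
    have key : (r z)⁻¹ - (r w)⁻¹ ≤ (1 - κ) * ((r p)⁻¹ - (r z)⁻¹) := by linarith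
    have := mul_le_mul_of_nonneg_left key hrz.le
    linarith

set_option maxHeartbeats 2000000 in
/-- invariant region for the dynamics -/
lemma Good.invariant {r : ℝ → ℝ} (h : Good r) {η c : ℝ} (hη : 0 < η) (hη1 : η < 1 / 100)
    (hc : 1 / 2 ≤ c) {p q : ℕ → ℝ} (hdyn : LinDyn r η p q) (hp0 : |p 0| ≤ 1)
    (hq0 : c < q 0) (hq1 : q 0 ≤ 1) (t : ℕ) :
    |p t| ≤ 4 ∧ c < q t ∧ 1 / 2 - 200 * η ^ 2 + 8 * η ^ 2 * (p t) ^ 2 ≤ (q t)⁻¹ := by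
  have hη2 : η ^ 2 < 1 / 10000 := by nlinarith
  have hη0 : 0 < η ^ 2 := by positivity
  induction t with
  | zero =>
    refine ⟨by linarith, hq0, ?_⟩
    have h1 : 1 ≤ (q 0)⁻¹ := (one_le_inv₀ (by linarith)).2 hq1
    have h2 : (p 0) ^ 2 ≤ 1 := by rw [← sq_abs]; nlinarith [abs_nonneg (p 0)]
    nlinarith
  | succ t ih =>
    obtain ⟨hp, hq, hJ⟩ := ih
    obtain ⟨hdp, hdq⟩ := hdyn
    rw [hdp t, hdq t]
    have har := h.bound_one (p t)
    have hrp := h.pos (p t)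
    have hr1 := h.le_one (p t)
    generalize r (p t) = R at *
    generalize p t = P at *
    generalize q t = Q at *
    clear hdp hdq
    have hQ : 0 < Q := by linarith
    have hP2 : P ^ 2 ≤ 16 := by rw [← sq_abs]; nlinarith [abs_nonneg P]
    have hPR2 : P ^ 2 * R ^ 2 ≤ 1 := by
      rw [← mul_pow, ← sq_abs]; nlinarith [abs_nonneg (P * R)]
    have hP0 : 0 ≤ P ^ 2 := sq_nonneg P
    have hQ4 : Q ≤ 4 := by
      have : (1 / 4 : ℝ) ≤ Q⁻¹ := by nlinarith [mul_nonneg hη0.le hP0]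
      have := inv_anti₀ (by norm_num) this
      rw [inv_inv] at this
      linarith
    -- coefficient
    have hc1 : η ^ 2 * P ^ 2 * R ^ 2 ≤ R / Q := by
      rw [le_div_iff₀ hQ]
      have h1 : P ^ 2 * Q ≤ 64 := by nlinarith
      have h1' : R * (P ^ 2 * Q) ≤ 64 := by
        have : R * (P ^ 2 * Q) ≤ 1 * (P ^ 2 * Q) :=
          mul_le_mul_of_nonneg_right hr1 (by positivity)
        linarith
      have h2 : η ^ 2 * (R * (P ^ 2 * Q)) ≤ 1 := by
        have : 0 ≤ R * (P ^ 2 * Q) := by positivity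
        nlinarith
      nlinarith
    have hc0 : 0 ≤ η ^ 2 * P ^ 2 * R ^ 2 := by positivity
    have hRQ0 : 0 < R / Q := by positivity
    have hrw : 2 * R / Q = 2 * (R / Q) := by ring
    set a := 1 - 2 * R / Q + η ^ 2 * P ^ 2 * R ^ 2 with ha
    have ha1 : a ≤ 1 - R / Q := by rw [ha, hrw]; linarith
    have hap : |a * P| ≤ 4 := by
      rw [abs_mul]
      rcases le_total 0 a with h0 | h0
      · rw [abs_of_nonneg h0]
        have : a ≤ 1 := by linarith
        nlinarith [abs_nonneg P]
      · rw [abs_of_nonpos h0]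
        have h1 : -a ≤ 2 * (R / Q) := by rw [ha, hrw]; linarith
        have h2 : -a * |P| ≤ 2 * (R / Q) * |P| := mul_le_mul_of_nonneg_right h1 (abs_nonneg P)
        have h3 : 2 * (R / Q) * |P| = 2 * (|P| * R) / Q := by ring
        rw [h3] at h2
        rw [abs_mul, abs_of_pos hrp] at har
        refine h2.trans ?_
        rw [div_le_iff₀ hQ]
        linarith
    set e := η ^ 2 * P ^ 2 * R * (2 * Q - R) with he
    have he0 : 0 ≤ e := by
      apply mul_nonneg (by positivity); linarith
    have he1 : e < 1 := by
      have h1 : P ^ 2 * R ≤ 16 := by nlinarith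
      have h2 : P ^ 2 * R * (2 * Q - R) ≤ 16 * 8 := by
        apply mul_le_mul h1 (by linarith) (by linarith) (by norm_num)
      have : 0 ≤ P ^ 2 * R * (2 * Q - R) := mul_nonneg (by positivity) (by linarith)
      have e1 : e = η ^ 2 * (P ^ 2 * R * (2 * Q - R)) := by rw [he]; ring
      rw [e1]; nlinarith
    have hinv : 1 ≤ (1 - e)⁻¹ := (one_le_inv₀ (by linarith)).2 (by linarith)
    refine ⟨hap, by nlinarith, ?_⟩
    have e2 : ((1 - e)⁻¹ * Q)⁻¹ = Q⁻¹ - 2 * η ^ 2 * P ^ 2 * R + η ^ 2 * P ^ 2 * R ^ 2 / Q := by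
      rw [mul_inv, inv_inv, he]; field_simp; ring
    rw [e2]
    have h9 : 0 ≤ η ^ 2 * P ^ 2 * R ^ 2 / Q := by positivity
    have hPR : P ^ 2 * R ≤ 16 := by nlinarith
    have hPR0 : 0 ≤ P ^ 2 * R := by positivity
    rcases le_total 2 Q with h2 | h2
    · have ha0 : 0 ≤ a := by
        have : R / Q ≤ 1 / 2 := by rw [div_le_iff₀ hQ]; linarith
        rw [ha, hrw]; linarith
      have ha2 : a ≤ 1 - R / 4 := by
        have : R / 4 ≤ R / Q := div_le_div_of_nonneg_left hrp.le hQ hQ4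
        linarith
      have ha3 : a ^ 2 ≤ 1 - R / 4 := by nlinarith
      have h5 : (a * P) ^ 2 ≤ (1 - R / 4) * P ^ 2 := by
        rw [mul_pow]; exact mul_le_mul_of_nonneg_right ha3 hP0
      have h6 := mul_le_mul_of_nonneg_left h5 hη0.le
      nlinarith
    · have h3 : (1 / 2 : ℝ) ≤ Q⁻¹ := by
        have := inv_anti₀ hQ h2
        linarith
      have h4 : (a * P) ^ 2 ≤ 16 := by rw [← sq_abs]; nlinarith [abs_nonneg (a * P)]
      have h5 := mul_le_mul_of_nonneg_left h4 hη0.le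
      have h6 := mul_le_mul_of_nonneg_left hPR hη0.le
      linarith

/-- The set of values below `zZero` has elasticity at least `-1/2`. -/
lemma Good.elas_of_lt {r : ℝ → ℝ} (h : Good r) {z : ℝ} (hz : 0 < z) (hc : cZero r < r z) :
    -(1 / 2) ≤ z * deriv r z / r z := by
  have hmem : (0 : ℝ) ∈ {z : ℝ | z * deriv r z / r z ≥ -(1 / 2)} := by simp
  have h0 : 0 ≤ zZero r := Real.sSup_nonneg' ⟨0, hmem, le_rfl⟩
  have hlt : z < zZero r := by
    by_contra hcon
    push Not at hcon
    have h1 : r z ≤ r (zZero r) := h.anti.antitoneOn h0 hz.le hcon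
    have h2 : r (zZero r) ≤ cZero r := le_max_left _ _
    linarith
  obtain ⟨y, hy, hzy⟩ := exists_lt_of_lt_csSup ⟨0, hmem⟩ hlt
  have h1 := h.elas (Set.mem_Ioi.2 hz) (Set.mem_Ioi.2 (hz.trans hzy)) hzy
  simp only [Set.mem_ofPred_eq] at h1 hy
  linarith

lemma Good.exists_eq {r : ℝ → ℝ} (h : Good r) {q : ℝ} (hq0 : 0 < q) (hq1 : q < 1) :
    ∃ z, 0 < z ∧ r z = q := by
  obtain ⟨b, hb, hb0⟩ := ((h.lim.eventually (gt_mem_nhds hq0)).and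
    (eventually_ge_atTop 0)).exists
  have := intermediate_value_Icc' hb0 h.cont1.continuous.continuousOn
  obtain ⟨z, hz, hz'⟩ := this ⟨hb.le, by rw [h.zero]; exact hq1.le⟩
  refine ⟨z, hz.1.lt_of_ne ?_, hz'⟩
  rintro rfl
  rw [h.zero] at hz'
  linarith

set_option maxHeartbeats 2000000 in
/-- One perturbed step, for positive `P`. -/
lemma Good.step {r : ℝ → ℝ} (h : Good r) {B K d κ κ' ε η P Q : ℝ}
    (hB : ∀ x, |x| ≤ 4 → (r x)⁻¹ ≤ B)
    (hK : ∀ x y, |x| ≤ 4 → |y| ≤ 4 → |(r x)⁻¹ - (r y)⁻¹| ≤ K * |x - y|) (hK0 : 0 ≤ K)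
    (hdκ : d ≤ κ) (hdε : d ≤ ε) (hd1 : d ≤ 1) (hε0 : 0 < ε)
    (hκ : ∀ x, 0 < x → r x ≤ κ' → κ ≤ -(x * deriv r x / r x))
    (hε : ∀ x, 0 < x → x ≤ 4 → ε ≤ 1 + x * deriv r x / r x)
    (hη : 0 < η) (hη1 : η < 1 / 100) (hP : 0 < P) (hP4 : P ≤ 4)
    (hQc : cZero r < Q) (hQ1 : Q < 1) (hQκ : Q ≤ κ') (hPκ : r P ≤ κ')
    (hs : Q < 2 * r P)
    (hap : |(1 - 2 * r P / Q + η ^ 2 * P ^ 2 * r P ^ 2) * P| ≤ 4) :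
    |((1 - η ^ 2 * P ^ 2 * r P * (2 * Q - r P))⁻¹ * Q) /
      r ((1 - 2 * r P / Q + η ^ 2 * P ^ 2 * r P ^ 2) * P) - 1|
      ≤ (1 - d) * |Q / r P - 1| + (6 * B + 4 * K) * η ^ 2 := by
  have hη2 : η ^ 2 < 1 / 10000 := by nlinarith
  have hη0 : 0 < η ^ 2 := by positivity
  have hQh : 1 / 2 < Q := lt_of_le_of_lt (le_max_right _ _) hQc
  have hQ0 : 0 < Q := by linarith
  have hR := h.pos P
  have hR1 := h.le_one P
  have hPR : P * r P ≤ 1 := (le_abs_self _).trans (h.bound_one P)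
  have hPR0 : 0 < P * r P := by positivity
  have hPR2 : (P * r P) ^ 2 ≤ 1 := by nlinarith
  -- main contraction
  have main : |Q / r ((2 * r P / Q - 1) * P) - 1| ≤ (1 - d) * |Q / r P - 1| := by
    obtain ⟨z, hz, rfl⟩ := h.exists_eq hQ0 hQ1
    rcases le_total P z with hPz | hPz
    · exact h.caseA hP hPz (h.elas_of_lt hz hQc) (hdκ.trans (hκ P hP hPκ)) hd1
    · exact h.caseB hz hPz hs.le (hdκ.trans (hκ z hz hQκ)) hd1 (hε P hP hP4) hdε hε0
  set w := (2 * r P / Q - 1) * P with hw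
  set p' := (1 - 2 * r P / Q + η ^ 2 * P ^ 2 * r P ^ 2) * P with hp'
  have hw4 : |w| ≤ 4 := by
    have h1 : 0 ≤ w := by
      apply mul_nonneg _ hP.le
      rw [sub_nonneg, le_div_iff₀ hQ0]; linarith
    rw [abs_of_nonneg h1]
    have h2 : w = 2 * (P * r P) / Q - P := by rw [hw]; ring
    have h3 : 2 * (P * r P) / Q ≤ 4 := by rw [div_le_iff₀ hQ0]; linarith
    linarith
  have hg : |(r p')⁻¹ - (r w)⁻¹| ≤ K * (4 * η ^ 2) := by
    rw [← h.even p']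
    refine (hK _ _ (by rwa [abs_neg]) hw4).trans ?_
    apply mul_le_mul_of_nonneg_left _ hK0
    have e : -p' - w = -(η ^ 2 * ((P * r P) ^ 2 * P)) := by rw [hp', hw]; ring
    rw [e, abs_neg, abs_of_nonneg (by positivity)]
    have : (P * r P) ^ 2 * P ≤ 1 * 4 := mul_le_mul hPR2 hP4 hP.le (by norm_num)
    nlinarith
  set e := η ^ 2 * P ^ 2 * r P * (2 * Q - r P) with he
  have he3 : |e| ≤ 3 * η ^ 2 := by
    have e1 : e = η ^ 2 * (P * r P * (P * (2 * Q - r P))) := by rw [he]; ring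
    rw [e1, abs_mul, abs_of_pos hη0, abs_mul, abs_of_pos hPR0]
    have h2 : |P * (2 * Q - r P)| ≤ 3 * (P * r P) := by
      rw [abs_le]; constructor <;> nlinarith
    have h3 : P * r P * |P * (2 * Q - r P)| ≤ P * r P * (3 * (P * r P)) :=
      mul_le_mul_of_nonneg_left h2 hPR0.le
    nlinarith
  have he2 := abs_le.1 he3
  have h1e : 1 / 2 < 1 - e := by linarith [he2.2]
  have hq : |(1 - e)⁻¹ * Q - Q| ≤ 6 * η ^ 2 := by
    have e1 : (1 - e)⁻¹ * Q - Q = Q * (e / (1 - e)) := by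
      have : (1 - e) ≠ 0 := by linarith
      field_simp; ring
    rw [e1, abs_mul, abs_div, abs_of_pos hQ0, abs_of_pos (show 0 < 1 - e by linarith)]
    have : |e| / (1 - e) ≤ 6 * η ^ 2 := by
      rw [div_le_iff₀ (by linarith)]; nlinarith
    have h0 : 0 ≤ |e| / (1 - e) := div_nonneg (abs_nonneg e) (by linarith)
    exact (mul_le_of_le_one_left h0 hQ1.le).trans this
  have hp'0 : 0 < (r p')⁻¹ := inv_pos.2 (h.pos p')
  have hb := hB p' hap
  have e5 : (1 - e)⁻¹ * Q / r p' - 1 = (Q / r w - 1) + (((1 - e)⁻¹ * Q - Q) * (r p')⁻¹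
      + Q * ((r p')⁻¹ - (r w)⁻¹)) := by ring
  rw [e5]
  refine (abs_add_le _ _).trans (add_le_add main ((abs_add_le _ _).trans ?_))
  rw [abs_mul, abs_mul, abs_of_pos hp'0, abs_of_pos hQ0]
  have k1 : |(1 - e)⁻¹ * Q - Q| * (r p')⁻¹ ≤ 6 * η ^ 2 * B :=
    mul_le_mul hq hb hp'0.le (by positivity)
  have k2 : Q * |(r p')⁻¹ - (r w)⁻¹| ≤ 1 * (K * (4 * η ^ 2)) :=
    mul_le_mul hQ1.le hg (abs_nonneg _) (by norm_num)
  linarith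

/-- One-step contraction of `|s_t - 1|`. -/
theorem eos_s_contraction_linear (l r : ℝ → ℝ) (δ : ℝ)
    (hL : AssumptionL l)
    (hr0 : r 0 = 1) (hrdef : ∀ x : ℝ, x ≠ 0 → r x = deriv l x / x)
    (hR : AssumptionR r) (hR2 : AssumptionR2 r)
    (hδ : δ ∈ Set.Ioo 0 (1 - cZero r)) :
    ∃ η₀ > (0 : ℝ), ∃ C > (0 : ℝ), ∃ d : ℝ, d ∈ Set.Ioc (0 : ℝ) (1 / 2) ∧
      ∀ η : ℝ, 0 < η → η < η₀ →
        ∀ p q : ℕ → ℝ, LinDyn r η p q →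
          |p 0| ≤ 1 → q 0 ∈ Set.Ioo (cZero r) (1 - δ) →
          (∀ t : ℕ, q t < 1 → p t ≠ 0) →
          ∀ t : ℕ, q t ≤ 1 - δ / 2 →
            q t / r (p t) < 2 * (1 + η ^ 2)⁻¹ →
            |q t / r (p t) - 1| > η ^ 2 / 2 →
            r (p t) ≤ 1 - δ / 4 →
            |q (t + 1) / r (p (t + 1)) - 1| ≤ (1 - d) * |q t / r (p t) - 1| + C * η ^ 2 := by
  have h := good_of l r hL hr0 hrdef hR hR2
  have hδ0 := hδ.1
  have hδ1 := hδ.2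
  have hch : 1 / 2 ≤ cZero r := le_max_right _ _
  obtain ⟨x₁, hx₁, hrx₁⟩ := h.exists_eq (q := 1 - δ / 4) (by linarith) (by linarith)
  -- constants
  obtain ⟨κ, hκ0, hκ⟩ : ∃ κ > 0, ∀ x, 0 < x → r x ≤ 1 - δ / 4 →
      κ ≤ -(x * deriv r x / r x) := by
    refine ⟨-(x₁ * deriv r x₁ / r x₁), ?_, ?_⟩
    · rw [← neg_div, ← mul_neg]
      have := h.dneg x₁ hx₁
      exact div_pos (mul_pos hx₁ (by linarith)) (h.pos _)
    · intro x hx hrx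
      have hle : x₁ ≤ x := by
        by_contra hcon
        push Not at hcon
        have := h.anti hx.le hx₁.le hcon
        linarith
      have := h.elas.antitoneOn (Set.mem_Ioi.2 hx₁) (Set.mem_Ioi.2 hx) hle
      try simp only at this
      linarith
  obtain ⟨ε, hε0, hε⟩ : ∃ ε > 0, ∀ x, 0 < x → x ≤ 4 → ε ≤ 1 + x * deriv r x / r x := by
    refine ⟨1 + 4 * deriv r 4 / r 4, ?_, ?_⟩
    · have h1 := h.elas (a := 4) (b := 5) (by simp) (by simp) (by norm_num)
      try simp only at h1
      have h2 : -1 ≤ 5 * deriv r 5 / r 5 := by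
        rw [le_div_iff₀ (h.pos 5)]
        linarith [h.mono 5 (by norm_num)]
      linarith
    · intro x hx hx4
      have := h.elas.antitoneOn (Set.mem_Ioi.2 hx) (b := 4) (by simp) hx4
      try simp only at this
      linarith
  have hB : ∀ x, |x| ≤ 4 → (r x)⁻¹ ≤ (r 4)⁻¹ := by
    intro x hx
    have e : r x = r |x| := by
      rcases abs_choice x with h' | h' <;> rw [h']
      exact (h.even x).symm
    rw [e]
    exact inv_anti₀ (h.pos 4) (h.anti.antitoneOn (abs_nonneg x) (by simp) hx)
  have hB0 : 0 < (r 4)⁻¹ := inv_pos.2 (h.pos 4)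
  obtain ⟨K, hK0, hK⟩ : ∃ K, 0 ≤ K ∧ ∀ x y, |x| ≤ 4 → |y| ≤ 4 →
      |(r x)⁻¹ - (r y)⁻¹| ≤ K * |x - y| := by
    refine ⟨|deriv r 4 / r 4 ^ 2| + |deriv r (-4) / r (-4) ^ 2|, by positivity, ?_⟩
    have key : ∀ x y, |x| ≤ 4 → |y| ≤ 4 → x ≤ y → |(r x)⁻¹ - (r y)⁻¹| ≤
        (|deriv r 4 / r 4 ^ 2| + |deriv r (-4) / r (-4) ^ 2|) * |x - y| := by
      intro x y hx hy hxy
      obtain ⟨t1, t2⟩ := h.tangent hxy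
      rw [abs_le] at hx hy
      have g1 := h.gconv.antitone hx.1
      have g2 := h.gconv.antitone hy.2
      try simp only at g1 g2
      rw [abs_sub_comm, abs_sub_comm x y, abs_of_nonneg (show 0 ≤ y - x by linarith)]
      have a1 := neg_abs_le (deriv r 4 / r 4 ^ 2)
      have a2 := abs_nonneg (deriv r 4 / r 4 ^ 2)
      have a3 := le_abs_self (deriv r (-4) / r (-4) ^ 2)
      have a4 := abs_nonneg (deriv r (-4) / r (-4) ^ 2)
      rw [abs_le]
      constructor
      · refine le_trans ?_ t1
        rw [← neg_mul]
        apply mul_le_mul_of_nonneg_right <;> linarith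
      · refine t2.trans ?_
        apply mul_le_mul_of_nonneg_right <;> linarith
    intro x y hx hy
    rcases le_total x y with hxy | hxy
    · exact key x y hx hy hxy
    · rw [abs_sub_comm, abs_sub_comm x y]
      exact key y x hy hx hxy
  refine ⟨1 / 100, by norm_num, 6 * (r 4)⁻¹ + 4 * K, by positivity, min (1 / 2) (min κ ε),
    ⟨by positivity, min_le_left _ _⟩, ?_⟩
  intro η hη hη1 p q hdyn hp0 hq0 hpne t hqt hs _ hrt
  have inv := fun t => h.invariant hη hη1 hch hdyn hp0 hq0.1 (by linarith [hq0.2]) t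
  obtain ⟨hpt, hqc, -⟩ := inv t
  have hp1 := (inv (t + 1)).1
  have hne := hpne t (by linarith)
  have hs2 : q t < 2 * r (p t) := by
    have h1 : (1 + η ^ 2)⁻¹ ≤ 1 := inv_le_one_of_one_le₀ (by nlinarith)
    rw [← div_lt_iff₀ (h.pos _)]
    linarith
  rw [hdyn.1 t] at hp1
  rw [hdyn.1 t, hdyn.2 t]
  have st := fun P hP hP4 => h.step (P := P) (Q := q t) (η := η) (d := min (1 / 2) (min κ ε)) hB hK hK0
    ((min_le_right _ _).trans (min_le_left _ _)) ((min_le_right _ _).trans (min_le_right _ _))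
    ((min_le_left _ _).trans (by norm_num)) hε0 hκ hε hη hη1 hP hP4 hqc (by linarith)
    (by linarith)
  rcases lt_or_gt_of_ne hne with hneg | hpos
  · have := st (-p t) (by linarith) (by linarith [neg_abs_le (p t)])
    simp only [h.even, neg_sq, mul_neg, abs_neg] at this
    exact this hrt hs2 hp1
  · exact st (p t) hpos ((le_abs_self _).trans hpt) hrt hs2 hp1
end
end
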